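/- (Zhou) Let (R,m) be an unramified regular local ring of mixed characteristic (0,p), and let I be an ideal of R. Then for all integers i, j: injdim_R(H^j_I(R)) ≤ dim(Supp_R(H^j_I(R))) + 1, and injdim_R(H^i_m(H^j_I(R))) ≤ 1. -/

import Mathlib

open CategoryTheory

namespace ZhouLC
open Abelian Limits

section OldExt

theorem unop_transport {V : Type*} [Category V] {KA LA A B : Vᵒᵖ} {KU LU : V}
    (k : KA ≅ Opposite.op KU) (l : LA ≅ Opposite.op LU) (ψ : KA ⟶ LA) (ψ' : LU ⟶ KU)
    (h : ψ ≫ l.hom = k.hom ≫ ψ'.op) (a : A ≅ KA) (b : B ≅ LA) (u : A ⟶ B)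
    (hu : u ≫ b.hom = a.hom ≫ ψ) :
    u.unop ≫ a.inv.unop ≫ k.inv.unop = (b.inv.unop ≫ l.inv.unop) ≫ ψ' := by
  apply Quiver.Hom.op_inj
  have h1 : ψ'.op = k.inv ≫ ψ ≫ l.hom := by rw [h]; simp
  have h2 : u = a.hom ≫ ψ ≫ b.inv := by rw [← Category.assoc, ← hu]; simp
  simp only [op_comp, h1, h2]
  simp

theorem homologyUnop_transport {V : Type*} [Category V] [Abelian V] {ι : Type*} {c : ComplexShape ι}
    {K L : HomologicalComplex Vᵒᵖ c} (ψ : K ⟶ L) (i : ι) {A B : Vᵒᵖ} (a : A ≅ K.homology i)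
    (b : B ≅ L.homology i) (u : A ⟶ B)
    (hu : u ≫ b.hom = a.hom ≫ HomologicalComplex.homologyMap ψ i) :
    u.unop ≫ (a.unop.symm ≪≫ (HomologicalComplex.homologyUnop K i).symm).hom =
      (b.unop.symm ≪≫ (HomologicalComplex.homologyUnop L i).symm).hom ≫
        HomologicalComplex.homologyMap ((HomologicalComplex.unopFunctor V c).map ψ.op) i :=
  unop_transport (K.unop.homologyOp i) (L.unop.homologyOp i) _ _
    (HomologicalComplex.homologyOp_hom_naturality (i := i)
      ((HomologicalComplex.unopFunctor V c).map ψ.op)) a b u hu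

variable {R : Type} [CommRing R] {X X' Y : ModuleCat.{0} R}

/-- The map on complexes of linear maps induced by a morphism of chain complexes. -/
noncomputable abbrev yonedaMap {P Q : ChainComplex (ModuleCat.{0} R) ℕ} (φ : P ⟶ Q)
    (Y : ModuleCat.{0} R) : Q.linearYonedaObj R Y ⟶ P.linearYonedaObj R Y :=
  (HomologicalComplex.unopFunctor _ _).map
      ((((linearYoneda R (ModuleCat.{0} R)).obj Y).rightOp.mapHomologicalComplex _).map φ).op

theorem isoExt_naturality (P : ProjectiveResolution X) (Q : ProjectiveResolution X') (n : ℕ)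
    (f : X ⟶ X') (φ : P.complex ⟶ Q.complex) (comm : φ.f 0 ≫ Q.π.f 0 = P.π.f 0 ≫ f) :
    ((_root_.Ext R (ModuleCat.{0} R) n).map f.op).app Y ≫ (P.isoExt n Y).hom =
     (Q.isoExt n Y).hom ≫ HomologicalComplex.homologyMap (yonedaMap φ Y) n :=
  homologyUnop_transport _ _ _ _ _ (P.isoLeftDerivedObj_hom_naturality f Q φ comm
    ((linearYoneda R (ModuleCat.{0} R)).obj Y).rightOp n)

/-- The linear equivalence between two quotients of the same module with the same kernel. -/
noncomputable def equivOfKerEq {Z A B : Type*} [AddCommGroup Z] [AddCommGroup A] [AddCommGroup B]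
    [Module R Z]
    [Module R A] [Module R B] (a : Z →ₗ[R] A) (b : Z →ₗ[R] B) (ha : Function.Surjective a)
    (hb : Function.Surjective b) (h : LinearMap.ker a = LinearMap.ker b) : A ≃ₗ[R] B :=
  (a.quotKerEquivOfSurjective ha).symm ≪≫ₗ Submodule.quotEquivOfEq _ _ h ≪≫ₗ
    b.quotKerEquivOfSurjective hb

theorem equivOfKerEq_apply {Z A B : Type*} [AddCommGroup Z] [AddCommGroup A] [AddCommGroup B]
    [Module R Z] [Module R A] [Module R B] (a : Z →ₗ[R] A) (b : Z →ₗ[R] B)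
    (ha : Function.Surjective a) (hb : Function.Surjective b)
    (h : LinearMap.ker a = LinearMap.ker b) (z : Z) : equivOfKerEq a b ha hb h (a z) = b z := by
  have : (a.quotKerEquivOfSurjective ha).symm (a z) = Submodule.Quotient.mk z := by
    rw [LinearEquiv.symm_apply_eq]; rfl
  simp only [equivOfKerEq, LinearEquiv.trans_apply, this]
  rfl

theorem hom_congr {A B : ModuleCat.{0} R} {f g : A ⟶ B} (h : f = g) (x : A) : f x = g x := by
  rw [h]

section Cocycles

variable (K : CochainComplex (ModuleCat.{0} R) ℕ) (n : ℕ)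

/-- The homology class of a cocycle. -/
noncomputable def classMap : LinearMap.ker (K.d n (n + 1)).hom →ₗ[R] K.homology n :=
  (K.liftCycles (ModuleCat.ofHom (LinearMap.ker (K.d n (n + 1)).hom).subtype) (n + 1) (by simp)
    (by ext x; exact x.2) ≫ K.homologyπ n).hom

theorem classMap_of_cycles (z : K.cycles n)
    (hz : (K.iCycles n) z ∈ LinearMap.ker (K.d n (n + 1)).hom) :
    classMap K n ⟨K.iCycles n z, hz⟩ = K.homologyπ n z := by
  simp only [classMap, ModuleCat.hom_comp, LinearMap.comp_apply]
  congr 1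
  apply (ModuleCat.mono_iff_injective (K.iCycles n)).1 inferInstance
  exact hom_congr (K.liftCycles_i (ModuleCat.ofHom (LinearMap.ker (K.d n (n + 1)).hom).subtype)
    (n + 1) (by simp) (by ext x; exact x.2)) _

theorem classMap_surjective : Function.Surjective (classMap K n) := by
  intro h
  obtain ⟨z, rfl⟩ := (ModuleCat.epi_iff_surjective (K.homologyπ n)).1 inferInstance h
  refine ⟨⟨K.iCycles n z, ?_⟩, classMap_of_cycles K n z _⟩
  rw [LinearMap.mem_ker, ← LinearMap.comp_apply, ← ModuleCat.hom_comp, K.iCycles_d]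
  rfl

theorem exists_cycles (x : LinearMap.ker (K.d n (n + 1)).hom) :
    ∃ z : K.cycles n, K.iCycles n z = x.1 := by
  refine ⟨(K.liftCycles (ModuleCat.ofHom (LinearMap.ker (K.d n (n + 1)).hom).subtype) (n + 1)
    (by simp) (by ext x; exact x.2)).hom x, ?_⟩
  exact hom_congr (K.liftCycles_i (ModuleCat.ofHom (LinearMap.ker (K.d n (n + 1)).hom).subtype)
    (n + 1) (by simp) (by ext x; exact x.2)) x

theorem classMap_eq_zero_iff (x : LinearMap.ker (K.d n (n + 1)).hom) :
    classMap K n x = 0 ↔ ∃ y : K.X ((ComplexShape.up ℕ).prev n), K.d _ n y = x.1 := by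
  obtain ⟨z, hz⟩ := exists_cycles K n x
  have hx : x = ⟨K.iCycles n z, by rw [hz]; exact x.2⟩ := Subtype.ext hz.symm
  rw [hx, classMap_of_cycles]
  have ex := ShortComplex.exact_of_g_is_cokernel
    (ShortComplex.mk _ _ (K.toCycles_comp_homologyπ ((ComplexShape.up ℕ).prev n) n))
    (K.homologyIsCokernel _ n rfl)
  rw [ShortComplex.moduleCat_exact_iff] at ex
  constructor
  · intro h
    obtain ⟨y, hy⟩ := ex z h
    refine ⟨y, ?_⟩
    change _ = K.iCycles n z
    rw [← hy]
    exact congrArg (fun f => f.hom y) (K.toCycles_i _ n).symm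
  · rintro ⟨y, hy⟩
    have : z = K.toCycles _ n y := by
      apply (ModuleCat.mono_iff_injective (K.iCycles n)).1 inferInstance
      refine hy.symm.trans ?_
      exact congrArg (fun f => f.hom y) (K.toCycles_i _ n).symm
    rw [this]
    exact congrArg (fun f => f.hom y) (K.toCycles_comp_homologyπ _ n)

variable {K n} in
theorem homologyMap_classMap {L : CochainComplex (ModuleCat.{0} R) ℕ} (φ : K ⟶ L)
    (x : LinearMap.ker (K.d n (n + 1)).hom) (y : LinearMap.ker (L.d n (n + 1)).hom)
    (h : (φ.f n) x.1 = y.1) :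
    HomologicalComplex.homologyMap φ n (classMap K n x) = classMap L n y := by
  obtain ⟨z, hz⟩ := exists_cycles K n x
  have hx : x = ⟨K.iCycles n z, by rw [hz]; exact x.2⟩ := Subtype.ext hz.symm
  have hy' : y.1 = L.iCycles n (HomologicalComplex.cyclesMap φ n z) := by
    rw [← h, ← hz]
    exact congrArg (fun f => f.hom z) (HomologicalComplex.cyclesMap_i φ n).symm
  have hy : y = ⟨L.iCycles n (HomologicalComplex.cyclesMap φ n z), by rw [← hy']; exact y.2⟩ :=
    Subtype.ext hy'
  rw [hx, hy, classMap_of_cycles, classMap_of_cycles]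
  exact congrArg (fun f => f.hom z) (HomologicalComplex.homologyπ_naturality φ n)

end Cocycles

section Compare

variable (P : ProjectiveResolution X) (Q : ProjectiveResolution X') (Y) (n : ℕ)

theorem extMk_zero_eq_zero (f : P.complex.X 0 ⟶ Y) (hf : P.complex.d 1 0 ≫ f = 0)
    (h : P.extMk f 1 rfl hf = 0) : f = 0 := by
  rw [← P.extEquivCohomologyClass.apply_eq_iff_eq,
    P.extEquivCohomologyClass_extMk, P.extEquivCohomologyClass_zero,
    CochainComplex.HomComplex.CohomologyClass.mk_eq_zero_iff,
    CochainComplex.HomComplex.Cocycle.toSingleMk_mem_coboundaries_iff _ _ _ _ _ 1 (by lia)] at h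
  obtain ⟨g, hg⟩ := h
  have h0 : IsZero (P.cochainComplex.X 1) :=
    CochainComplex.isZero_of_isStrictlyLE P.cochainComplex 0 1 (by lia)
  have : P.cochainComplex.d (-((0 : ℕ) : ℤ)) 1 = 0 := h0.eq_of_tgt _ _
  have h2 : (P.cochainComplexXIso (-((0 : ℕ) : ℤ)) 0 rfl).hom ≫ f = 0 := by
    rw [← hg, h0.eq_of_src g 0, comp_zero]
  rwa [← cancel_epi (P.cochainComplexXIso (-((0 : ℕ) : ℤ)) 0 rfl).hom, comp_zero]

/-- The class in `Abelian.Ext` of a cocycle. -/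
noncomputable def extClassMap :
    LinearMap.ker ((P.complex.linearYonedaObj R Y).d n (n + 1)).hom →ₗ[R] Abelian.Ext X Y n where
  toFun f := P.extMk (Y := Y) f.1 (n + 1) rfl f.2
  map_add' f g := (P.add_extMk (Y := Y) f.1 g.1 (n + 1) rfl f.2 g.2).symm
  map_smul' r f := by
    have key (g : P.complex.X n ⟶ Y) (hg : P.complex.d (n + 1) n ≫ g = 0)
        (hg' : P.complex.d (n + 1) n ≫ (r • g) = 0) :
        P.extMk (r • g) (n + 1) rfl hg' = r • P.extMk g (n + 1) rfl hg := by
      rw [Abelian.Ext.smul_eq_comp_mk₀, P.extMk_comp_mk₀]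
      congr 1
    exact key f.1 f.2 _

theorem extClassMap_surjective : Function.Surjective (extClassMap Y P n) := by
  intro α
  obtain ⟨f, hf, h⟩ := P.extMk_surjective α (n + 1) rfl
  exact ⟨⟨f, hf⟩, h⟩

theorem ker_classMap_eq : LinearMap.ker (classMap (P.complex.linearYonedaObj R Y) n) =
    LinearMap.ker (extClassMap Y P n) := by
  ext x
  rw [LinearMap.mem_ker, LinearMap.mem_ker, classMap_eq_zero_iff]
  cases n with
  | zero =>
    constructor
    · rintro ⟨y, hy⟩
      have : (P.complex.linearYonedaObj R Y).d ((ComplexShape.up ℕ).prev 0) 0 = 0 :=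
        HomologicalComplex.shape _ _ _ (by simp)
      rw [this] at hy
      have : x = 0 := Subtype.ext hy.symm
      rw [this, map_zero]
    · intro h
      exact ⟨0, by rw [map_zero]; exact (extMk_zero_eq_zero Y P x.1 x.2 h).symm⟩
  | succ m =>
    have := P.extMk_eq_zero_iff (Y := Y) x.1 (m + 2) rfl x.2 m rfl
    have e : (ComplexShape.up ℕ).prev (m + 1) = m := by simp
    rw [e]
    exact this.symm

/-- Comparison between the two definitions of `Ext`. -/
noncomputable def extCompare : ((_root_.Ext R (ModuleCat.{0} R) n).obj (Opposite.op X)).obj Y ≃ₗ[R]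
    Abelian.Ext X Y n :=
  (P.isoExt n Y).toLinearEquiv ≪≫ₗ
    equivOfKerEq (classMap (P.complex.linearYonedaObj R Y) n) (extClassMap Y P n)
      (classMap_surjective _ _) (extClassMap_surjective _ _ _) (ker_classMap_eq _ _ _)

theorem extCompare_eq (a : ((_root_.Ext R (ModuleCat.{0} R) n).obj (Opposite.op X)).obj Y)
    (w : LinearMap.ker ((P.complex.linearYonedaObj R Y).d n (n + 1)).hom)
    (h : (P.isoExt n Y).hom a = classMap _ n w) :
    extCompare Y P n a = extClassMap Y P n w := by
  refine Eq.trans ?_ (equivOfKerEq_apply (classMap (P.complex.linearYonedaObj R Y) n)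
      (extClassMap Y P n) (classMap_surjective _ _) (extClassMap_surjective _ _ _)
      (ker_classMap_eq _ _ _) w)
  rw [← h]
  rfl

variable {P Q} in
theorem extCompare_naturality (f : X ⟶ X') (φ : P.Hom Q f)
    (a : ((_root_.Ext R (ModuleCat.{0} R) n).obj (Opposite.op X')).obj Y) :
    extCompare Y P n (((_root_.Ext R (ModuleCat.{0} R) n).map f.op).app Y a) =
      (Abelian.Ext.mk₀ f).comp (extCompare Y Q n a) (zero_add _) := by
  have h1 := hom_congr (isoExt_naturality (Y := Y) P Q n f φ.hom φ.hom_f_zero_comp_π_f_zero) a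
  obtain ⟨w, hw⟩ := classMap_surjective _ n ((Q.isoExt n Y).hom a)
  have hd : ((yonedaMap φ.hom Y).f n) w.1 ∈
      LinearMap.ker ((P.complex.linearYonedaObj R Y).d n (n + 1)).hom := by
    have := hom_congr ((yonedaMap φ.hom Y).comm n (n + 1)) w.1
    refine this.trans ?_
    refine (congrArg ((yonedaMap φ.hom Y).f (n + 1)) w.2).trans ?_
    exact map_zero ((yonedaMap φ.hom Y).f (n + 1)).hom
  have h2 := homologyMap_classMap (yonedaMap φ.hom Y) w ⟨_, hd⟩ rfl
  rw [extCompare_eq Y Q n a w hw.symm, extCompare_eq Y P n _ ⟨_, hd⟩]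
  · exact (ProjectiveResolution.mk₀_comp_extMk w.1 (n + 1) rfl w.2 φ).symm
  · rw [← h2, hw]
    exact h1

end Compare

/-- Comparison between the two definitions of `Ext`. -/
noncomputable def extEquiv (X Y : ModuleCat.{0} R) (n : ℕ) :
    ((_root_.Ext R (ModuleCat.{0} R) n).obj (Opposite.op X)).obj Y ≃ₗ[R] Abelian.Ext X Y n :=
  extCompare Y (projectiveResolution X) n

theorem extEquiv_naturality (Y : ModuleCat.{0} R) (n : ℕ) (f : X ⟶ X')
    (a : ((_root_.Ext R (ModuleCat.{0} R) n).obj (Opposite.op X')).obj Y) :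
    extEquiv X Y n (((_root_.Ext R (ModuleCat.{0} R) n).map f.op).app Y a) =
      (Abelian.Ext.mk₀ f).comp (extEquiv X' Y n a) (zero_add _) :=
  extCompare_naturality Y n f
    { hom := ProjectiveResolution.lift f (projectiveResolution X) (projectiveResolution X')
      hom_f_zero_comp_π_f_zero :=
        (ProjectiveResolution.lift_commutes_zero f (projectiveResolution X)
          (projectiveResolution X')).trans (by simp) } a

end OldExt
end ZhouLC

namespace ZhouLC
open Abelian Limits

section LC
variable {R : Type} [CommRing R] (I : Ideal R)

/-- The module `R / I ^ t`. -/
abbrev S (t : ℕ) : ModuleCat.{0} R := ModuleCat.of R (R ⧸ I ^ t)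

/-- The projection `R / I ^ t' ⟶ R / I ^ t`. -/
def Sπ {t t' : ℕ} (h : t ≤ t') : S I t' ⟶ S I t :=
  ModuleCat.ofHom (Submodule.mapQ _ _ LinearMap.id (Ideal.pow_le_pow_right h))

variable (i : ℕ) (M : ModuleCat.{0} R)

/-- The structure map to the colimit. -/
noncomputable def lcι (t : ℕ) :
    (((_root_.Ext R (ModuleCat.{0} R) i).obj (Opposite.op (S I t))).obj M) ⟶
    (localCohomology I i).obj M :=
  (colimit.ι (localCohomology.diagram (localCohomology.idealPowersDiagram I) i)
    (Opposite.op (Opposite.op t))).app M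

theorem lcι_map {t t' : ℕ} (h : t ≤ t')
    (a : (((_root_.Ext R (ModuleCat.{0} R) i).obj (Opposite.op (S I t))).obj M)) :
    lcι I i M t'
    (((_root_.Ext R (ModuleCat.{0} R) i).map (Sπ I h).op).app M a) = lcι I i M t a := by
  have := colimit.w (localCohomology.diagram (localCohomology.idealPowersDiagram I) i) (homOfLE h).op.op
  exact hom_congr (congrArg (fun f => f.app M) this) a

/-- The evaluated cocone is a colimit. -/
noncomputable def lcIsColimit : IsColimit (((evaluation _ _).obj M).mapCocone
   (colimit.cocone (localCohomology.diagram (localCohomology.idealPowersDiagram I) i))) :=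
  isColimitOfPreserves ((evaluation _ _).obj M) (colimit.isColimit _)

theorem lcι_surj (x : (localCohomology I i).obj M) : ∃ t a, lcι I i M t a = x := by
  obtain ⟨j, a, h⟩ := Concrete.isColimit_exists_rep _ (lcIsColimit I i M) x
  exact ⟨j.unop.unop, a, h⟩

theorem lcι_eq_zero (t : ℕ) (a) (h : lcι I i M t a = 0) : ∃ t', ∃ h : t ≤ t',
   ((_root_.Ext R (ModuleCat.{0} R) i).map (Sπ I h).op).app M a = 0 := by
  obtain ⟨j, f, g, e⟩ := Concrete.isColimit_exists_of_rep_eq _ (lcIsColimit I i M) (i := Opposite.op (Opposite.op t)) (j := Opposite.op (Opposite.op t)) a 0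
    (h.trans (map_zero (lcι I i M t).hom).symm)
  refine ⟨j.unop.unop, leOfHom f.unop.unop, ?_⟩
  refine Eq.trans ?_ (e.trans ?_)
  · rfl
  · exact map_zero ((((localCohomology.diagram (localCohomology.idealPowersDiagram I) i)).map g).app M).hom

/-- The structure map to the colimit. -/
noncomputable def lcMap (t : ℕ) : Abelian.Ext (S I t) M i →ₗ[R] (localCohomology I i).obj M :=
  (lcι I i M t).hom ∘ₗ (extEquiv (S I t) M i).symm.toLinearMap

theorem lcMap_map {t t' : ℕ} (h : t ≤ t') (a : Abelian.Ext (S I t) M i) :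
    lcMap I i M t' ((Abelian.Ext.mk₀ (Sπ I h)).comp a (zero_add _)) = lcMap I i M t a := by
  obtain ⟨b, rfl⟩ := (extEquiv (S I t) M i).surjective a
  rw [← extEquiv_naturality]
  simp only [lcMap, LinearMap.comp_apply, LinearEquiv.coe_coe, LinearEquiv.symm_apply_apply]
  exact lcι_map I i M h b

theorem lcMap_surj (x : (localCohomology I i).obj M) : ∃ t a, lcMap I i M t a = x := by
  obtain ⟨t, a, h⟩ := lcι_surj I i M x
  exact ⟨t, extEquiv _ _ _ a, by simpa [lcMap] using h⟩

theorem lcMap_eq_zero_iff (t : ℕ) (a) : lcMap I i M t a = 0 ↔ ∃ t', ∃ h : t ≤ t',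
    (Abelian.Ext.mk₀ (Sπ I h)).comp a (zero_add _) = 0 := by
  constructor
  · intro h
    obtain ⟨t', h', e⟩ := lcι_eq_zero I i M t _ h
    refine ⟨t', h', ?_⟩
    have := extEquiv_naturality M i (Sπ I h') ((extEquiv (S I t) M i).symm a)
    rw [LinearEquiv.apply_symm_apply] at this
    exact this.symm.trans ((congrArg _ e).trans (map_zero _))
  · rintro ⟨t', h, e⟩
    rw [← lcMap_map I i M h, e, map_zero]

/-- Linear maps out of local cohomology. -/
theorem exists_lcDesc {N : Type} [AddCommGroup N] [Module R N]
    (G : ∀ t, Abelian.Ext (S I t) M i →ₗ[R] N)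
    (hG : ∀ t t' (h : t ≤ t') a, G t' ((Abelian.Ext.mk₀ (Sπ I h)).comp a (zero_add _)) = G t a) :
    ∃ F : (localCohomology I i).obj M →ₗ[R] N, ∀ t a, F (lcMap I i M t a) = G t a := by
  have key : ∀ t a t' a', lcMap I i M t a = lcMap I i M t' a' → G t a = G t' a' := by
    intro t a t' a' h
    have h1 := lcMap_map I i M (le_max_left t t') a
    have h2 := lcMap_map I i M (le_max_right t t') a'
    have h3 : lcMap I i M (max t t') ((Abelian.Ext.mk₀ (Sπ I (le_max_left t t'))).comp a (zero_add _) -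
      (Abelian.Ext.mk₀ (Sπ I (le_max_right t t'))).comp a' (zero_add _)) = 0 := by
      rw [map_sub, h1, h2, h, sub_self]
    rw [lcMap_eq_zero_iff] at h3
    obtain ⟨u, hu, e⟩ := h3
    have h4 := congrArg (G u) e
    rw [hG, map_zero, map_sub, hG, hG] at h4
    exact sub_eq_zero.mp h4
  choose T A hA using lcMap_surj I i M
  refine ⟨{ toFun := fun x => G (T x) (A x), map_add' := ?_, map_smul' := ?_ }, ?_⟩
  · intro x y
    rw [← hG _ _ (le_max_left (T x) (T y)), ← hG _ _ (le_max_right (T x) (T y)) (A y), ← map_add]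
    apply key
    rw [map_add, lcMap_map, lcMap_map, hA, hA, hA]
  · intro r x
    rw [RingHom.id_apply, ← map_smul]
    apply key
    rw [map_smul, hA, hA]
  · intro t a
    exact key _ _ _ _ (hA _)

end LC

section Recursion
variable {R : Type} [CommRing R] (I : Ideal R)

/-- The local cohomology module with support in `I`. -/
noncomputable abbrev LC (i : ℕ) (M : Type) [AddCommGroup M] [Module R M] : ModuleCat.{0} R :=
  (localCohomology I i).obj (ModuleCat.of R M)

/-- The torsion submodule. -/
def gam (M : Type) [AddCommGroup M] [Module R M] : Submodule R M where
  carrier := {m | ∃ t : ℕ, ∀ a ∈ I ^ t, a • m = 0}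
  add_mem' := by
    rintro x y ⟨t, ht⟩ ⟨u, hu⟩
    refine ⟨t + u, fun a ha => ?_⟩
    rw [smul_add, ht a (Ideal.pow_le_pow_right (by omega) ha),
      hu a (Ideal.pow_le_pow_right (by omega) ha), add_zero]
  zero_mem' := ⟨0, fun a _ => smul_zero a⟩
  smul_mem' := by
    rintro r x ⟨t, ht⟩
    exact ⟨t, fun a ha => by rw [smul_comm, ht a ha, smul_zero]⟩

variable {M E C : Type} [AddCommGroup M] [Module R M] [AddCommGroup E] [Module R E]
  [AddCommGroup C] [Module R C]

theorem gam_map (f : M →ₗ[R] E) {m : M} (hm : m ∈ gam I M) : f m ∈ gam I E := by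
  obtain ⟨t, ht⟩ := hm
  exact ⟨t, fun a ha => by rw [← map_smul, ht a ha, map_zero]⟩

/-- The short complex attached to an exact pair. -/
noncomputable abbrev sc (f : M →ₗ[R] E) (g : E →ₗ[R] C) (he : Function.Exact f g) :
    ShortComplex (ModuleCat.{0} R) :=
  ShortComplex.mk (ModuleCat.ofHom f) (ModuleCat.ofHom g)
    (by ext x; exact he.apply_apply_eq_zero x)

theorem sc_exact {f : M →ₗ[R] E} {g : E →ₗ[R] C} (hf : Function.Injective f)
    (hg : Function.Surjective g) (he : Function.Exact f g) : (sc f g he).ShortExact :=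
  ModuleCat.shortComplex_shortExact (sc f g he) he hf hg

theorem exists_push (i : ℕ) (f : M →ₗ[R] E) : ∃ F : LC I i M →ₗ[R] LC I i E,
    ∀ t a, F (lcMap I i _ t a) = lcMap I i _ t
    (a.comp (Abelian.Ext.mk₀ (ModuleCat.ofHom f)) (add_zero _)) := by
  apply exists_lcDesc I i (ModuleCat.of R M) (fun t => (lcMap I i _ t) ∘ₗ
    { toFun := fun a => a.comp (Abelian.Ext.mk₀ (ModuleCat.ofHom f)) (add_zero _),
      map_add' := fun a b => Abelian.Ext.add_comp _ _ _ _,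
      map_smul' := fun r a => Abelian.Ext.smul_comp _ _ _ _ })
  intro t t' h a
  simp only [LinearMap.comp_apply, LinearMap.coe_mk, AddHom.coe_mk]
  rw [Abelian.Ext.comp_assoc _ _ _ (zero_add _) (add_zero _) (by omega)]
  exact lcMap_map I i _ h _

theorem exists_conn (i : ℕ) {f : M →ₗ[R] E} {g : E →ₗ[R] C} (hf : Function.Injective f)
    (hg : Function.Surjective g) (he : Function.Exact f g) : ∃ F : LC I i C →ₗ[R] LC I (i+1) M,
    ∀ t a, F (lcMap I i _ t a) = lcMap I (i+1) _ t (a.comp (sc_exact hf hg he).extClass rfl) := by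
  apply exists_lcDesc I i (ModuleCat.of R C) (fun t => (lcMap I (i+1) _ t) ∘ₗ
    { toFun := fun a => a.comp (sc_exact hf hg he).extClass rfl,
      map_add' := fun a b => Abelian.Ext.add_comp _ _ _ _,
      map_smul' := fun r a => Abelian.Ext.smul_comp _ _ _ _ })
  intro t t' h a
  simp only [LinearMap.comp_apply, LinearMap.coe_mk, AddHom.coe_mk]
  rw [Abelian.Ext.comp_assoc _ _ _ (zero_add _) rfl (by omega)]
  exact lcMap_map I (i+1) _ h _

theorem conn_surj (i : ℕ) {f : M →ₗ[R] E} {g : E →ₗ[R] C} (hf : Function.Injective f)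
    (hg : Function.Surjective g) (he : Function.Exact f g) (h1 : Subsingleton (LC I (i+1) E))
    (F : LC I i C →ₗ[R] LC I (i+1) M)
    (hF : ∀ t a, F (lcMap I i _ t a) = lcMap I (i+1) _ t (a.comp (sc_exact hf hg he).extClass rfl)) :
    Function.Surjective F := by
  intro x
  obtain ⟨t, a, rfl⟩ := lcMap_surj I (i+1) _ x
  have h2 : lcMap I (i+1) _ t (a.comp (Abelian.Ext.mk₀ (ModuleCat.ofHom f)) (add_zero _)) = 0 :=
    Subsingleton.elim _ _
  rw [lcMap_eq_zero_iff] at h2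
  obtain ⟨t', h, e⟩ := h2
  rw [← Abelian.Ext.comp_assoc _ _ _ (zero_add _) (add_zero _) (by omega)] at e
  obtain ⟨c, hc⟩ := Abelian.Ext.covariant_sequence_exact₁ _ (sc_exact hf hg he) _ e rfl
  refine ⟨lcMap I i _ t' c, ?_⟩
  rw [hF, hc]
  exact lcMap_map I (i+1) _ h a

theorem conn_ker (i : ℕ) {f : M →ₗ[R] E} {g : E →ₗ[R] C} (hf : Function.Injective f)
    (hg : Function.Surjective g) (he : Function.Exact f g)
    (F : LC I i C →ₗ[R] LC I (i+1) M)
    (hF : ∀ t a, F (lcMap I i _ t a) = lcMap I (i+1) _ t (a.comp (sc_exact hf hg he).extClass rfl))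
    (x : LC I i C) (hx : F x = 0) :
    ∃ t, ∃ b : Abelian.Ext (S I t) (ModuleCat.of R E) i, lcMap I i (ModuleCat.of R C) t
      (b.comp (Abelian.Ext.mk₀ (ModuleCat.ofHom g)) (add_zero _)) = x := by
  obtain ⟨t, a, rfl⟩ := lcMap_surj I i _ x
  rw [hF, lcMap_eq_zero_iff] at hx
  obtain ⟨t', h, e⟩ := hx
  rw [← Abelian.Ext.comp_assoc _ _ _ (zero_add _) rfl (by omega)] at e
  obtain ⟨c, hc⟩ := Abelian.Ext.covariant_sequence_exact₃ _ (sc_exact hf hg he) _ rfl e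
  exact ⟨t', c, by rw [← lcMap_map I i _ h a, ← hc]⟩

/-- Dimension shifting for local cohomology. -/
theorem lc_shift (i : ℕ) {f : M →ₗ[R] E} {g : E →ₗ[R] C} (hf : Function.Injective f)
    (hg : Function.Surjective g) (he : Function.Exact f g) (h0 : Subsingleton (LC I i E))
    (h1 : Subsingleton (LC I (i+1) E)) : Nonempty (LC I i C ≃ₗ[R] LC I (i+1) M) := by
  obtain ⟨F, hF⟩ := exists_conn I i hf hg he
  refine ⟨LinearEquiv.ofBijective F ⟨?_, conn_surj I i hf hg he h1 F hF⟩⟩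
  rw [injective_iff_map_eq_zero]
  intro x hx
  obtain ⟨t, b, rfl⟩ := conn_ker I i hf hg he F hF x hx
  have : lcMap I i _ t b = 0 := Subsingleton.elim _ _
  obtain ⟨G, hG⟩ := exists_push I i g
  rw [← hG, this, map_zero]

/-- `H⁰_I(M) ≃ Γ_I(M)`. -/
theorem exists_lc_zero (M : Type) [AddCommGroup M] [Module R M] :
    ∃ F : LC I 0 M ≃ₗ[R] gam I M, ∀ t a, (F (lcMap I 0 _ t a) : M) =
      (Abelian.Ext.homEquiv₀ a).hom (Submodule.Quotient.mk 1 : R ⧸ I ^ t) := by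
  obtain ⟨F, hF⟩ := exists_lcDesc I 0 (ModuleCat.of R M) (N := gam I M) (fun t =>
    { toFun := fun a => ⟨(Abelian.Ext.homEquiv₀ a).hom (Submodule.Quotient.mk 1 : R ⧸ I ^ t), t,
        fun r hr => by
          rw [← map_smul, ← Submodule.Quotient.mk_smul, (Submodule.Quotient.mk_eq_zero _).mpr,
            map_zero]
          simpa using hr⟩,
      map_add' := fun a b => by
        ext
        have : Abelian.Ext.homEquiv₀ (a + b) = Abelian.Ext.homEquiv₀ a + Abelian.Ext.homEquiv₀ b :=
          map_add Abelian.Ext.addEquiv₀ a b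
        simp [this]
      map_smul' := fun r a => by
        ext
        have : Abelian.Ext.homEquiv₀ (r • a) = r • Abelian.Ext.homEquiv₀ a :=
          map_smul (Abelian.Ext.linearEquiv₀ (R := R)) r a
        simp [this] }) (by
    intro t t' h a
    ext
    obtain ⟨b, rfl⟩ := Abelian.Ext.homEquiv₀.symm.surjective a
    simp only [LinearMap.coe_mk, AddHom.coe_mk, Equiv.apply_symm_apply]
    rw [show Abelian.Ext.homEquiv₀.symm b = Abelian.Ext.mk₀ b from rfl, Abelian.Ext.mk₀_comp_mk₀]
    rw [← show Abelian.Ext.homEquiv₀.symm (Sπ I h ≫ b) = Abelian.Ext.mk₀ (Sπ I h ≫ b) from rfl,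
      Equiv.apply_symm_apply]
    rfl)
  have hF' : ∀ t a, (F (lcMap I 0 _ t a) : M) =
      (Abelian.Ext.homEquiv₀ a).hom (Submodule.Quotient.mk 1 : R ⧸ I ^ t) := by
    intro t a
    rw [hF]; rfl
  refine ⟨LinearEquiv.ofBijective F ⟨?_, ?_⟩, hF'⟩
  · rw [injective_iff_map_eq_zero]
    intro x hx
    obtain ⟨t, a, rfl⟩ := lcMap_surj I 0 _ x
    have h1 := hF' t a
    rw [hx] at h1
    have h2 : Abelian.Ext.homEquiv₀ a = 0 := by
      refine ModuleCat.hom_ext (LinearMap.ext fun y => ?_)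
      obtain ⟨y, rfl⟩ := Submodule.Quotient.mk_surjective _ y
      have h3 : (Submodule.Quotient.mk y : R ⧸ I ^ t) = y • Submodule.Quotient.mk 1 := by
        rw [← Submodule.Quotient.mk_smul, smul_eq_mul, mul_one]
      rw [h3, map_smul]
      change y • (Abelian.Ext.homEquiv₀ a).hom (Submodule.Quotient.mk 1 : R ⧸ I ^ t) = 0
      rw [← h1]; simp
    have h4 : a = 0 := by
      apply (Abelian.Ext.addEquiv₀ (X := S I t) (Y := ModuleCat.of R M)).injective
      rw [map_zero]; exact h2
    rw [h4, map_zero]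
  · rintro ⟨m, t, ht⟩
    refine ⟨lcMap I 0 _ t (Abelian.Ext.homEquiv₀.symm (ModuleCat.ofHom ((I ^ t).liftQ (LinearMap.toSpanSingleton R M m)
      (fun r hr => by simpa using ht r hr)))), ?_⟩
    ext
    rw [hF', Equiv.apply_symm_apply]
    change (I ^ t).liftQ (LinearMap.toSpanSingleton R M m) _ (Submodule.Quotient.mk 1) = m
    rw [Submodule.liftQ_apply]; simp

/-- The first local cohomology module as a quotient of torsion. -/
theorem lc_one {f : M →ₗ[R] E} {g : E →ₗ[R] C} (hf : Function.Injective f)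
    (hg : Function.Surjective g) (he : Function.Exact f g) (h1 : Subsingleton (LC I 1 E)) :
    ∃ F : gam I C →ₗ[R] LC I 1 M, Function.Surjective F ∧
      ∀ c : gam I C, F c = 0 ↔ ∃ e ∈ gam I E, g e = c := by
  obtain ⟨F, hF⟩ := exists_conn I 0 hf hg he
  obtain ⟨ρ, hρ⟩ := exists_lc_zero I C
  obtain ⟨ρE, hρE⟩ := exists_lc_zero I E
  have hpush : ∀ t (b : Abelian.Ext (S I t) (ModuleCat.of R E) 0),
      (ρ (lcMap I 0 (ModuleCat.of R C) t (b.comp (Abelian.Ext.mk₀ (ModuleCat.ofHom g)) (add_zero _))) : C)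
      = g (ρE (lcMap I 0 _ t b)) := by
    intro t b
    rw [hρ, hρE]
    obtain ⟨b, rfl⟩ := Abelian.Ext.homEquiv₀.symm.surjective b
    rw [show Abelian.Ext.homEquiv₀.symm b = Abelian.Ext.mk₀ b from rfl, Abelian.Ext.mk₀_comp_mk₀]
    rw [← show Abelian.Ext.homEquiv₀.symm (b ≫ ModuleCat.ofHom g) = Abelian.Ext.mk₀ _ from rfl,
      Equiv.apply_symm_apply]
    rw [← show Abelian.Ext.homEquiv₀.symm b = Abelian.Ext.mk₀ b from rfl, Equiv.apply_symm_apply]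
    rfl
  refine ⟨F ∘ₗ ρ.symm.toLinearMap, (conn_surj I 0 hf hg he h1 F hF).comp ρ.symm.surjective, fun c => ?_⟩
  constructor
  · intro h
    obtain ⟨t, b, e⟩ := conn_ker I 0 hf hg he F hF _ h
    refine ⟨ρE (lcMap I 0 _ t b), (ρE (lcMap I 0 _ t b)).2, ?_⟩
    rw [← hpush, e]; simp
  · rintro ⟨e, he', hec⟩
    obtain ⟨x, hx⟩ := ρE.surjective ⟨e, he'⟩
    obtain ⟨t, b, rfl⟩ := lcMap_surj I 0 _ x
    have := hpush t b
    rw [hx, hec] at this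
    have h3 := ρ.symm_apply_eq.mpr (Subtype.ext this).symm
    simp only [LinearMap.comp_apply, LinearEquiv.coe_coe]
    rw [h3, hF, Abelian.Ext.comp_assoc _ _ _ (add_zero _) (zero_add _) (by omega)]
    rw [show (Abelian.Ext.mk₀ (ModuleCat.ofHom g)).comp (sc_exact hf hg he).extClass (zero_add 1) = 0 from
      (sc_exact hf hg he).comp_extClass, Abelian.Ext.comp_zero, map_zero]

theorem lc_injective (i : ℕ) (E : Type) [AddCommGroup E] [Module R E] [Module.Injective R E] :
    Subsingleton (LC I (i+1) E) := by
  have := Module.injective_object_of_injective_module R E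
  refine subsingleton_of_forall_eq 0 fun x => ?_
  obtain ⟨t, a, rfl⟩ := lcMap_surj I (i+1) _ x
  rw [Abelian.Ext.eq_zero_of_injective a, map_zero]

theorem lc_congr (i : ℕ) (e : M ≃ₗ[R] E) : Nonempty (LC I i M ≃ₗ[R] LC I i E) :=
  ⟨((localCohomology I i).mapIso e.toModuleIso).toLinearEquiv⟩

end Recursion
end ZhouLC

namespace ZhouLC
open Abelian Limits

section EV
variable {R : Type} [CommRing R]

/-- The `l`-th extension group of two modules. -/
abbrev EX (R : Type) [CommRing R] (X Y : Type) [AddCommGroup X] [Module R X] [AddCommGroup Y]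
    [Module R Y] (l : ℕ) : Type :=
  Abelian.Ext (ModuleCat.of R X) (ModuleCat.of R Y) l

/-- Vanishing of the `l`-th extension group. -/
abbrev EV (R : Type) [CommRing R] (X Y : Type) [AddCommGroup X] [Module R X] [AddCommGroup Y]
    [Module R Y] (l : ℕ) : Prop :=
  Subsingleton (EX R X Y l)

variable {A B C X Y : Type} [AddCommGroup A] [Module R A] [AddCommGroup B] [Module R B]
  [AddCommGroup C] [Module R C] [AddCommGroup X] [Module R X] [AddCommGroup Y] [Module R Y]

theorem EV.congr {A' : Type} [AddCommGroup A'] [Module R A'] {Y' : Type} [AddCommGroup Y']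
    [Module R Y'] {l : ℕ}
    (e : A ≃ₗ[R] A') (e' : Y ≃ₗ[R] Y') (h : EV R A Y l) : EV R A' Y' l := by
  refine subsingleton_of_forall_eq 0 fun a => ?_
  have h1 : (Abelian.Ext.mk₀ e.toModuleIso.hom).comp (a.comp (Abelian.Ext.mk₀ e'.toModuleIso.inv) (add_zero l)) (zero_add l) = 0 :=
    h.elim _ _
  have h2 := congrArg (fun b => (Abelian.Ext.mk₀ e.toModuleIso.inv).comp (b.comp (Abelian.Ext.mk₀ e'.toModuleIso.hom) (add_zero l)) (zero_add l)) h1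
  have e1 : e.toModuleIso.inv ≫ e.toModuleIso.hom = 𝟙 _ := e.toModuleIso.inv_hom_id
  have e2 : e'.toModuleIso.inv ≫ e'.toModuleIso.hom = 𝟙 _ := e'.toModuleIso.inv_hom_id
  simpa [-LinearEquiv.toModuleIso_hom, -LinearEquiv.toModuleIso_inv, e1, e2] using h2

theorem ext_smul (r : R) {l : ℕ} (a : EX R X A l) :
    a.comp (Abelian.Ext.mk₀ (ModuleCat.ofHom (r • LinearMap.id))) (add_zero l) = r • a := by
  rw [Abelian.Ext.smul_eq_comp_mk₀]; rfl

theorem smul_ext (r : R) {l : ℕ} (a : EX R X A l) :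
    (Abelian.Ext.mk₀ (ModuleCat.ofHom (r • LinearMap.id))).comp a (zero_add l) = r • a := by
  have : (Abelian.Ext.mk₀ (ModuleCat.ofHom (r • (LinearMap.id : X →ₗ[R] X)))) = r • Abelian.Ext.mk₀ (𝟙 (ModuleCat.of R X)) := by
    rw [← Abelian.Ext.mk₀_smul]; rfl
  rw [this, Abelian.Ext.smul_comp, Abelian.Ext.mk₀_id_comp]

theorem EV.of_subsingleton_left [Subsingleton X] (l : ℕ) : EV R X Y l := by
  refine subsingleton_of_forall_eq 0 fun a => ?_
  rw [← smul_ext (1:R) a |>.trans (one_smul _ _), show (1:R) • (LinearMap.id : X →ₗ[R] X) = 0 from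
    LinearMap.ext fun x => Subsingleton.elim _ _]
  rw [ModuleCat.ofHom_zero, Abelian.Ext.mk₀_zero, Abelian.Ext.zero_comp]

theorem EV.of_subsingleton_right [Subsingleton Y] (l : ℕ) : EV R X Y l := by
  refine subsingleton_of_forall_eq 0 fun a => ?_
  rw [← (ext_smul (1:R) a).trans (one_smul _ _), show (1:R) • (LinearMap.id : Y →ₗ[R] Y) = 0 from
    LinearMap.ext fun x => Subsingleton.elim _ _]
  rw [ModuleCat.ofHom_zero, Abelian.Ext.mk₀_zero, Abelian.Ext.comp_zero]

theorem EV.of_injective [Module.Injective R Y] (l : ℕ) : EV R X Y (l+1) := by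
  have := Module.injective_object_of_injective_module R Y
  exact subsingleton_of_forall_eq 0 fun a => Abelian.Ext.eq_zero_of_injective a

theorem EV.of_projective [Module.Projective R X] (l : ℕ) : EV R X Y (l+1) := by
  have : Projective (ModuleCat.of R X) := (IsProjective.iff_projective X).mp inferInstance
  exact subsingleton_of_forall_eq 0 fun a => Abelian.Ext.eq_zero_of_projective a

section
variable {f : A →ₗ[R] B} {g : B →ₗ[R] C} (hf : Function.Injective f)
    (hg : Function.Surjective g) (he : Function.Exact f g)
include hf hg he

theorem EV.cov₁ {l : ℕ} (h1 : EV R X C l) (h2 : EV R X B (l+1)) : EV R X A (l+1) := by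
  refine subsingleton_of_forall_eq 0 fun a => ?_
  obtain ⟨c, rfl⟩ := Abelian.Ext.covariant_sequence_exact₁ _ (sc_exact hf hg he) a (h2.elim _ _) rfl
  rw [h1.elim c 0, Abelian.Ext.zero_comp]

theorem EV.cov₂ {l : ℕ} (h1 : EV R X A l) (h2 : EV R X C l) : EV R X B l := by
  refine subsingleton_of_forall_eq 0 fun a => ?_
  obtain ⟨c, rfl⟩ := Abelian.Ext.covariant_sequence_exact₂ _ (sc_exact hf hg he) a (h2.elim _ _)
  rw [h1.elim c 0, Abelian.Ext.zero_comp]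

theorem EV.cov₃ {l : ℕ} (h1 : EV R X B l) (h2 : EV R X A (l+1)) : EV R X C l := by
  refine subsingleton_of_forall_eq 0 fun a => ?_
  obtain ⟨c, rfl⟩ := Abelian.Ext.covariant_sequence_exact₃ _ (sc_exact hf hg he) a rfl (h2.elim _ _)
  rw [h1.elim c 0, Abelian.Ext.zero_comp]

theorem EV.con₁ {l : ℕ} (h1 : EV R B Y l) (h2 : EV R C Y (l+1)) : EV R A Y l := by
  refine subsingleton_of_forall_eq 0 fun a => ?_
  obtain ⟨c, rfl⟩ := Abelian.Ext.contravariant_sequence_exact₁ (sc_exact hf hg he) (ModuleCat.of R Y) a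
    (n₁ := l + 1) (add_comm _ _) (h2.elim _ _)
  rw [h1.elim c 0, Abelian.Ext.comp_zero]

theorem EV.con₂ {l : ℕ} (h1 : EV R A Y l) (h2 : EV R C Y l) : EV R B Y l := by
  refine subsingleton_of_forall_eq 0 fun a => ?_
  obtain ⟨c, rfl⟩ := Abelian.Ext.contravariant_sequence_exact₂ (sc_exact hf hg he) (ModuleCat.of R Y) a
    (h1.elim _ _)
  rw [h2.elim c 0, Abelian.Ext.comp_zero]

theorem EV.con₃ {l : ℕ} (h1 : EV R A Y l) (h2 : EV R B Y (l+1)) : EV R C Y (l+1) := by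
  refine subsingleton_of_forall_eq 0 fun a => ?_
  obtain ⟨c, rfl⟩ := Abelian.Ext.contravariant_sequence_exact₃ (sc_exact hf hg he) (ModuleCat.of R Y) a
    (h2.elim _ _) (add_comm 1 l)
  rw [h1.elim c 0, Abelian.Ext.comp_zero]

end

theorem exists_embedding (R : Type) [CommRing R] (M : Type) [AddCommGroup M] [Module R M] :
    ∃ (E C : Type) (_ : AddCommGroup E) (_ : Module R E) (_ : AddCommGroup C) (_ : Module R C)
      (f : M →ₗ[R] E)
      (g : E →ₗ[R] C), Module.Injective R E ∧ Function.Injective f ∧ Function.Surjective g ∧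
      Function.Exact f g := by
  obtain ⟨⟨J, hJ, ι, hι⟩⟩ := EnoughInjectives.presentation (ModuleCat.of R M)
  refine ⟨J, J ⧸ LinearMap.range ι.hom, inferInstance, inferInstance, inferInstance, inferInstance,
    ι.hom, Submodule.mkQ _, Module.injective_module_of_injective_object R J, ?_,
      Submodule.mkQ_surjective _, ?_⟩
  · exact (ModuleCat.mono_iff_injective ι).mp hι
  · exact LinearMap.exact_iff.mpr (Submodule.ker_mkQ _)

theorem exists_cosyzygy (R : Type) [CommRing R] (M : Type) [AddCommGroup M] [Module R M] :
    ∃ (E C : Type) (_ : AddCommGroup E) (_ : Module R E) (_ : AddCommGroup C) (_ : Module R C)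
      (f : M →ₗ[R] E)
      (g : E →ₗ[R] C), Module.Injective R E ∧ Function.Injective f ∧ Function.Surjective g ∧
      Function.Exact f g ∧ ∀ (X : Type) [AddCommGroup X] [Module R X] (l : ℕ),
        EV R X C (l+1) ↔ EV R X M (l+2) := by
  obtain ⟨E, C, _, _, _, _, f, g, hE, hf, hg, he⟩ := exists_embedding R M
  exact ⟨E, C, _, _, _, _, f, g, hE, hf, hg, he, fun X _ _ l =>
    ⟨fun h => EV.cov₁ hf hg he h (EV.of_injective _), fun h => EV.cov₃ hf hg he (EV.of_injective _) h⟩⟩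

theorem EV.all_succ {l : ℕ} (h : ∀ (X : Type) [AddCommGroup X] [Module R X], EV R X Y l) :
    ∀ (X : Type) [AddCommGroup X] [Module R X], EV R X Y (l+1) := by
  intro X _ _
  have hs := Finsupp.linearCombination_id_surjective R X
  have he := LinearMap.exact_subtype_ker_map (Finsupp.linearCombination R (id : X → X))
  exact EV.con₃ (Submodule.subtype_injective _) hs he (h _) (EV.of_projective _)

theorem EV.all_le {l l' : ℕ} (h : ∀ (X : Type) [AddCommGroup X] [Module R X], EV R X Y l)
    (hl : l ≤ l') :
    ∀ (X : Type) [AddCommGroup X] [Module R X], EV R X Y l' := by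
  induction l', hl using Nat.le_induction with
  | base => exact h
  | succ n _ ih => exact EV.all_succ ih

theorem injective_of_ev (h : ∀ J : Ideal R, EV R (R ⧸ J) Y 1) : Module.Injective R Y := by
  refine Module.Baer.iff_injective.mp fun J φ => ?_
  have he : Function.Exact (Submodule.subtype J) (Submodule.mkQ J) :=
    LinearMap.exact_iff.mpr (by rw [Submodule.ker_mkQ, Submodule.range_subtype])
  obtain ⟨c, hc⟩ := Abelian.Ext.contravariant_sequence_exact₁ (sc_exact (Submodule.subtype_injective J)
    (Submodule.mkQ_surjective J) he) (ModuleCat.of R Y) (Abelian.Ext.mk₀ (ModuleCat.ofHom φ))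
    (n₁ := 1) rfl ((h J).elim _ _)
  obtain ⟨ψ, rfl⟩ := Abelian.Ext.homEquiv₀.symm.surjective c
  rw [show Abelian.Ext.homEquiv₀.symm ψ = Abelian.Ext.mk₀ ψ from rfl,
    Abelian.Ext.mk₀_comp_mk₀] at hc
  have h2 := (Abelian.Ext.mk₀_bijective _ _).1 hc
  exact ⟨ψ.hom, fun x hx => hom_congr h2 ⟨x, hx⟩⟩

theorem EV.all_of_ideal {l : ℕ} (h : ∀ J : Ideal R, EV R (R ⧸ J) Y (l+1)) :
    ∀ (X : Type) [AddCommGroup X] [Module R X], EV R X Y (l+1) := by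
  induction l generalizing Y with
  | zero =>
    have := injective_of_ev h
    intro X _ _
    exact EV.of_injective 0
  | succ n ih =>
    obtain ⟨E, C, _, _, _, _, f, g, hE, hf, hg, he, hC⟩ := exists_cosyzygy R Y
    intro X _ _
    rw [← hC]
    exact ih (fun J => (hC _ _).mpr (h J)) X

end EV

section Ideals
variable {R : Type} [CommRing R]

/-- The colon ideal. -/
abbrev colonI (J : Ideal R) (x : R) : Ideal R := Submodule.comap (LinearMap.lsmul R R x) J

theorem mem_colonI {J : Ideal R} {x y : R} : y ∈ colonI J x ↔ x * y ∈ J := Iff.rfl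

/-- Multiplication by `x` as a map from `R / (J : x)` to `R / J`. -/
def colonF (J : Ideal R) (x : R) : (R ⧸ colonI J x) →ₗ[R] (R ⧸ J) :=
  Submodule.mapQ (colonI J x) J (LinearMap.lsmul R R x) le_rfl

/-- The projection to the quotient by the sum. -/
def colonG (J : Ideal R) (x : R) : (R ⧸ J) →ₗ[R] (R ⧸ (J ⊔ Ideal.span {x})) :=
  Submodule.mapQ J (J ⊔ Ideal.span {x}) LinearMap.id le_sup_left

theorem colonF_inj (J : Ideal R) (x : R) : Function.Injective (colonF J x) := by
  rw [injective_iff_map_eq_zero]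
  intro a
  obtain ⟨a, rfl⟩ := Submodule.Quotient.mk_surjective _ a
  intro h
  exact (Submodule.Quotient.mk_eq_zero _).mpr ((Submodule.Quotient.mk_eq_zero J).mp h)

theorem colonG_surj (J : Ideal R) (x : R) : Function.Surjective (colonG J x) := by
  intro a
  obtain ⟨a, rfl⟩ := Submodule.Quotient.mk_surjective _ a
  exact ⟨Submodule.Quotient.mk a, rfl⟩

theorem colon_exact (J : Ideal R) (x : R) : Function.Exact (colonF J x) (colonG J x) := by
  intro a
  obtain ⟨a, rfl⟩ := Submodule.Quotient.mk_surjective _ a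
  constructor
  · intro h
    have h' := (Submodule.Quotient.mk_eq_zero (J ⊔ Ideal.span {x})).mp h
    obtain ⟨u, hu, v, hv, e⟩ := Submodule.mem_sup.mp h'
    obtain ⟨w, rfl⟩ := Ideal.mem_span_singleton'.mp hv
    refine ⟨Submodule.Quotient.mk w, ?_⟩
    refine (Submodule.Quotient.eq J).mpr ?_
    have : x * w - a = - u := by simp at e; rw [← e]; ring
    change x * w - a ∈ J
    rw [this]; exact J.neg_mem hu
  · rintro ⟨b, h⟩
    obtain ⟨b, rfl⟩ := Submodule.Quotient.mk_surjective _ b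
    rw [← h]
    refine (Submodule.Quotient.mk_eq_zero (J ⊔ Ideal.span {x})).mpr ?_
    exact Ideal.mem_sup_right (Ideal.mem_span_singleton.mpr ⟨b, rfl⟩)

theorem le_colonI (J : Ideal R) (x : R) : J ≤ colonI J x := fun _ h => J.mul_mem_left x h

theorem lt_sup_span {J : Ideal R} {x : R} (hx : x ∉ J) : J < J ⊔ Ideal.span {x} :=
  lt_of_le_of_ne le_sup_left fun h => hx (h ▸ Ideal.mem_sup_right (Ideal.mem_span_singleton_self x))

/-- Noetherian induction on ideals adapted to cyclic modules. -/
theorem ideal_dévissage [IsNoetherianRing R] {p : Ideal R → Prop} (htop : p ⊤)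
    (hex : ∀ J x, p (colonI J x) → p (J ⊔ Ideal.span {x}) → p J)
    (hprime : ∀ P : Ideal R, P.IsPrime → (∀ J, P < J → p J) → p P) (J : Ideal R) : p J := by
  induction J using IsNoetherian.induction with
  | hgt J ih =>
  by_cases h : ∃ x, x ∉ J ∧ colonI J x ≠ J
  · obtain ⟨x, hx, hne⟩ := h
    exact hex J x (ih _ (lt_of_le_of_ne (le_colonI J x) hne.symm)) (ih _ (lt_sup_span hx))
  · push Not at h
    by_cases ht : J = ⊤
    · rwa [ht]
    refine hprime J ⟨ht, fun {x y} hxy => ?_⟩ ih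
    by_contra! hc
    have h1 := h x hc.1
    exact hc.2 (h1 ▸ (mem_colonI.mpr hxy))

variable {Y : Type} [AddCommGroup Y] [Module R Y]

theorem ev_ideal_induction [IsNoetherianRing R] (l : ℕ)
    (hprime : ∀ P : Ideal R, P.IsPrime → (∀ J, P < J → EV R (R ⧸ J) Y l) → EV R (R ⧸ P) Y l)
    (J : Ideal R) : EV R (R ⧸ J) Y l := by
  induction J using ideal_dévissage with
  | htop =>
    have : Subsingleton (R ⧸ (⊤ : Ideal R)) := Ideal.Quotient.subsingleton_iff.mpr rfl
    exact EV.of_subsingleton_left l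
  | hex J x h1 h2 => exact EV.con₂ (colonF_inj J x) (colonG_surj J x) (colon_exact J x) h1 h2
  | hprime P hP h => exact hprime P hP h

theorem prime_smul_injective {P : Ideal R} (hP : P.IsPrime) {x : R} (hx : x ∉ P) :
    Function.Injective (x • (LinearMap.id : (R ⧸ P) →ₗ[R] (R ⧸ P))) := by
  rw [injective_iff_map_eq_zero]
  intro b
  obtain ⟨b, rfl⟩ := Submodule.Quotient.mk_surjective _ b
  intro h
  have h2 : x * b ∈ P := (Submodule.Quotient.mk_eq_zero P).mp h
  exact (Submodule.Quotient.mk_eq_zero _).mpr ((hP.mem_or_mem h2).resolve_left hx)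

theorem prime_smul_exact (P : Ideal R) (x : R) :
    Function.Exact (x • (LinearMap.id : (R ⧸ P) →ₗ[R] (R ⧸ P))) (colonG P x) := by
  intro y
  rw [colon_exact P x y]
  constructor
  · rintro ⟨b, rfl⟩
    obtain ⟨b, rfl⟩ := Submodule.Quotient.mk_surjective _ b
    exact ⟨Submodule.Quotient.mk b, rfl⟩
  · rintro ⟨b, rfl⟩
    obtain ⟨b, rfl⟩ := Submodule.Quotient.mk_surjective _ b
    exact ⟨Submodule.Quotient.mk b, rfl⟩

theorem prime_quot_smul {P : Ideal R} (hP : P.IsPrime) {x : R} (hx : x ∉ P) {l : ℕ}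
    (h : EV R (R ⧸ (P ⊔ Ideal.span {x})) Y l) (a : EX R (R ⧸ P) Y l) (ha : x • a = 0) : a = 0 := by
  rw [← smul_ext] at ha
  obtain ⟨c, rfl⟩ := Abelian.Ext.contravariant_sequence_exact₂ (sc_exact (prime_smul_injective hP hx)
    (colonG_surj P x) (prime_smul_exact P x)) (ModuleCat.of R Y) a ha
  rw [h.elim c 0, Abelian.Ext.comp_zero]

end Ideals
end ZhouLC

namespace ZhouLC
open Abelian Limits

section Torsion
variable {R : Type} [CommRing R] (I : Ideal R)
variable {M E C X Y : Type} [AddCommGroup M] [Module R M] [AddCommGroup E] [Module R E]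
  [AddCommGroup C] [Module R C] [AddCommGroup X] [Module R X] [AddCommGroup Y] [Module R Y]

theorem gam_fg_bound [Module.Finite R M] (φ : M →ₗ[R] gam I E) :
    ∃ t : ℕ, ∀ a ∈ I ^ t, ∀ x, a • φ x = 0 := by
  obtain ⟨s, hs⟩ := Module.Finite.fg_top (R := R) (M := M)
  choose T hT using fun x => (φ x).2
  refine ⟨s.sup T, fun a ha x => ?_⟩
  have hx : x ∈ Submodule.span R (s : Set M) := hs ▸ Submodule.mem_top
  induction hx using Submodule.span_induction with
  | mem y hy =>
    ext
    exact hT y a (Ideal.pow_le_pow_right (Finset.le_sup hy) ha)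
  | zero => simp
  | add y z _ _ h1 h2 => rw [map_add, smul_add, h1, h2, add_zero]
  | smul r y _ h => rw [map_smul, smul_comm, h, smul_zero]

theorem gam_injective [IsNoetherianRing R] [Module.Injective R E] :
    Module.Injective R (gam I E) := by
  refine Module.Baer.iff_injective.mp fun J φ => ?_
  obtain ⟨t, ht⟩ := gam_fg_bound I φ
  obtain ⟨k, hk⟩ := Ideal.exists_pow_inf_eq_pow_smul I (J : Submodule R R)
  have hk' := hk (t + k) (by omega)
  simp only [smul_eq_mul, Ideal.mul_top, Nat.add_sub_cancel] at hk'
  set K : Submodule R J := Submodule.comap (Submodule.subtype J) (I ^ (t + k) : Submodule R R) with hK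
  have hφ : K ≤ LinearMap.ker φ := by
    intro x hx
    have h1 : (x : R) ∈ I ^ t * (I ^ k ⊓ J) := hk' ▸ ⟨hx, x.2⟩
    have h2 : ∀ y ∈ I ^ t * (I ^ k ⊓ J), ∀ hy : y ∈ J, φ ⟨y, hy⟩ = 0 := by
      intro y hy
      induction hy using Submodule.mul_induction_on' with
      | mem_mul_mem a ha b hb =>
        intro hy
        rw [show (⟨a * b, hy⟩ : J) = a • ⟨b, hb.2⟩ from rfl, map_smul, ht a ha]
      | add y hy' z hz' h1 h2 =>
        intro hy
        have e1 : y ∈ J := (hk' ▸ hy' : y ∈ I ^ (t+k) ⊓ J).2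
        have e2 : z ∈ J := (hk' ▸ hz' : z ∈ I ^ (t+k) ⊓ J).2
        rw [show (⟨y + z, hy⟩ : J) = ⟨y, e1⟩ + ⟨z, e2⟩ from rfl, map_add, h1, h2, add_zero]
    exact h2 _ h1 x.2
  obtain ⟨h, hh⟩ := Module.Injective.out (R := R) (Q := E) (X := J ⧸ K) (Y := R ⧸ I ^ (t + k))
    (K.mapQ (I ^ (t+k)) J.subtype le_rfl) (by
      rw [injective_iff_map_eq_zero]
      intro a
      obtain ⟨a, rfl⟩ := Submodule.Quotient.mk_surjective _ a
      intro ha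
      exact (Submodule.Quotient.mk_eq_zero _).mpr ((Submodule.Quotient.mk_eq_zero (I ^ (t+k))).mp ha))
    ((gam I E).subtype ∘ₗ K.liftQ φ hφ)
  have hg : ∀ y, h y ∈ gam I E := by
    intro y
    refine ⟨t + k, fun a ha => ?_⟩
    obtain ⟨y, rfl⟩ := Submodule.Quotient.mk_surjective _ y
    rw [← map_smul, ← Submodule.Quotient.mk_smul, (Submodule.Quotient.mk_eq_zero _).mpr, map_zero]
    exact Ideal.mul_mem_right _ _ ha
  refine ⟨(h.codRestrict (gam I E) hg) ∘ₗ Submodule.mkQ _, fun x hx => ?_⟩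
  ext
  exact hh (Submodule.Quotient.mk ⟨x, hx⟩)

theorem gam_gam : gam I (gam I E) = ⊤ := by
  refine eq_top_iff.mpr fun x _ => ?_
  obtain ⟨t, ht⟩ := x.2
  exact ⟨t, fun a ha => Subtype.ext (ht a ha)⟩

theorem gam_top_of_surjective (g : E →ₗ[R] C) (hg : Function.Surjective g) (h : gam I E = ⊤) :
    gam I C = ⊤ := by
  refine eq_top_iff.mpr fun x _ => ?_
  obtain ⟨y, rfl⟩ := hg x
  exact gam_map I g (h ▸ Submodule.mem_top)

/-- Torsion modules embed in torsion injective modules. -/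
theorem exists_torsion_embedding [IsNoetherianRing R] (hM : gam I M = ⊤) :
    ∃ (E C : Type) (_ : AddCommGroup E) (_ : Module R E) (_ : AddCommGroup C) (_ : Module R C)
      (f : M →ₗ[R] E)
      (g : E →ₗ[R] C), Module.Injective R E ∧ Function.Injective f ∧ Function.Surjective g ∧
      Function.Exact f g ∧ gam I E = ⊤ ∧ gam I C = ⊤ := by
  obtain ⟨E, C, _, _, _, _, f, g, hE, hf, hg, he⟩ := exists_embedding R M
  set f' : M →ₗ[R] gam I E := f.codRestrict _ (fun m => gam_map I f (hM ▸ Submodule.mem_top))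
  refine ⟨gam I E, gam I E ⧸ LinearMap.range f', inferInstance, inferInstance, inferInstance, inferInstance,
    f', Submodule.mkQ _, gam_injective I, fun x y h => hf (congrArg Subtype.val h), Submodule.mkQ_surjective _,
    LinearMap.exact_iff.mpr (Submodule.ker_mkQ _), gam_gam I, ?_⟩
  exact gam_top_of_surjective I (Submodule.mkQ _) (Submodule.mkQ_surjective _) (gam_gam I)

theorem lc_torsion [IsNoetherianRing R] (i : ℕ) (hM : gam I M = ⊤) :
    Subsingleton (LC I (i+1) M) := by
  obtain ⟨E, C, _, _, _, _, f, g, hE, hf, hg, he, htE, htC⟩ := exists_torsion_embedding I hM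
  induction i generalizing M E C with
  | zero =>
    obtain ⟨F, hF, hk⟩ := lc_one I hf hg he (lc_injective I 0 E)
    refine subsingleton_of_forall_eq 0 fun x => ?_
    obtain ⟨c, rfl⟩ := hF x
    obtain ⟨e, h⟩ := hg c
    exact (hk c).mpr ⟨e, htE ▸ Submodule.mem_top, h⟩
  | succ n ih =>
    obtain ⟨F⟩ := lc_shift I (n+1) hf hg he (lc_injective I _ E) (lc_injective I _ E)
    obtain ⟨E', C', _, _, _, _, f', g', hE', hf', hg', he', htE', htC'⟩ := exists_torsion_embedding I htC
    have := ih htC E' C' _ _ _ _ f' g' hE' hf' hg' he' htE' htC'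
    exact F.symm.injective.subsingleton

/-- Presentation of a finitely generated module. -/
theorem exists_presentation [IsNoetherianRing R] (X : Type) [AddCommGroup X] [Module R X]
    [Module.Finite R X] :
    ∃ (n : ℕ) (K : Submodule R (Fin n → R)) (g : (Fin n → R) →ₗ[R] X), Function.Surjective g ∧
      Function.Exact K.subtype g := by
  obtain ⟨n, g, hg⟩ := Module.Finite.exists_fin' R X
  exact ⟨n, LinearMap.ker g, g, hg, LinearMap.exact_subtype_ker_map g⟩

theorem ext_torsion [IsNoetherianRing R] (x : R) (hY : ∀ y : Y, ∃ n : ℕ, x ^ n • y = 0) (l : ℕ)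
    [Module.Finite R X] (a : EX R X Y l) : ∃ n : ℕ, x ^ n • a = 0 := by
  induction l generalizing X with
  | zero =>
    obtain ⟨a, rfl⟩ := Abelian.Ext.homEquiv₀.symm.surjective a
    obtain ⟨s, hs⟩ := Module.Finite.fg_top (R := R) (M := X)
    choose T hT using hY
    refine ⟨s.sup (fun b => T (a.hom b)), ?_⟩
    rw [show Abelian.Ext.homEquiv₀.symm a = Abelian.Ext.mk₀ a from rfl, ← Abelian.Ext.mk₀_smul]
    rw [show x ^ (s.sup (fun b => T (a.hom b))) • a = 0 from ?_, Abelian.Ext.mk₀_zero]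
    refine ModuleCat.hom_ext (LinearMap.ext_on hs fun b hb => ?_)
    obtain ⟨c, hc⟩ := Nat.exists_eq_add_of_le (Finset.le_sup (f := fun b => T (a.hom b)) hb)
    change x ^ (s.sup (fun b => T (a.hom b))) • a.hom b = 0
    rw [hc, add_comm, pow_add, mul_smul, hT, smul_zero]
  | succ n ih =>
    obtain ⟨m, K, g, hg, he⟩ := exists_presentation (R := R) X
    obtain ⟨c, rfl⟩ := Abelian.Ext.contravariant_sequence_exact₃ (sc_exact K.subtype_injective hg he)
      (ModuleCat.of R Y) a ((EV.of_projective (R := R) (X := Fin m → R) n).elim _ _) (add_comm 1 n)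
    obtain ⟨t, ht⟩ := ih c
    exact ⟨t, by rw [← Abelian.Ext.comp_smul, ht, Abelian.Ext.comp_zero]⟩

theorem ext_fg [IsNoetherianRing R] (l : ℕ) [Module.Finite R X] (a : EX R X Y l) :
    ∃ (N : Submodule R Y) (b : EX R X N l), N.FG ∧ b.comp
    (Abelian.Ext.mk₀ (ModuleCat.ofHom N.subtype)) (add_zero l) = a := by
  induction l generalizing X with
  | zero =>
    obtain ⟨a, rfl⟩ := Abelian.Ext.homEquiv₀.symm.surjective a
    refine ⟨LinearMap.range a.hom, Abelian.Ext.mk₀ (ModuleCat.ofHom a.hom.rangeRestrict), ?_, ?_⟩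
    · exact Module.Finite.iff_fg.mp (Module.Finite.range a.hom)
    · rw [Abelian.Ext.mk₀_comp_mk₀]; rfl
  | succ n ih =>
    obtain ⟨m, K, g, hg, he⟩ := exists_presentation (R := R) X
    obtain ⟨c, rfl⟩ := Abelian.Ext.contravariant_sequence_exact₃ (sc_exact K.subtype_injective hg he)
      (ModuleCat.of R Y) a ((EV.of_projective (R := R) (X := Fin m → R) n).elim _ _) (add_comm 1 n)
    obtain ⟨N, b, hN, rfl⟩ := ih c
    exact ⟨N, (sc_exact K.subtype_injective hg he).extClass.comp b (add_comm 1 n), hN,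
      Abelian.Ext.comp_assoc _ _ _ _ _ (by omega)⟩

theorem lc_pow_torsion {i : ℕ} {x : R} (hx : x ∈ I) (a : LC I i M) : ∃ n : ℕ, x ^ n • a = 0 := by
  obtain ⟨t, b, rfl⟩ := lcMap_surj I i _ a
  refine ⟨t, ?_⟩
  rw [← map_smul]
  have h := smul_ext (X := R ⧸ I ^ t) (x ^ t) b
  rw [show x ^ t • (LinearMap.id : (R ⧸ I ^ t) →ₗ[R] (R ⧸ I ^ t)) = 0 from ?_, ModuleCat.ofHom_zero,
    Abelian.Ext.mk₀_zero, Abelian.Ext.zero_comp] at h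
  · rw [← h, map_zero]
  · refine LinearMap.ext fun y => ?_
    obtain ⟨y, rfl⟩ := Submodule.Quotient.mk_surjective _ y
    exact (Submodule.Quotient.mk_eq_zero _).mpr (Ideal.mul_mem_right _ _ (Ideal.pow_mem_pow hx t))

end Torsion

section Local
variable {R : Type} [CommRing R] [IsNoetherianRing R] [IsLocalRing R]
open IsLocalRing

theorem ev_of_residue {Y : Type} [AddCommGroup Y] [Module R Y]
    (hY : ∀ x ∈ maximalIdeal R, ∀ y : Y, ∃ n : ℕ, x ^ n • y = 0) (l : ℕ)
    (h : EV R (R ⧸ maximalIdeal R) Y (l+1)) :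
    ∀ (X : Type) [AddCommGroup X] [Module R X], EV R X Y (l+1) := by
  refine EV.all_of_ideal fun J => ?_
  refine ev_ideal_induction _ (fun P hP ih => ?_) J
  by_cases hm : maximalIdeal R ≤ P
  · rwa [le_antisymm (le_maximalIdeal hP.ne_top) hm]
  obtain ⟨x, hx, hxP⟩ := SetLike.not_le_iff_exists.mp hm
  refine subsingleton_of_forall_eq 0 fun a => ?_
  obtain ⟨n, hn⟩ := ext_torsion x (hY x hx) (l+1) a
  induction n with
  | zero => simpa using hn
  | succ n ihn =>
    rw [pow_succ', mul_smul] at hn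
    exact ihn (prime_quot_smul hP hxP (ih _ (lt_sup_span hxP)) _ hn)

end Local

end ZhouLC

namespace ZhouLC
open Abelian Limits

section Exact
variable {R : Type} [CommRing R] (I : Ideal R)
variable {M E C : Type} [AddCommGroup M] [Module R M] [AddCommGroup E] [Module R E]
  [AddCommGroup C] [Module R C]

theorem lc_subsingleton_of_ext {i : ℕ}
    (h : ∀ t (a : Abelian.Ext (S I t) (ModuleCat.of R M) i), lcMap I i _ t a = 0) :
    Subsingleton (LC I i M) := by
  refine subsingleton_of_forall_eq 0 fun x => ?_
  obtain ⟨t, b, rfl⟩ := lcMap_surj I i _ x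
  exact h t b

theorem lc_middle (i : ℕ) {f : M →ₗ[R] E} {g : E →ₗ[R] C} (hf : Function.Injective f)
    (hg : Function.Surjective g) (he : Function.Exact f g) (h1 : Subsingleton (LC I i M))
    (h2 : Subsingleton (LC I i C)) : Subsingleton (LC I i E) := by
  refine lc_subsingleton_of_ext I fun t a => ?_
  have h3 := h2.elim (lcMap I i _ t (a.comp (Abelian.Ext.mk₀ (ModuleCat.ofHom g)) (add_zero _))) 0
  rw [lcMap_eq_zero_iff] at h3
  obtain ⟨t', h, e⟩ := h3
  rw [← Abelian.Ext.comp_assoc _ _ _ (zero_add _) (add_zero _) (by omega)] at e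
  obtain ⟨c, hc⟩ := Abelian.Ext.covariant_sequence_exact₂ _ (sc_exact hf hg he) _ e
  obtain ⟨G, hG⟩ := exists_push I i f
  rw [← lcMap_map I i _ h, ← hc]
  exact (hG t' c).symm.trans (by rw [h1.elim (lcMap I i _ t' c) 0, map_zero])

theorem lc_smul_inj (i : ℕ) {x : R} {g : M →ₗ[R] C}
    (hx : Function.Injective (x • (LinearMap.id : M →ₗ[R] M)))
    (hg : Function.Surjective g) (he : Function.Exact (x • (LinearMap.id : M →ₗ[R] M)) g)
    (h1 : Subsingleton (LC I i C))
    (y : LC I (i+1) M) (hy : x • y = 0) : y = 0 := by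
  obtain ⟨t, a, rfl⟩ := lcMap_surj I (i+1) _ y
  have h2 := (congrArg (lcMap I (i+1) _ t) (ext_smul x a)).trans ((map_smul _ _ _).trans hy)
  rw [lcMap_eq_zero_iff] at h2
  obtain ⟨t', h, e⟩ := h2
  rw [← Abelian.Ext.comp_assoc _ _ _ (zero_add _) (add_zero _) (by omega)] at e
  obtain ⟨c, hc⟩ := Abelian.Ext.covariant_sequence_exact₁ _ (sc_exact hx hg he) _ e rfl
  obtain ⟨F, hF⟩ := exists_conn I i hx hg he
  rw [← lcMap_map I _ _ h, ← hc]
  exact (hF t' c).symm.trans (by rw [h1.elim (lcMap I i _ t' c) 0, map_zero])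

theorem lc_subsingleton (i : ℕ) [Subsingleton M] : Subsingleton (LC I i M) :=
  lc_subsingleton_of_ext I fun t a => by
    have := EV.of_subsingleton_right (R := R) (X := R ⧸ I ^ t) (Y := M) i
    rw [this.elim a 0, map_zero]

end Exact

section Local
variable {R : Type} [CommRing R]
open IsLocalRing

theorem ringKrullDim_sup_succ_le {P : Ideal R} (hP : P.IsPrime) {x : R} (hx : x ∉ P) :
    ringKrullDim (R ⧸ (P ⊔ Ideal.span {x})) + 1 ≤ ringKrullDim (R ⧸ P) := by
  have h1 := ringKrullDim_quotient_succ_le_of_nonZeroDivisor (R := R ⧸ P) (r := Ideal.Quotient.mk P x)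
    (mem_nonZeroDivisors_of_ne_zero (by rwa [Ne, Ideal.Quotient.eq_zero_iff_mem]))
  have e : ((R ⧸ P) ⧸ Ideal.span {Ideal.Quotient.mk P x}) ≃+* R ⧸ (P ⊔ Ideal.span {x}) :=
    (Ideal.quotEquivOfEq (by rw [Ideal.map_span,
      Set.image_singleton])).trans (DoubleQuot.quotQuotEquivQuotSup P (Ideal.span {x}))
  rwa [ringKrullDim_eq_of_ringEquiv e] at h1

variable [IsNoetherianRing R] [IsLocalRing R]

theorem lc_vanish_cyclic (J : Ideal R) (i : ℕ) (h : ringKrullDim (R ⧸ J) < i) :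
    Subsingleton (LC (maximalIdeal R) i (R ⧸ J)) := by
  induction J using ideal_dévissage generalizing i with
  | htop =>
    have : Subsingleton (R ⧸ (⊤ : Ideal R)) := Ideal.Quotient.subsingleton_iff.mpr rfl
    exact lc_subsingleton _ i
  | hex J x h1 h2 =>
    refine lc_middle _ i (colonF_inj J x) (colonG_surj J x) (colon_exact J x) (h1 i ?_) (h2 i ?_)
    · exact (ringKrullDim_le_of_surjective _ (Ideal.Quotient.factor_surjective (le_colonI J x))).trans_lt h
    · exact (ringKrullDim_le_of_surjective _ (Ideal.Quotient.factor_surjective le_sup_left)).trans_lt h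
  | hprime P hP ih =>
    have hi : 0 < i := by
      have : (0 : WithBot ℕ∞) ≤ ringKrullDim (R ⧸ P) := ringKrullDim_nonneg_of_nontrivial
      exact_mod_cast this.trans_lt h
    obtain ⟨i, rfl⟩ := Nat.exists_eq_succ_of_ne_zero hi.ne'
    by_cases hm : maximalIdeal R ≤ P
    · refine lc_torsion _ i (eq_top_iff.mpr fun x _ => ⟨1, fun a ha => ?_⟩)
      obtain ⟨x, rfl⟩ := Submodule.Quotient.mk_surjective _ x
      exact (Submodule.Quotient.mk_eq_zero _).mpr (Ideal.mul_mem_right _ _ (hm (by simpa using ha)))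
    obtain ⟨x, hx, hxP⟩ := SetLike.not_le_iff_exists.mp hm
    have hd : ringKrullDim (R ⧸ (P ⊔ Ideal.span {x})) < i := by
      have h1 := (ringKrullDim_sup_succ_le hP hxP).trans_lt h
      rw [Nat.succ_eq_add_one, Nat.cast_add, Nat.cast_one] at h1
      exact lt_of_add_lt_add_right h1
    have h0 := ih _ (lt_sup_span hxP) i hd
    have hf : Function.Injective (x • (LinearMap.id : (R ⧸ P) →ₗ[R] (R ⧸ P))) := prime_smul_injective hP hxP
    refine subsingleton_of_forall_eq 0 fun a => ?_
    obtain ⟨n, hn⟩ := lc_pow_torsion _ hx a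
    induction n with
    | zero => simpa using hn
    | succ n ihn =>
      rw [pow_succ', mul_smul] at hn
      exact ihn (lc_smul_inj _ i hf (colonG_surj P x) (prime_smul_exact P x) h0 _ hn)

/-- Grothendieck vanishing. -/
theorem lc_vanish (M : Type) [AddCommGroup M] [Module R M] (i : ℕ)
    (h : ∀ m : M, ringKrullDim (R ⧸ Ideal.torsionOf R M m) < i) :
    Subsingleton (LC (maximalIdeal R) i M) := by
  have hfg : ∀ (N : Type) [AddCommGroup N] [Module R N], Module.Finite R N →
      (∀ m : N, ringKrullDim (R ⧸ Ideal.torsionOf R N m) < i) → Subsingleton (LC (maximalIdeal R) i N) := by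
    intro N _ _ hN
    induction hN using IsNoetherianRing.induction_on_isQuotientEquivQuotientPrime R with
    | subsingleton N => exact fun _ => lc_subsingleton _ i
    | quotient N P e =>
      intro hN
      have h1 : ringKrullDim (R ⧸ P.1) < i := by
        refine lt_of_le_of_lt (ringKrullDim_le_of_surjective _ (Ideal.Quotient.factor_surjective ?_))
          (hN (e.symm (Submodule.Quotient.mk 1)))
        intro r hr
        rw [Ideal.mem_torsionOf_iff, ← map_smul, EmbeddingLike.map_eq_zero_iff] at hr
        have := (Submodule.Quotient.mk_eq_zero P.1).mp hr
        simpa using this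
      have := lc_vanish_cyclic P.1 i h1
      obtain ⟨F⟩ := lc_congr (maximalIdeal R) i e
      exact F.injective.subsingleton
    | exact N₁ N₂ N₃ f g hf hg he h1 h3 =>
      intro hN
      refine lc_middle _ i hf hg he (h1 fun m => ?_) (h3 fun m => ?_)
      · refine lt_of_le_of_lt (ringKrullDim_le_of_surjective _ (Ideal.Quotient.factor_surjective ?_)) (hN (f m))
        intro r hr
        rw [Ideal.mem_torsionOf_iff] at hr ⊢
        exact hf (by rw [map_smul, hr, map_zero])
      · obtain ⟨m, rfl⟩ := hg m
        refine lt_of_le_of_lt (ringKrullDim_le_of_surjective _ (Ideal.Quotient.factor_surjective ?_)) (hN m)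
        intro r hr
        rw [Ideal.mem_torsionOf_iff] at hr ⊢
        rw [← map_smul, hr, map_zero]
  refine lc_subsingleton_of_ext _ fun t a => ?_
  obtain ⟨N, b, hN, rfl⟩ := ext_fg i a
  obtain ⟨G, hG⟩ := exists_push (maximalIdeal R) i N.subtype
  have : Subsingleton (LC (maximalIdeal R) i N) := by
    refine hfg N (Module.Finite.iff_fg.mpr hN) fun m => ?_
    refine lt_of_le_of_lt (ringKrullDim_le_of_surjective _ (Ideal.Quotient.factor_surjective ?_)) (h m)
    intro r hr
    rw [Ideal.mem_torsionOf_iff] at hr ⊢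
    exact Subtype.ext hr
  exact (hG t b).symm.trans (by rw [this.elim (lcMap _ i _ t b) 0, map_zero])

end Local
end ZhouLC

namespace ZhouLC
open Abelian Limits

section Trunc
variable {R : Type} [CommRing R] (I : Ideal R)
variable {M E C : Type} [AddCommGroup M] [Module R M] [AddCommGroup E] [Module R E]
  [AddCommGroup C] [Module R C]

/-- The functoriality of torsion submodules. -/
def gamMap (f : M →ₗ[R] E) : gam I M →ₗ[R] gam I E := f.restrict fun _ hm => gam_map I f hm

theorem gamMap_injective {f : M →ₗ[R] E} (hf : Function.Injective f) :
    Function.Injective (gamMap I f) :=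
  fun _ _ h => Subtype.ext (hf (congrArg Subtype.val h))

theorem gamMap_exact {f : M →ₗ[R] E} {g : E →ₗ[R] C} (hf : Function.Injective f)
    (he : Function.Exact f g) :
    Function.Exact (gamMap I f) (gamMap I g) := by
  intro x
  constructor
  · intro h
    obtain ⟨m, hm⟩ := (he x).mp (congrArg Subtype.val h)
    obtain ⟨t, ht⟩ := x.2
    exact ⟨⟨m, t, fun a ha => hf (by rw [map_smul, hm, ht a ha, map_zero])⟩, Subtype.ext hm⟩
  · rintro ⟨m, rfl⟩
    exact Subtype.ext (he.apply_apply_eq_zero m)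

theorem gamMap_surjective {f : M →ₗ[R] E} {g : E →ₗ[R] C} (hf : Function.Injective f)
    (hg : Function.Surjective g) (he : Function.Exact f g) [Module.Injective R E]
    (h : Subsingleton (LC I 1 M)) : Function.Surjective (gamMap I g) := by
  obtain ⟨F, hF, hk⟩ := lc_one I hf hg he (lc_injective I 0 E)
  intro c
  obtain ⟨e, he, h⟩ := (hk c).mp (h.elim _ _)
  exact ⟨⟨e, he⟩, Subtype.ext h⟩

theorem injective_of_surj {B : Type} [AddCommGroup B] [Module R B] (g : E →ₗ[R] B)
    (hg : Function.Surjective g)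
    (h : Module.Injective R (LinearMap.range g)) : Module.Injective R B :=
  injective_of_ev fun J => EV.congr (LinearEquiv.refl R _)
    ((LinearEquiv.ofEq _ _ (LinearMap.range_eq_top.mpr hg)).trans Submodule.topEquiv) (EV.of_injective (R := R) (X := R ⧸ J) 0)

variable [IsNoetherianRing R]

/-- The image of torsion is injective when the torsion of the kernel has injective dimension at most one. -/
theorem range_gamMap_injective {f : M →ₗ[R] E} {g : E →ₗ[R] C} (hf : Function.Injective f)
    (he : Function.Exact f g) [Module.Injective R E]
    (h : ∀ (X : Type) [AddCommGroup X] [Module R X], EV R X (gam I M) 2) :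
    Module.Injective R (LinearMap.range (gamMap I g)) := by
  have := gam_injective I (E := E)
  refine injective_of_ev fun J => ?_
  have he' : Function.Exact (gamMap I f) (gamMap I g).rangeRestrict := by
    intro x
    rw [← gamMap_exact I hf he x]
    exact ⟨fun h => congrArg Subtype.val h, fun h => Subtype.ext h⟩
  exact EV.cov₃ (gamMap_injective I hf) (LinearMap.surjective_rangeRestrict _) he' (EV.of_injective 0) (h _)

theorem ev_of_lc_vanish (l : ℕ) (Y : Type) [AddCommGroup Y] [Module R Y]
    (h0 : Module.Injective R (gam I Y))
    (h : ∀ i, Subsingleton (LC I (i+1) Y)) : EV R (R ⧸ I) Y (l+1) := by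
  induction l generalizing Y with
  | zero =>
    obtain ⟨E, C, _, _, _, _, f, g, hE, hf, hg, he, hC⟩ := exists_cosyzygy R Y
    refine subsingleton_of_forall_eq 0 fun a => ?_
    obtain ⟨c, rfl⟩ := Abelian.Ext.covariant_sequence_exact₁ _ (sc_exact hf hg he) a
      ((EV.of_injective (X := R ⧸ I) (Y := E) 0).elim _ _) rfl
    obtain ⟨φ, rfl⟩ := Abelian.Ext.homEquiv₀.symm.surjective c
    have hφ : ∀ x, φ.hom x ∈ gam I C := fun x => ⟨1, fun a ha => by
      obtain ⟨x, rfl⟩ := Submodule.Quotient.mk_surjective _ x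
      rw [← map_smul, ← Submodule.Quotient.mk_smul, (Submodule.Quotient.mk_eq_zero _).mpr, map_zero]
      exact Ideal.mul_mem_right _ _ (by simpa using ha)⟩
    have hs := gamMap_surjective I hf hg he (h 0)
    obtain ⟨c', hc'⟩ := Abelian.Ext.covariant_sequence_exact₃ _ (sc_exact (gamMap_injective I hf) hs
      (gamMap_exact I hf he)) (Abelian.Ext.mk₀ (ModuleCat.ofHom (φ.hom.codRestrict (gam I C) hφ))) (n₁ := 1) rfl
      ((EV.of_injective (X := R ⧸ I) (Y := gam I Y) 0).elim _ _)
    obtain ⟨ψ, rfl⟩ := Abelian.Ext.homEquiv₀.symm.surjective c'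
    rw [show Abelian.Ext.homEquiv₀.symm ψ = Abelian.Ext.mk₀ ψ from rfl,
      Abelian.Ext.mk₀_comp_mk₀] at hc'
    have h2 := (Abelian.Ext.mk₀_bijective _ _).1 hc'
    have h3 : φ = (ψ ≫ ModuleCat.ofHom (gam I E).subtype) ≫ ModuleCat.ofHom g := by
      refine ModuleCat.hom_ext (LinearMap.ext fun x => ?_)
      exact (congrArg Subtype.val (hom_congr h2 x)).symm
    rw [show Abelian.Ext.homEquiv₀.symm φ = Abelian.Ext.mk₀ φ from rfl, h3,
      ← Abelian.Ext.mk₀_comp_mk₀,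
      Abelian.Ext.comp_assoc _ _ _ (add_zero _) (zero_add _) (by omega)]
    rw [show (Abelian.Ext.mk₀ (ModuleCat.ofHom g)).comp (sc_exact hf hg he).extClass (zero_add 1) = 0 from
      (sc_exact hf hg he).comp_extClass, Abelian.Ext.comp_zero]
  | succ l ih =>
    obtain ⟨E, C, _, _, _, _, f, g, hE, hf, hg, he, hC⟩ := exists_cosyzygy R Y
    rw [← hC]
    refine ih C ?_ fun i => ?_
    · exact injective_of_surj _ (gamMap_surjective I hf hg he (h 0))
        (range_gamMap_injective I hf he fun X _ _ => EV.of_injective 1)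
    · obtain ⟨F⟩ := lc_shift I (i+1) hf hg he (lc_injective I _ E) (lc_injective I _ E)
      have := h (i+1)
      exact F.injective.subsingleton

theorem ev_of_lc_injdim (d : ℕ) (Y : Type) [AddCommGroup Y] [Module R Y]
    (h : ∀ i, ∀ (X : Type) [AddCommGroup X] [Module R X], EV R X (LC I i Y) 2)
    (hd : ∀ i, d < i → Subsingleton (LC I i Y)) (l : ℕ) : EV R (R ⧸ I) Y (d + 2 + l) := by
  induction d generalizing Y with
  | zero =>
    obtain ⟨E, C, _, _, _, _, f, g, hE, hf, hg, he, hC⟩ := exists_cosyzygy R Y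
    obtain ⟨ρ, -⟩ := exists_lc_zero I Y
    rw [show 0 + 2 + l = l + 2 by omega, ← hC]
    refine ev_of_lc_vanish I l C ?_ fun i => ?_
    · exact injective_of_surj _ (gamMap_surjective I hf hg he (hd 1 zero_lt_one))
        (range_gamMap_injective I hf he fun X _ _ => EV.congr (LinearEquiv.refl R X) ρ (h 0 X))
    · obtain ⟨F⟩ := lc_shift I (i+1) hf hg he (lc_injective I _ E) (lc_injective I _ E)
      have := hd (i+2) (by omega)
      exact F.injective.subsingleton
  | succ d ih =>
    obtain ⟨E, C, _, _, _, _, f, g, hE, hf, hg, he, hC⟩ := exists_cosyzygy R Y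
    obtain ⟨ρ, -⟩ := exists_lc_zero I Y
    obtain ⟨ρC, -⟩ := exists_lc_zero I C
    rw [show d + 1 + 2 + l = (d + 1 + l) + 2 by omega, ← hC]
    have hB := range_gamMap_injective I hf he fun X _ _ => EV.congr (LinearEquiv.refl R X) ρ (h 0 X)
    rw [show d + 1 + l + 1 = d + 2 + l by omega]
    refine ih C (fun i X _ _ => ?_) fun i hi => ?_
    · cases i with
      | zero =>
        obtain ⟨F, hF, hk⟩ := lc_one I hf hg he (lc_injective I 0 E)
        refine EV.congr (LinearEquiv.refl R X) ρC.symm ?_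
        refine EV.cov₂ (Submodule.subtype_injective (LinearMap.range (gamMap I g))) hF ?_ (EV.of_injective 1) (h 1 X)
        intro c
        rw [hk]
        constructor
        · rintro ⟨e, he, h⟩
          exact ⟨⟨c, ⟨e, he⟩, Subtype.ext h⟩, rfl⟩
        · rintro ⟨⟨_, ⟨e, rfl⟩⟩, rfl⟩
          exact ⟨e, e.2, rfl⟩
      | succ i =>
        obtain ⟨F⟩ := lc_shift I (i+1) hf hg he (lc_injective I _ E) (lc_injective I _ E)
        exact EV.congr (LinearEquiv.refl R X) F.symm (h _ X)
    · cases i with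
      | zero => omega
      | succ i =>
        obtain ⟨F⟩ := lc_shift I (i+1) hf hg he (lc_injective I _ E) (lc_injective I _ E)
        have := hd (i+2) (by omega)
        exact F.injective.subsingleton

end Trunc
end ZhouLC

namespace ZhouLC
open Abelian Limits

section Localize
variable {R : Type} [CommRing R]

theorem extends_of_ev {Y : Type} [AddCommGroup Y] [Module R Y] (J : Ideal R) (h : EV R (R ⧸ J) Y 1)
    (φ : J →ₗ[R] Y) : ∃ y : Y, ∀ x : J, φ x = (x : R) • y := by
  have he : Function.Exact (Submodule.subtype J) (Submodule.mkQ J) :=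
    LinearMap.exact_iff.mpr (by rw [Submodule.ker_mkQ, Submodule.range_subtype])
  obtain ⟨c, hc⟩ := Abelian.Ext.contravariant_sequence_exact₁ (sc_exact (Submodule.subtype_injective J)
    (Submodule.mkQ_surjective J) he) (ModuleCat.of R Y) (Abelian.Ext.mk₀ (ModuleCat.ofHom φ))
    (n₁ := 1) rfl (h.elim _ _)
  obtain ⟨ψ, rfl⟩ := Abelian.Ext.homEquiv₀.symm.surjective c
  rw [show Abelian.Ext.homEquiv₀.symm ψ = Abelian.Ext.mk₀ ψ from rfl,
    Abelian.Ext.mk₀_comp_mk₀] at hc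
  have h2 := (Abelian.Ext.mk₀_bijective _ _).1 hc
  refine ⟨ψ.hom (1 : R), fun x => ?_⟩
  rw [← map_smul, smul_eq_mul, mul_one]
  exact (hom_congr h2 x).symm

/-- Each class in `Ext¹(R / J, Y)` comes from a linear map `J → Y`, and is killed by the scalars for which
the scaled map extends to `R`. -/
theorem ext_one_rep {Y : Type} [AddCommGroup Y] [Module R Y] (J : Ideal R) (a : EX R (R ⧸ J) Y 1) :
    ∃ φ : J →ₗ[R] Y, ∀ (s : R) (y : Y), (∀ x : J, s • φ x = (x : R) • y) → s • a = 0 := by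
  have he : Function.Exact (Submodule.subtype J) (Submodule.mkQ J) :=
    LinearMap.exact_iff.mpr (by rw [Submodule.ker_mkQ, Submodule.range_subtype])
  have hS := sc_exact (Submodule.subtype_injective J) (Submodule.mkQ_surjective J) he
  obtain ⟨c, rfl⟩ := Abelian.Ext.contravariant_sequence_exact₃ hS (ModuleCat.of R Y) a
    ((EV.of_projective (R := R) (X := R) 0).elim _ _) (n₀ := 0) rfl
  obtain ⟨φ, rfl⟩ := Abelian.Ext.homEquiv₀.symm.surjective c
  refine ⟨φ.hom, fun s y hy => ?_⟩
  rw [show Abelian.Ext.homEquiv₀.symm φ = Abelian.Ext.mk₀ φ from rfl, ← Abelian.Ext.comp_smul,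
    ← Abelian.Ext.mk₀_smul]
  have h3 : s • φ = ModuleCat.ofHom (Submodule.subtype J) ≫ ModuleCat.ofHom (LinearMap.toSpanSingleton R Y y) := by
    refine ModuleCat.hom_ext (LinearMap.ext fun x => ?_)
    exact hy x
  rw [h3, ← Abelian.Ext.mk₀_comp_mk₀, ← Abelian.Ext.comp_assoc _ _ _ rfl (zero_add _) (by omega)]
  rw [show hS.extClass.comp (Abelian.Ext.mk₀ (ModuleCat.ofHom (Submodule.subtype J))) (add_zero 1) = 0 from
      hS.extClass_comp, Abelian.Ext.zero_comp]

open IsLocalRing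

theorem ev_of_localized [IsNoetherianRing R] (l : ℕ) (M : Type) [AddCommGroup M] [Module R M]
    (h : ∀ (P : Ideal R) [P.IsPrime], EV (Localization.AtPrime P)
      (Localization.AtPrime P ⧸ maximalIdeal (Localization.AtPrime P))
      (LocalizedModule P.primeCompl M) (l+1)) :
    ∀ (X : Type) [AddCommGroup X] [Module R X], EV R X M (l+1) := by
  induction l generalizing M with
  | zero =>
    refine EV.all_of_ideal fun J => ?_
    refine ev_ideal_induction 1 (fun P hP ih => ?_) J
    refine subsingleton_of_forall_eq 0 fun a => ?_
    obtain ⟨φ, hφ⟩ := ext_one_rep P a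
    suffices ∃ s, s ∉ P ∧ ∃ y : M, ∀ x : P, s • φ x = (x : R) • y by
      obtain ⟨s, hs, y, hy⟩ := this
      exact prime_quot_smul hP hs (ih _ (lt_sup_span hs)) a (hφ s y hy)
    set A := Localization.AtPrime P
    have hP' : P.map (algebraMap R A) = maximalIdeal A := Localization.AtPrime.map_eq_maximalIdeal
    have h1 := h P
    rw [← hP'] at h1
    obtain ⟨y, hy⟩ := extends_of_ev _ h1 (IsLocalizedModule.mapExtendScalars P.primeCompl
      (Algebra.idealMap (S := A) P) (LocalizedModule.mkLinearMap P.primeCompl M) A φ)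
    obtain ⟨⟨c, u⟩, rfl⟩ := IsLocalizedModule.mk'_surjective P.primeCompl (LocalizedModule.mkLinearMap P.primeCompl M) y
    have h2 : ∀ x : P, ∃ v : P.primeCompl, v • (u : R) • φ x = v • (x : R) • c := by
      intro x
      have h3 := hy (Algebra.idealMap (S := A) P x)
      rw [IsLocalizedModule.mapExtendScalars_apply_apply, IsLocalizedModule.map_apply] at h3
      have h4 : ((Algebra.idealMap (S := A) P x : P.map (algebraMap R A)) : A) = algebraMap R A x := rfl
      rw [h4, algebraMap_smul] at h3
      simp only [Function.uncurry_apply_pair] at h3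
      rw [← IsLocalizedModule.mk'_smul, ← IsLocalizedModule.mk'_one P.primeCompl,
        IsLocalizedModule.mk'_eq_mk'_iff] at h3
      obtain ⟨v, hv⟩ := h3
      refine ⟨v, ?_⟩
      simpa [Submonoid.smul_def] using hv.symm
    obtain ⟨S, hS⟩ : P.FG := IsNoetherian.noetherian P
    change Submodule.span R (S : Set R) = P at hS
    choose V hV using h2
    have hSP : ∀ x ∈ S, x ∈ P := fun x hx => hS.le (Submodule.subset_span hx)
    set v : P.primeCompl := ∏ x ∈ S.attach, V ⟨x, hSP x x.2⟩
    have h5 : ∀ x (hx : x ∈ P), ((v * u : P.primeCompl) : R) • φ ⟨x, hx⟩ = x • (v : R) • c := by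
      intro x hx
      have hx' : x ∈ Submodule.span R (S : Set R) := by rw [hS]; exact hx
      induction hx' using Submodule.span_induction with
      | mem x hxS =>
        obtain ⟨w, hw⟩ := Finset.dvd_prod_of_mem (fun x : S => V ⟨x, hSP x x.2⟩) (Finset.mem_attach S ⟨x, hxS⟩)
        have h6 := congrArg (fun z => (w : R) • z) (hV ⟨x, hx⟩)
        have hv : v = V ⟨x, hx⟩ * w := hw
        simp only [Submonoid.smul_def, smul_smul] at h6
        rw [hv, smul_smul, Submonoid.coe_mul, Submonoid.coe_mul]
        convert h6 using 2 <;> ring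
      | zero => rw [zero_smul]; exact (congrArg _ (map_zero φ)).trans (smul_zero _)
      | add y z hy hz h1 h2 =>
        rw [hS] at hy hz
        rw [show (⟨y + z, hx⟩ : P) = ⟨y, hy⟩ + ⟨z, hz⟩ from rfl, map_add, smul_add, h1, h2,
          add_smul]
      | smul r y hy h1 =>
        rw [hS] at hy
        rw [show (⟨r • y, hx⟩ : P) = r • ⟨y, hy⟩ from rfl, map_smul, smul_comm, h1, smul_eq_mul,
          mul_smul]
    exact ⟨_, (v * u).2, (v : R) • c, fun x => h5 x x.2⟩
  | succ l ih =>
    obtain ⟨E, C, _, _, _, _, f, g, hE, hf, hg, he, hC⟩ := exists_cosyzygy R M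
    intro X _ _
    rw [← hC]
    refine ih C (fun P _ => ?_) X
    have : Module.Injective (Localization P.primeCompl) (LocalizedModule P.primeCompl E) :=
      Module.injective_of_isLocalizedModule P.primeCompl (LocalizedModule.mkLinearMap P.primeCompl E)
    refine EV.cov₃ (f := LocalizedModule.map P.primeCompl f) (g := LocalizedModule.map P.primeCompl g)
      ?_ ?_ ?_ (EV.of_injective l) (h P)
    · exact IsLocalizedModule.map_injective P.primeCompl (LocalizedModule.mkLinearMap _ _) (LocalizedModule.mkLinearMap _ _) f hf
    · exact IsLocalizedModule.map_surjective P.primeCompl (LocalizedModule.mkLinearMap _ _) (LocalizedModule.mkLinearMap _ _) g hg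
    · exact IsLocalizedModule.map_exact P.primeCompl (LocalizedModule.mkLinearMap _ _) (LocalizedModule.mkLinearMap _ _)
        (LocalizedModule.mkLinearMap _ _) f g he

end Localize
end ZhouLC

namespace ZhouLC
open Abelian Limits

section Dim
variable {R : Type} [CommRing R] {M : Type} [AddCommGroup M] [Module R M]

theorem krullDim_torsionOf_le (m : M) :
    ringKrullDim (R ⧸ Ideal.torsionOf R M m) ≤ Order.krullDim (Module.support R M) := by
  rw [ringKrullDim_quotient]
  refine Order.krullDim_le_of_strictMono (fun P => ⟨P.1, ?_⟩) fun _ _ h => h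
  rw [Module.mem_support_iff_exists_annihilator]
  refine ⟨m, fun r hr => P.2 ?_⟩
  have := Submodule.mem_annihilator_span_singleton m r |>.1 hr
  exact this

theorem krullDim_support_localized_le (P : Ideal R) [P.IsPrime] :
    Order.krullDim (Module.support (Localization.AtPrime P) (LocalizedModule P.primeCompl M)) ≤
      Order.krullDim (Module.support R M) := by
  refine Order.krullDim_le_of_strictMono (fun Q => ⟨PrimeSpectrum.comap (algebraMap R _) Q.1, ?_⟩) ?_
  · have h := Q.2
    rw [Module.mem_support_iff_exists_annihilator] at h ⊢
    obtain ⟨x, hx⟩ := h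
    obtain ⟨⟨m, s⟩, rfl⟩ := IsLocalizedModule.mk'_surjective P.primeCompl (LocalizedModule.mkLinearMap P.primeCompl M) x
    refine ⟨m, fun r hr => hx ?_⟩
    rw [Submodule.mem_annihilator_span_singleton] at hr ⊢
    rw [algebraMap_smul, Function.uncurry_apply_pair, ← IsLocalizedModule.mk'_smul, hr,
      IsLocalizedModule.mk'_zero]
  · intro a b hab
    have : PrimeSpectrum.comap (algebraMap R (Localization.AtPrime P)) a.1 ≤ PrimeSpectrum.comap (algebraMap R (Localization.AtPrime P)) b.1 :=
      Ideal.comap_mono hab.le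
    refine lt_of_le_of_ne this fun h => hab.ne ?_
    exact Subtype.ext (PrimeSpectrum.localization_comap_injective _ P.primeCompl (congrArg Subtype.val h))

end Dim
end ZhouLC

namespace ZhouLC
open Abelian Limits TensorProduct

section BaseChange
variable {R : Type} [CommRing R] {S : Type} [CommRing S] [Algebra R S] [Module.Flat R S]

theorem injective_restrictScalars (E : Type) [AddCommGroup E] [Module R E] [Module S E]
    [IsScalarTower R S E]
    [Module.Injective S E] : Module.Injective R E := by
  refine Module.Baer.injective fun J φ => ?_
  have hi : Function.Injective (LinearMap.baseChange S J.subtype) :=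
    Module.Flat.lTensor_preserves_injective_linearMap (M := S) J.subtype Subtype.val_injective
  obtain ⟨ψ, hψ⟩ := Module.Injective.out _ hi (LinearMap.liftBaseChange S φ)
  refine ⟨(LinearMap.toSpanSingleton R E (ψ (1 ⊗ₜ 1))), fun x hx => ?_⟩
  have h := hψ (1 ⊗ₜ ⟨x, hx⟩)
  rw [LinearMap.liftBaseChange_tmul, one_smul] at h
  rw [← h, LinearMap.baseChange_tmul, LinearMap.toSpanSingleton_apply,
    ← LinearMap.map_smul_of_tower,
    ← TensorProduct.tmul_smul, smul_eq_mul, mul_one]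
  rfl

theorem injective_baseChange [IsNoetherianRing R] (E : Type) [AddCommGroup E] [Module R E]
    [Module.Injective R E] :
    Module.Injective R (S ⊗[R] E) := by
  refine Module.Baer.injective fun J φ => ?_
  have : Module.FinitePresentation R J := Module.finitePresentation_of_finite R J
  have hb := Module.FinitePresentation.isBaseChange_map R J E S
  suffices ∀ Φ : S ⊗[R] J →ₗ[S] S ⊗[R] E, ∃ y : S ⊗[R] E, ∀ x : J, Φ (1 ⊗ₜ x) = (x : R) • y by
    obtain ⟨y, hy⟩ := this (LinearMap.liftBaseChange S φ)
    refine ⟨LinearMap.toSpanSingleton R _ y, fun x hx => ?_⟩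
    have h := hy ⟨x, hx⟩
    rw [LinearMap.liftBaseChange_tmul, one_smul] at h
    rw [h]; rfl
  intro Φ
  induction Φ using hb.inductionOn with
  | zero => exact ⟨0, fun x => by simp⟩
  | tmul h =>
    obtain ⟨ψ, hψ⟩ := Module.Injective.out J.subtype Subtype.val_injective h
    refine ⟨1 ⊗ₜ ψ 1, fun x => ?_⟩
    rw [← TensorProduct.tmul_smul, ← map_smul, smul_eq_mul, mul_one]
    exact congrArg (fun z => (1 : S) ⊗ₜ[R] z) (hψ x).symm
  | smul s Φ h =>
    obtain ⟨y, hy⟩ := h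
    exact ⟨s • y, fun x => by rw [LinearMap.smul_apply, hy, smul_comm]⟩
  | add Φ Ψ h1 h2 =>
    obtain ⟨y, hy⟩ := h1
    obtain ⟨z, hz⟩ := h2
    exact ⟨y + z, fun x => by rw [LinearMap.add_apply, hy, hz, smul_add]⟩

omit [Module.Flat R S] in
theorem mem_gam_map (I : Ideal R) {Y : Type} [AddCommGroup Y] [Module R Y] [Module S Y]
    [IsScalarTower R S Y] {y : Y} :
    y ∈ gam (I.map (algebraMap R S)) Y ↔ ∃ t : ℕ, ∀ a ∈ I ^ t, a • y = 0 := by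
  refine ⟨fun ⟨t, h⟩ => ⟨t, fun a ha => ?_⟩, fun ⟨t, h⟩ => ⟨t, fun a ha => ?_⟩⟩
  · rw [← algebraMap_smul S]
    exact h _ (by rw [← Ideal.map_pow]; exact Ideal.mem_map_of_mem _ ha)
  · rw [← Ideal.map_pow] at ha
    have : I.map (algebraMap R S) ^ t ≤ LinearMap.ker (LinearMap.toSpanSingleton S Y y) := by
      rw [← Ideal.map_pow, Ideal.map_le_iff_le_comap]
      intro a ha
      change algebraMap R S a • y = 0
      rw [algebraMap_smul, h a ha]
    rw [Ideal.map_pow] at ha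
    exact this ha

theorem lc_of_restrict_injective (I : Ideal R) (i : ℕ) (Y : Type) [AddCommGroup Y] [Module R Y]
    [Module S Y]
    [IsScalarTower R S Y] [Module.Injective R Y] :
    Subsingleton (LC (I.map (algebraMap R S)) (i+1) Y) := by
  induction i using Nat.strong_induction_on generalizing Y with
  | _ i ih =>
  obtain ⟨E, C, _, _, _, _, f, g, hE, hf, hg, he⟩ := exists_embedding S Y
  let _ : Module R E := Module.compHom E (algebraMap R S)
  let _ : Module R C := Module.compHom C (algebraMap R S)
  have : IsScalarTower R S E := IsScalarTower.of_algebraMap_smul fun _ _ => rfl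
  have : IsScalarTower R S C := IsScalarTower.of_algebraMap_smul fun _ _ => rfl
  have hE' : Module.Injective R E := injective_restrictScalars (S := S) E
  cases i with
  | zero =>
    obtain ⟨F, hF, hk⟩ := lc_one (I.map (algebraMap R S)) hf hg he (lc_injective _ 0 E)
    suffices ∀ c, F c = 0 from ⟨fun a b => by
      obtain ⟨a, rfl⟩ := hF a
      obtain ⟨b, rfl⟩ := hF b
      rw [this, this]⟩
    rintro ⟨c, hc⟩
    rw [hk]
    obtain ⟨r, hr⟩ := Module.Injective.out (f.restrictScalars R) hf LinearMap.id
    obtain ⟨e, rfl⟩ := hg c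
    refine ⟨e - f (r e), ?_, ?_⟩
    · rw [mem_gam_map] at hc ⊢
      obtain ⟨t, ht⟩ := hc
      refine ⟨t, fun a ha => ?_⟩
      have h1 := ht a ha
      rw [← LinearMap.map_smul_of_tower] at h1
      obtain ⟨y, hy⟩ := (he _).mp h1
      have h2 : r (f y) = y := hr y
      rw [hy, map_smul] at h2
      rw [smul_sub, ← hy, ← h2, LinearMap.map_smul_of_tower, sub_self]
    · rw [map_sub, he.apply_apply_eq_zero, sub_zero]
  | succ i =>
    have hC : Module.Injective R C := injective_of_ev fun J =>
      EV.cov₃ (f := f.restrictScalars R) (g := g.restrictScalars R) hf hg he (EV.of_injective 0) (EV.of_injective 1)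
    obtain ⟨e⟩ := lc_shift _ (i+1) hf hg he (lc_injective _ i E) (lc_injective _ (i+1) E)
    have := ih i (Nat.lt_succ_self i) C
    exact e.symm.toEquiv.subsingleton

theorem baseChange_exact {M N P : Type} [AddCommGroup M] [Module R M] [AddCommGroup N] [Module R N]
    [AddCommGroup P] [Module R P] {f : M →ₗ[R] N} {g : N →ₗ[R] P} (h : Function.Exact f g) :
    Function.Exact (f.baseChange S) (g.baseChange S) := Module.Flat.lTensor_exact (M := S) h

theorem baseChange_injective {M N : Type} [AddCommGroup M] [Module R M] [AddCommGroup N]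
    [Module R N]
    {f : M →ₗ[R] N} (h : Function.Injective f) :
    Function.Injective (f.baseChange S) := Module.Flat.lTensor_preserves_injective_linearMap
    (M := S) f h

omit [Module.Flat R S] in
theorem baseChange_surjective {M N : Type} [AddCommGroup M] [Module R M] [AddCommGroup N]
    [Module R N]
    {f : M →ₗ[R] N} (h : Function.Surjective f) :
    Function.Surjective (f.baseChange S) := LinearMap.lTensor_surjective S h

theorem range_baseChange_gam [IsNoetherianRing R] (I : Ideal R) (M : Type) [AddCommGroup M]
    [Module R M] :
    LinearMap.range ((gam I M).subtype.baseChange S) = gam (I.map (algebraMap R S)) (S ⊗[R] M) := by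
  apply le_antisymm
  · rintro _ ⟨x, rfl⟩
    induction x using TensorProduct.induction_on with
    | zero => rw [map_zero]; exact zero_mem _
    | add x y hx hy => rw [map_add]; exact add_mem hx hy
    | tmul s m =>
      rw [mem_gam_map]
      obtain ⟨m, t, ht⟩ := m
      refine ⟨t, fun a ha => ?_⟩
      rw [LinearMap.baseChange_tmul, ← TensorProduct.tmul_smul]
      exact (congrArg _ (ht a ha)).trans (TensorProduct.tmul_zero _ _)
  · intro z hz
    rw [mem_gam_map] at hz
    obtain ⟨t, ht⟩ := hz
    obtain ⟨n, v, hv⟩ := Submodule.fg_iff_exists_fin_generating_family.mp (IsNoetherian.noetherian (I ^ t))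
    let D : M →ₗ[R] (Fin n → M) := LinearMap.pi fun i => LinearMap.lsmul R M (v i)
    have hD : LinearMap.ker D ≤ gam I M := by
      intro m hm
      refine ⟨t, fun a ha => ?_⟩
      have : I ^ t ≤ LinearMap.ker (LinearMap.toSpanSingleton R M m) := by
        rw [← hv, Submodule.span_le]
        rintro _ ⟨i, rfl⟩
        exact congrFun hm i
      exact this ha
    have h0 : D.baseChange S z = 0 := by
      apply (TensorProduct.piRight R S S (fun _ : Fin n => M)).injective
      rw [map_zero]
      funext i
      have : ∀ z : S ⊗[R] M, TensorProduct.piRight R S S (fun _ : Fin n => M) (D.baseChange S z) i = v i • z := by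
        intro z
        induction z using TensorProduct.induction_on with
        | zero => simp
        | add x y hx hy => rw [map_add, map_add, Pi.add_apply, hx, hy, smul_add]
        | tmul s m => simp [D]
      rw [this, ht _ (hv ▸ Submodule.subset_span ⟨i, rfl⟩)]; rfl
    obtain ⟨w, rfl⟩ := (baseChange_exact (S := S) (LinearMap.exact_subtype_ker_map D) z).mp h0
    refine ⟨(Submodule.inclusion hD).baseChange S w, ?_⟩
    rw [← LinearMap.comp_apply, ← LinearMap.baseChange_comp]
    rfl

theorem exists_equiv_of_ker {A B C : Type} [AddCommGroup A] [Module S A] [AddCommGroup B]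
    [Module S B]
    [AddCommGroup C] [Module S C] (f : A →ₗ[S] B) (g : A →ₗ[S] C) (hf : Function.Surjective f)
    (hg : Function.Surjective g) (h : LinearMap.ker f = LinearMap.ker g) : Nonempty (B ≃ₗ[S] C) :=
  ⟨(f.quotKerEquivOfSurjective hf).symm.trans ((Submodule.quotEquivOfEq _ _ h).trans (g.quotKerEquivOfSurjective hg))⟩

theorem lc_baseChange [IsNoetherianRing R] (I : Ideal R) (j : ℕ) (M : Type) [AddCommGroup M]
    [Module R M] :
    Nonempty (S ⊗[R] LC I j M ≃ₗ[S] LC (I.map (algebraMap R S)) j (S ⊗[R] M)) := by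
  induction j using Nat.strong_induction_on generalizing M with
  | _ j ih =>
  match j with
  | 0 =>
    obtain ⟨e, -⟩ := exists_lc_zero I M
    obtain ⟨e', -⟩ := exists_lc_zero (I.map (algebraMap R S)) (S ⊗[R] M)
    exact ⟨(e.baseChange R S).trans ((LinearEquiv.ofInjective ((gam I M).subtype.baseChange S)
      (baseChange_injective Subtype.val_injective)).trans ((LinearEquiv.ofEq _ _ (range_baseChange_gam I M)).trans e'.symm))⟩
  | 1 =>
    obtain ⟨E, C, _, _, _, _, f, g, hE, hf, hg, he⟩ := exists_embedding R M
    have := injective_baseChange (R := R) (S := S) E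
    obtain ⟨F, hF, hk⟩ := lc_one I hf hg he (lc_injective _ 0 E)
    obtain ⟨F', hF', hk'⟩ := lc_one (I.map (algebraMap R S)) (baseChange_injective (S := S) hf) (baseChange_surjective (S := S) hg)
      (baseChange_exact he) (lc_of_restrict_injective I 0 _)
    let e : S ⊗[R] gam I C ≃ₗ[S] gam (I.map (algebraMap R S)) (S ⊗[R] C) :=
      (LinearEquiv.ofInjective ((gam I C).subtype.baseChange S)
        (baseChange_injective Subtype.val_injective)).trans (LinearEquiv.ofEq _ _ (range_baseChange_gam I C))
    have he' : ∀ x, (e x : S ⊗[R] C) = (gam I C).subtype.baseChange S x := fun _ => rfl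
    refine exists_equiv_of_ker (F.baseChange S) (F' ∘ₗ e.toLinearMap) (baseChange_surjective hF)
      (hF'.comp e.surjective) ?_
    have hG : Function.Exact (gamMap I g) F := fun c => by
      rw [hk]
      exact ⟨fun ⟨e, he, h⟩ => ⟨⟨e, he⟩, Subtype.ext h⟩, fun ⟨e, h⟩ => ⟨e, e.2, congrArg Subtype.val h⟩⟩
    ext x
    rw [LinearMap.mem_ker, LinearMap.mem_ker, baseChange_exact hG x]
    change _ ↔ F' (e x) = 0
    rw [hk', he']
    have hcomm : ∀ y, (gam I C).subtype.baseChange S ((gamMap I g).baseChange S y) =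
        g.baseChange S ((gam I E).subtype.baseChange S y) := by
      intro y
      rw [← LinearMap.comp_apply, ← LinearMap.baseChange_comp, ← LinearMap.comp_apply,
        ← LinearMap.baseChange_comp]
      rfl
    constructor
    · rintro ⟨y, rfl⟩
      exact ⟨_, range_baseChange_gam (S := S) I E ▸ ⟨y, rfl⟩, (hcomm y).symm⟩
    · rintro ⟨z, hz, h⟩
      rw [← range_baseChange_gam] at hz
      obtain ⟨y, rfl⟩ := hz
      exact ⟨y, baseChange_injective (S := S) (f := (gam I C).subtype) Subtype.val_injective ((hcomm y).trans h)⟩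
  | j + 2 =>
    obtain ⟨E, C, _, _, _, _, f, g, hE, hf, hg, he⟩ := exists_embedding R M
    have := injective_baseChange (R := R) (S := S) E
    obtain ⟨e⟩ := lc_shift I (j+1) hf hg he (lc_injective _ _ E) (lc_injective _ _ E)
    obtain ⟨e'⟩ := lc_shift (I.map (algebraMap R S)) (j+1) (baseChange_injective (S := S) hf) (baseChange_surjective (S := S) hg)
      (baseChange_exact he) (lc_of_restrict_injective I _ _) (lc_of_restrict_injective I _ _)
    obtain ⟨e''⟩ := ih (j+1) (by omega) C
    exact ⟨(e.symm.baseChange R S).trans (e''.trans e')⟩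

omit [Algebra R S] [Module.Flat R S] in
theorem gam_eq_of_pow_le {I J : Ideal R} {a b : ℕ} (h : I ^ a ≤ J) (h' : J ^ b ≤ I)
    (M : Type) [AddCommGroup M] [Module R M] : gam I M = gam J M := by
  have key : ∀ {I J : Ideal R} {a : ℕ}, I ^ a ≤ J → gam J M ≤ gam I M := by
    rintro I J a h m ⟨t, ht⟩
    exact ⟨a * t, fun r hr => ht r (Ideal.pow_right_mono h t (pow_mul I a t ▸ hr))⟩
  exact le_antisymm (key h') (key h)

omit [Algebra R S] [Module.Flat R S] in
theorem lc_of_pow_le {I J : Ideal R} {a b : ℕ} (h : I ^ a ≤ J) (h' : J ^ b ≤ I) (j : ℕ)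
    (M : Type) [AddCommGroup M] [Module R M] : Nonempty (LC I j M ≃ₗ[R] LC J j M) := by
  induction j using Nat.strong_induction_on generalizing M with
  | _ j ih =>
  match j with
  | 0 =>
    obtain ⟨e, -⟩ := exists_lc_zero I M
    obtain ⟨e', -⟩ := exists_lc_zero J M
    exact ⟨e.trans ((LinearEquiv.ofEq _ _ (gam_eq_of_pow_le h h' M)).trans e'.symm)⟩
  | 1 =>
    obtain ⟨E, C, _, _, _, _, f, g, hE, hf, hg, he⟩ := exists_embedding R M
    obtain ⟨F, hF, hk⟩ := lc_one I hf hg he (lc_injective _ 0 E)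
    obtain ⟨F', hF', hk'⟩ := lc_one J hf hg he (lc_injective _ 0 E)
    refine exists_equiv_of_ker F (F' ∘ₗ (LinearEquiv.ofEq _ _ (gam_eq_of_pow_le h h' C)).toLinearMap) hF
      (hF'.comp (LinearEquiv.surjective _)) ?_
    ext c
    rw [LinearMap.mem_ker, LinearMap.mem_ker, hk, gam_eq_of_pow_le h h' E]
    exact (hk' (LinearEquiv.ofEq _ _ (gam_eq_of_pow_le h h' C) c)).symm
  | j + 2 =>
    obtain ⟨E, C, _, _, _, _, f, g, hE, hf, hg, he⟩ := exists_embedding R M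
    obtain ⟨e⟩ := lc_shift I (j+1) hf hg he (lc_injective _ _ E) (lc_injective _ _ E)
    obtain ⟨e'⟩ := lc_shift J (j+1) hf hg he (lc_injective _ _ E) (lc_injective _ _ E)
    obtain ⟨e''⟩ := ih (j+1) (by omega) C
    exact ⟨e.symm.trans (e''.trans e')⟩

end BaseChange
end ZhouLC

namespace ZhouLC
open Abelian Limits TensorProduct

section
variable {R : Type} [CommRing R] [IsNoetherianRing R]

theorem lc_localized (I : Ideal R) (j : ℕ) (P : Ideal R) [P.IsPrime] :
    Nonempty (LocalizedModule P.primeCompl (LC I j R) ≃ₗ[Localization.AtPrime P]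
      LC (I.map (algebraMap R (Localization.AtPrime P))) j (Localization.AtPrime P)) := by
  have : Module.Flat R (Localization.AtPrime P) := IsLocalization.flat _ P.primeCompl
  obtain ⟨e⟩ := lc_baseChange (S := Localization.AtPrime P) I j R
  obtain ⟨e'⟩ := lc_congr (I.map (algebraMap R (Localization.AtPrime P))) j
    (TensorProduct.AlgebraTensorModule.rid R (Localization.AtPrime P) (Localization.AtPrime P))
  exact ⟨(LocalizedModule.equivTensorProduct P.primeCompl _).trans (e.trans e')⟩

end

section Twist
variable {A S : Type} [CommRing A] [CommRing S]

/-- Extension of scalars along a ring homomorphism. -/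
def BC (φ : A →+* S) (N : Type) [AddCommGroup N] [Module A N] : Type :=
  letI := φ.toAlgebra
  S ⊗[A] N

variable (φ : A →+* S) {N N' N'' : Type} [AddCommGroup N] [Module A N] [AddCommGroup N']
    [Module A N']
  [AddCommGroup N''] [Module A N'']

noncomputable instance : AddCommGroup (BC φ N) :=
  letI := φ.toAlgebra
  (inferInstance : AddCommGroup (S ⊗[A] N))

noncomputable instance : Module S (BC φ N) :=
  letI := φ.toAlgebra
  (inferInstance : Module S (S ⊗[A] N))

/-- The pure tensors in an extension of scalars. -/
noncomputable def bct (s : S) (n : N) : BC φ N :=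
  let _ := φ.toAlgebra
  s ⊗ₜ[A] n

theorem bc_induction {p : BC φ N → Prop} (h0 : p 0) (ht : ∀ s n, p (bct φ s n))
    (ha : ∀ x y, p x → p y → p (x + y)) (x) : p x :=
  let _ := φ.toAlgebra
  TensorProduct.induction_on (R := A) (M := S) (N := N) x h0 ht ha

theorem smul_bct (s t : S) (n : N) : s • bct φ t n = bct φ (s * t) n := rfl

theorem bct_smul (s : S) (a : A) (n : N) : bct φ s (a • n) = φ a • bct φ s n :=
  let _ := φ.toAlgebra
  TensorProduct.tmul_smul (R := A) a s n

theorem bct_zero (s : S) : bct φ s (0 : N) = 0 :=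
  let _ := φ.toAlgebra
  TensorProduct.tmul_zero (R := A) N s

/-- Functoriality of extension of scalars. -/
noncomputable def bcMap (f : N →ₗ[A] N') : BC φ N →ₗ[S] BC φ N' :=
  let _ := φ.toAlgebra
  f.baseChange S

theorem bcMap_bct (f : N →ₗ[A] N') (s : S) (n : N) : bcMap φ f (bct φ s n) = bct φ s (f n) := rfl

theorem bcMap_exact (hφ : φ.Flat) {f : N →ₗ[A] N'} {g : N' →ₗ[A] N''} (h : Function.Exact f g) :
    Function.Exact (bcMap φ f) (bcMap φ g) :=
  let _ := φ.toAlgebra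
  have : Module.Flat A S := hφ
  baseChange_exact h

theorem bcMap_injective (hφ : φ.Flat) {f : N →ₗ[A] N'} (h : Function.Injective f) :
    Function.Injective (bcMap φ f) :=
  let _ := φ.toAlgebra
  have : Module.Flat A S := hφ
  baseChange_injective h

theorem bc_lc [IsNoetherianRing A] (hφ : φ.Flat) (I : Ideal A) (j : ℕ) :
    Nonempty (BC φ (LC I j N) ≃ₗ[S] LC (I.map φ) j (BC φ N)) :=
  let _ := φ.toAlgebra
  have : Module.Flat A S := hφ
  lc_baseChange I j N

theorem bc_self : Nonempty (BC φ A ≃ₗ[S] S) :=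
  let _ := φ.toAlgebra
  ⟨TensorProduct.AlgebraTensorModule.rid A S S⟩

theorem bc_lc_lc [IsNoetherianRing A] (hφ : φ.Flat) (I J : Ideal A) (i j : ℕ) :
    Nonempty (BC φ (LC J i (LC I j A)) ≃ₗ[S] LC (J.map φ) i (LC (I.map φ) j S)) := by
  obtain ⟨e1⟩ := bc_lc φ (N := LC I j A) hφ J i
  obtain ⟨e2⟩ := bc_lc φ (N := A) hφ I j
  obtain ⟨e3⟩ := bc_self φ
  obtain ⟨e4⟩ := lc_congr (I.map φ) j e3
  obtain ⟨e5⟩ := lc_congr (J.map φ) i (e2.trans e4)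
  exact ⟨e1.trans e5⟩

theorem bc_lc_lc_twist [IsNoetherianRing A] (α : A →+* S) (hφ : φ.Flat) (hα : α.Flat) (n : ℕ)
    (h : ∀ I : Ideal A, I.map φ ^ n ≤ I.map α) (h' : ∀ I : Ideal A, I.map α ^ n ≤ I.map φ)
    (I J : Ideal A) (i j : ℕ) :
    Nonempty (BC φ (LC J i (LC I j A)) ≃ₗ[S] BC α (LC J i (LC I j A))) := by
  obtain ⟨e1⟩ := bc_lc_lc φ hφ I J i j
  obtain ⟨e2⟩ := bc_lc_lc α hα I J i j
  obtain ⟨e3⟩ := lc_of_pow_le (h J) (h' J) i (LC (I.map φ) j S)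
  obtain ⟨e4⟩ := lc_of_pow_le (h I) (h' I) j S
  obtain ⟨e5⟩ := lc_congr (J.map α) i e4
  exact ⟨e1.trans (e3.trans (e5.trans e2.symm))⟩

end Twist
end ZhouLC

namespace ZhouLC
open Abelian Limits IsLocalRing Pointwise

section WR
variable {A : Type} [CommRing A]

/-- `rs` is a weakly regular sequence on `A ⧸ J`. -/
def WR : Ideal A → List A → Prop
  | _, [] => True
  | J, x :: rs => (∀ a, x * a ∈ J → a ∈ J) ∧ WR (J ⊔ Ideal.span {x}) rs

end WR

section
variable {A : Type} [CommRing A] [IsLocalRing A] [IsNoetherianRing A]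

theorem le_of_le_sup_mul {N J : Ideal A} (h : N ≤ J ⊔ maximalIdeal A * N) : N ≤ J :=
  Submodule.le_of_le_smul_of_le_jacobson_bot (IsNoetherian.noetherian N)
    (maximalIdeal_le_jacobson _) h

theorem exchange (rs : List A) : ∀ (J : Ideal A) (x : A), J ⊔ Ideal.ofList rs = maximalIdeal A →
    x ∈ maximalIdeal A → x ∉ maximalIdeal A ^ 2 ⊔ J → ∃ rs' : List A, rs'.length + 1 = rs.length ∧
      J ⊔ Ideal.span {x} ⊔ Ideal.ofList rs' = maximalIdeal A := by
  induction rs with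
  | nil =>
    intro J x h hx hx'
    rw [Ideal.ofList_nil, sup_bot_eq] at h
    exact absurd (Ideal.mem_sup_right (h ▸ hx)) hx'
  | cons r rs ih =>
    intro J x h hx hx'
    rw [Ideal.ofList_cons, ← sup_assoc] at h
    have hr : r ∈ maximalIdeal A := by
      rw [← h]
      exact Ideal.mem_sup_left (Ideal.mem_sup_right (Ideal.mem_span_singleton_self r))
    by_cases hc : x ∈ maximalIdeal A ^ 2 ⊔ (J ⊔ Ideal.span {r})
    · refine ⟨rs, rfl, le_antisymm ?_ ?_⟩
      · rw [← h]
        refine sup_le (sup_le (le_sup_left.trans le_sup_left) ?_) le_sup_right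
        rw [Ideal.span_singleton_le_iff_mem, h]
        exact hx
      · apply le_of_le_sup_mul
        nth_rw 1 [← h]
        rw [← pow_two]
        refine sup_le (sup_le (le_sup_left.trans (le_sup_left.trans le_sup_left)) ?_) (le_sup_right.trans le_sup_left)
        rw [Ideal.span_singleton_le_iff_mem]
        rw [← sup_assoc, Submodule.mem_sup] at hc
        obtain ⟨y, hy, z, hz, rfl⟩ := hc
        obtain ⟨a, rfl⟩ := Ideal.mem_span_singleton'.1 hz
        have ha : IsUnit a := by
          by_contra ha
          refine hx' (add_mem hy (Ideal.mem_sup_left ?_))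
          rw [pow_two]
          exact Ideal.mul_mem_mul ((mem_maximalIdeal a).2 ha) hr
        rw [← Ideal.unit_mul_mem_iff_mem _ ha]
        refine (Ideal.add_mem_iff_right _ (a := y) ?_).1
          (Ideal.mem_sup_left (Ideal.mem_sup_left (Ideal.mem_sup_right (Ideal.mem_span_singleton_self _))))
        refine (sup_le le_sup_right (le_sup_left.trans (le_sup_left.trans le_sup_left)) :
          maximalIdeal A ^ 2 ⊔ J ≤ _) hy
    · obtain ⟨rs', hl, he⟩ := ih _ x h hx hc
      refine ⟨r :: rs', by simp [hl], ?_⟩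
      rw [Ideal.ofList_cons, ← he]
      simp only [sup_assoc, sup_left_comm, sup_comm]

omit [IsNoetherianRing A] in
theorem ringKrullDim_quot_maximal : ringKrullDim (A ⧸ maximalIdeal A) = 0 :=
  ringKrullDim_eq_zero_of_field (ResidueField A)

theorem ringKrullDim_le_sup_succ (J : Ideal A) {x : A} (hx : x ∈ maximalIdeal A)
    (hJ : J ≤ maximalIdeal A) :
    ringKrullDim (A ⧸ J) ≤ ringKrullDim (A ⧸ (J ⊔ Ideal.span {x})) + 1 := by
  have : Nontrivial (A ⧸ J) := Ideal.Quotient.nontrivial_iff.2 (ne_top_of_le_ne_top (Ideal.IsPrime.ne_top inferInstance) hJ)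
  have : IsLocalRing (A ⧸ J) := IsLocalRing.of_surjective' _ Ideal.Quotient.mk_surjective
  have hx' : Ideal.Quotient.mk J x ∈ maximalIdeal (A ⧸ J) := by
    rw [mem_maximalIdeal, mem_nonunits_iff]
    rintro h
    obtain ⟨b, hb⟩ := isUnit_iff_exists_inv.1 h
    obtain ⟨b, rfl⟩ := Ideal.Quotient.mk_surjective b
    rw [← map_mul, ← map_one (Ideal.Quotient.mk J), Ideal.Quotient.eq] at hb
    have h1 := sub_mem (Ideal.mul_mem_right b _ hx) (hJ hb)
    rw [sub_sub_cancel] at h1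
    exact (Ideal.ne_top_iff_one _).1 (Ideal.IsPrime.ne_top inferInstance) h1
  have h1 := ringKrullDim_le_ringKrullDim_quotSMulTop_succ hx'
  have e : ((A ⧸ J) ⧸ ((Ideal.Quotient.mk J x) • (⊤ : Ideal (A ⧸ J)))) ≃+* A ⧸ (J ⊔ Ideal.span {x}) :=
    (Ideal.quotEquivOfEq (by
      rw [Ideal.map_span, Set.image_singleton, ← Submodule.ideal_span_singleton_smul, smul_eq_mul,
        Ideal.mul_top])).trans
        (DoubleQuot.quotQuotEquivQuotSup J (Ideal.span {x}))
  rwa [ringKrullDim_eq_of_ringEquiv e] at h1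

theorem ringKrullDim_le_length (rs : List A) : ∀ J : Ideal A, J ⊔ Ideal.ofList rs = maximalIdeal A →
    ringKrullDim (A ⧸ J) ≤ (rs.length : ℕ) := by
  induction rs with
  | nil =>
    intro J h
    rw [Ideal.ofList_nil, sup_bot_eq] at h
    subst h
    exact ringKrullDim_quot_maximal.le
  | cons r rs ih =>
    intro J h
    have hJ : J ≤ maximalIdeal A := h ▸ le_sup_left
    rw [Ideal.ofList_cons, ← sup_assoc] at h
    have hr : r ∈ maximalIdeal A := by
      rw [← h]
      exact Ideal.mem_sup_left (Ideal.mem_sup_right (Ideal.mem_span_singleton_self r))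
    refine (ringKrullDim_le_sup_succ J hr hJ).trans ?_
    rw [List.length_cons, Nat.cast_add, Nat.cast_one]
    gcongr
    exact ih _ h

theorem isPrime_of_length_le (n : ℕ) :
    ∀ (J : Ideal A) (rs : List A), rs.length = n → J ⊔ Ideal.ofList rs = maximalIdeal A →
    (n : WithBot ℕ∞) ≤ ringKrullDim (A ⧸ J) → J.IsPrime := by
  induction n with
  | zero =>
    intro J rs hl h _
    rw [List.length_eq_zero_iff] at hl
    subst hl
    rw [Ideal.ofList_nil, sup_bot_eq] at h
    subst h
    infer_instance
  | succ n ih =>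
    intro J rs hl h hd
    have hJ : J ≤ maximalIdeal A := h ▸ le_sup_left
    obtain ⟨x, hx, hx1, hx2⟩ : ∃ x ∈ maximalIdeal A, x ∉ maximalIdeal A ^ 2 ⊔ J ∧ ∀ q ∈ J.minimalPrimes, x ∉ q := by
      by_contra! hcon
      have h1 : (maximalIdeal A : Set A) ⊆ ⋃ q ∈ insert (maximalIdeal A ^ 2 ⊔ J) J.minimalPrimes, ((fun q : Ideal A => q) q : Set A) := by
        intro x hx
        simp only [Set.mem_iUnion]
        by_cases hx1 : x ∈ maximalIdeal A ^ 2 ⊔ J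
        · exact ⟨_, Set.mem_insert _ _, hx1⟩
        · obtain ⟨q, hq, hxq⟩ := hcon x hx hx1
          exact ⟨q, Set.mem_insert_of_mem _ hq, hxq⟩
      replace h1 := (Ideal.subset_union_prime_finite (f := fun q : Ideal A => q) ((Ideal.finite_minimalPrimes_of_isNoetherianRing A J).insert _)
        (maximalIdeal A ^ 2 ⊔ J) (maximalIdeal A ^ 2 ⊔ J) (fun q hq h1 _ => ((Set.mem_insert_iff.1 hq).resolve_left h1).1.1)).1 h1
      have hzero : ringKrullDim (A ⧸ J) ≤ 0 := by
        obtain ⟨q, hq, hle⟩ := h1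
        rcases Set.mem_insert_iff.1 hq with rfl | hq
        · have : maximalIdeal A ≤ J := le_of_le_sup_mul (hle.trans (by rw [← pow_two, sup_comm]))
          have e : J = maximalIdeal A := le_antisymm hJ this
          subst e
          exact ringKrullDim_quot_maximal.le
        · have : Ring.KrullDimLE 0 (A ⧸ J) := by
            rw [Ring.krullDimLE_zero_iff]
            intro P hP
            have h2 : J ≤ P.comap (Ideal.Quotient.mk J) := by
              intro a ha
              rw [Ideal.mem_comap, Ideal.Quotient.eq_zero_iff_mem.2 ha]
              exact zero_mem _
            have h3 : P.comap (Ideal.Quotient.mk J) = maximalIdeal A := by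
              apply le_antisymm (le_maximalIdeal (Ideal.IsPrime.ne_top inferInstance))
              refine le_trans hle (hq.2 ⟨inferInstance, h2⟩ ?_)
              exact (le_maximalIdeal (Ideal.IsPrime.ne_top inferInstance)).trans hle
            have h4 : (P.comap (Ideal.Quotient.mk J)).IsMaximal := h3 ▸ inferInstance
            have h5 := Ideal.map_comap_of_surjective _ (Ideal.Quotient.mk_surjective (I := J)) P
            rw [← h5]
            exact (Ideal.map_eq_top_or_isMaximal_of_surjective _ Ideal.Quotient.mk_surjective h4).resolve_left
              (by rw [h5]; exact hP.ne_top)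
          exact (Ring.krullDimLE_iff (n := 0)).1 this
      have := hd.trans hzero
      rw [← Nat.cast_zero (R := WithBot ℕ∞), Nat.cast_le] at this
      omega
    obtain ⟨rs', hl', h'⟩ := exchange rs J x h hx hx1
    have hd' := hd.trans (ringKrullDim_le_sup_succ J hx hJ)
    rw [Nat.cast_add, Nat.cast_one] at hd'
    have hp := ih (J ⊔ Ideal.span {x}) rs' (by omega) h' (by
      exact ENat.WithBot.add_le_add_one_right_iff.1 hd')
    obtain ⟨q, hq, hqJ⟩ := Ideal.exists_minimalPrimes_le (J := J ⊔ Ideal.span {x}) (I := J) le_sup_left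
    have : q ≤ J := by
      apply le_of_le_sup_mul
      intro a ha
      obtain ⟨j, hj, z, hz, rfl⟩ := Submodule.mem_sup.1 (hqJ ha)
      obtain ⟨b, rfl⟩ := Ideal.mem_span_singleton'.1 hz
      refine add_mem (Ideal.mem_sup_left hj) (Ideal.mem_sup_right ?_)
      rw [mul_comm b x]
      refine Ideal.mul_mem_mul hx (?_ : b ∈ q)
      have h7 : b * x ∈ q := by
        have := sub_mem ha (hq.1.2 hj)
        rwa [add_sub_cancel_left] at this
      exact (hq.1.1.mem_or_mem h7).resolve_right (hx2 q hq)
    rw [le_antisymm hq.1.2 this]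
    exact hq.1.1

theorem wr_of_length_le (rs : List A) : ∀ J : Ideal A, J ⊔ Ideal.ofList rs = maximalIdeal A →
    ((rs.length : ℕ) : WithBot ℕ∞) ≤ ringKrullDim (A ⧸ J) → WR J rs := by
  induction rs with
  | nil => intros; trivial
  | cons r rs ih =>
    intro J h hd
    have hp := isPrime_of_length_le _ J (r :: rs) rfl h hd
    have hJ : J ≤ maximalIdeal A := h ▸ le_sup_left
    rw [Ideal.ofList_cons, ← sup_assoc] at h
    have hr : r ∈ maximalIdeal A := by
      rw [← h]
      exact Ideal.mem_sup_left (Ideal.mem_sup_right (Ideal.mem_span_singleton_self r))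
    have hrJ : r ∉ J := by
      intro hrJ
      have h1 : J ⊔ Ideal.span {r} = J := sup_eq_left.2 ((Ideal.span_singleton_le_iff_mem _).2 hrJ)
      rw [h1] at h
      have := hd.trans (ringKrullDim_le_length rs J h)
      rw [List.length_cons, Nat.cast_le] at this
      omega
    refine ⟨fun a ha => (hp.mem_or_mem ha).resolve_left hrJ, ih _ h ?_⟩
    have hd' := hd.trans (ringKrullDim_le_sup_succ J hr hJ)
    rw [List.length_cons, Nat.cast_add, Nat.cast_one] at hd'
    exact ENat.WithBot.add_le_add_one_right_iff.1 hd'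

end
end ZhouLC

namespace ZhouLC
open Abelian Limits IsLocalRing

section
variable {A : Type} [CommRing A]

theorem ev_of_wr (rs : List A) : ∀ (J : Ideal A) (d : ℕ), WR J rs →
    (∀ (Y : Type) [AddCommGroup Y] [Module A Y] (l : ℕ), EV A (A ⧸ J) Y (d + 1 + l)) →
    ∀ (Y : Type) [AddCommGroup Y] [Module A Y] (l : ℕ), EV A (A ⧸ (J ⊔ Ideal.ofList rs)) Y
    (d + rs.length + 1 + l) := by
  induction rs with
  | nil =>
    intro J d _ h
    rwa [Ideal.ofList_nil, sup_bot_eq]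
  | cons r rs ih =>
    intro J d hw h Y _ _ l
    have hr : colonI J r = J := le_antisymm (fun y hy => hw.1 y hy) (le_colonI J r)
    rw [Ideal.ofList_cons, ← sup_assoc]
    have h2 := ih (J ⊔ Ideal.span {r}) (d + 1) hw.2 (fun Y _ _ l => by
      have e : d + 1 + 1 + l = d + 1 + l + 1 := by omega
      rw [e]
      exact EV.con₃ (colonF_inj J r) (colonG_surj J r) (colon_exact J r) (by rw [hr]; exact h Y l) (h Y (l + 1))) Y l
    have e : d + (r :: rs).length + 1 + l = d + 1 + rs.length + 1 + l := by
      rw [List.length_cons]; omega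
    rwa [e]

theorem ev_residue_of_wr [IsLocalRing A] {rs : List A} (hw : WR ⊥ rs)
    (h : Ideal.ofList rs = maximalIdeal A)
    (Y : Type) [AddCommGroup Y] [Module A Y] (l : ℕ) :
    EV A (A ⧸ maximalIdeal A) Y (rs.length + 1 + l) := by
  have h1 := ev_of_wr rs ⊥ 0 hw (fun Y _ _ l => by
    have e : 0 + 1 + l = l + 1 := by omega
    rw [e]
    exact EV.congr (Submodule.quotEquivOfEqBot ⊥ rfl).symm (LinearEquiv.refl A Y) (EV.of_projective (X := A) (Y := Y) l)) Y l
  rwa [bot_sup_eq, h, zero_add] at h1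

theorem EV.shift {X : Type} [AddCommGroup X] [Module A X] {d : ℕ}
    (h : ∀ (Y : Type) [AddCommGroup Y] [Module A Y], EV A X Y (d + 1)) (l : ℕ) :
    ∀ (Y : Type) [AddCommGroup Y] [Module A Y], EV A X Y (d + 1 + l) := by
  induction l with
  | zero => exact h
  | succ l ih =>
    intro Y _ _
    obtain ⟨E, C, _, _, _, _, f, g, hE, hf, hg, he, hC⟩ := exists_cosyzygy A Y
    have e : d + 1 + (l + 1) = (d + l) + 2 := by omega
    have e' : d + 1 + l = d + l + 1 := by omega
    rw [e, ← hC, ← e']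
    exact ih C

theorem ev_of_finite [IsNoetherianRing A] {X : Type} [AddCommGroup X] [Module A X]
    [Module.Finite A X] {n : ℕ}
    (h : ∀ (Y : Type) [AddCommGroup Y] [Module A Y] [Module.Finite A Y], EV A X Y n) (Y : Type)
    [AddCommGroup Y] [Module A Y] :
    EV A X Y n := by
  have := ModuleCat.hasProjectiveDimensionLT_of_forall_finite (ModuleCat.of A X) n (fun L _ => h L)
  exact HasProjectiveDimensionLT.subsingleton (ModuleCat.of A X) n _ le_rfl (ModuleCat.of A Y)

theorem ev_quot_of_residue_finite [IsLocalRing A] [IsNoetherianRing A] {d : ℕ} {Y : Type}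
    [AddCommGroup Y] [Module A Y] [Module.Finite A Y]
    (h : ∀ l, EV A (A ⧸ maximalIdeal A) Y (d + l)) (J : Ideal A) : ∀ l, EV A (A ⧸ J) Y (d + l) := by
  induction J using ideal_dévissage with
  | htop =>
    have : Subsingleton (A ⧸ (⊤ : Ideal A)) := Ideal.Quotient.subsingleton_iff.mpr rfl
    exact fun l => EV.of_subsingleton_left _
  | hex J x h1 h2 => exact fun l => EV.con₂ (colonF_inj J x) (colonG_surj J x) (colon_exact J x) (h1 l) (h2 l)
  | hprime P hP ih =>
    by_cases hm : maximalIdeal A ≤ P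
    · have : P = maximalIdeal A := le_antisymm (le_maximalIdeal hP.ne_top) hm
      rwa [this]
    · obtain ⟨x, hx, hxP⟩ := SetLike.not_le_iff_exists.1 hm
      intro l
      have hs : ∀ a : EX A (A ⧸ P) Y (d + l), ∃ b, x • b = a := by
        intro a
        obtain ⟨c, hc⟩ := Abelian.Ext.contravariant_sequence_exact₁ (sc_exact (prime_smul_injective hP hxP)
          (colonG_surj P x) (prime_smul_exact P x)) (ModuleCat.of A Y) a (n₁ := d + (l + 1)) (by omega)
            ((ih _ (lt_sup_span hxP) (l + 1)).elim _ _)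
        exact ⟨c, by rw [← smul_ext]; exact hc⟩
      have hfin : Module.Finite A (EX A (A ⧸ P) Y (d + l)) := inferInstance
      have : (⊤ : Submodule A (EX A (A ⧸ P) Y (d + l))) ≤ ⊥ := by
        refine Submodule.le_of_le_smul_of_le_jacobson_bot (I := maximalIdeal A) hfin.fg_top (maximalIdeal_le_jacobson _) ?_
        intro a _
        obtain ⟨b, rfl⟩ := hs a
        exact Submodule.mem_sup_right (Submodule.smul_mem_smul hx trivial)
      exact subsingleton_of_forall_eq 0 fun a => (Submodule.mem_bot A).1 (this trivial)

theorem ev_quot_of_residue [IsLocalRing A] [IsNoetherianRing A] {d : ℕ}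
    (h : ∀ (Y : Type) [AddCommGroup Y] [Module A Y], EV A (A ⧸ maximalIdeal A) Y (d + 1))
    (J : Ideal A)
    (Y : Type) [AddCommGroup Y] [Module A Y] : EV A (A ⧸ J) Y (d + 1) :=
  ev_of_finite (fun Y _ _ _ => ev_quot_of_residue_finite (d := d + 1) (fun l => EV.shift h l Y) J 0) Y

end
end ZhouLC

namespace ZhouLC
open Abelian Limits IsLocalRing

section
variable {A : Type} [CommRing A] {M N L : Type} [AddCommGroup M] [Module A M] [AddCommGroup N]
    [Module A N]
  [AddCommGroup L] [Module A L]

/-- The quotient of a module by the multiples of `x`, as a module over `A ⧸ (x)`. -/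
abbrev QS (x : A) (M : Type) [AddCommGroup M] [Module A M] :
    Type := M ⧸ (Ideal.span {x} • ⊤ : Submodule A M)

theorem mem_span_smul_top {x : A} {m : M} :
    m ∈ (Ideal.span {x} • ⊤ : Submodule A M) ↔ ∃ b : M, x • b = m := by
  rw [Submodule.ideal_span_singleton_smul, Submodule.mem_smul_pointwise_iff_exists]
  exact ⟨fun ⟨b, _, h⟩ => ⟨b, h⟩, fun ⟨b, h⟩ => ⟨b, trivial, h⟩⟩

/-- Functoriality of `QS`. -/
noncomputable def qsMap (x : A) (f : M →ₗ[A] N) : QS x M →ₗ[A ⧸ Ideal.span {x}] QS x N :=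
  LinearMap.extendScalarsOfSurjective (R := A) Ideal.Quotient.mk_surjective (Submodule.mapQ _ _ f (by
    intro m hm
    obtain ⟨b, rfl⟩ := mem_span_smul_top.1 hm
    exact mem_span_smul_top.2 ⟨f b, (map_smul f x b).symm⟩))

theorem qsMap_mk (x : A) (f : M →ₗ[A] N) (m : M) :
    qsMap x f (Submodule.Quotient.mk m) = Submodule.Quotient.mk (f m) := rfl

theorem qsMap_surjective (x : A) {f : M →ₗ[A] N} (hf : Function.Surjective f) :
    Function.Surjective (qsMap x f) := by
  intro n
  obtain ⟨n, rfl⟩ := Submodule.Quotient.mk_surjective _ n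
  obtain ⟨m, rfl⟩ := hf n
  exact ⟨Submodule.Quotient.mk m, rfl⟩

theorem qsMap_exact (x : A) {f : M →ₗ[A] N} {g : N →ₗ[A] L} (hg : Function.Surjective g)
    (he : Function.Exact f g) :
    Function.Exact (qsMap x f) (qsMap x g) := by
  intro n
  obtain ⟨n, rfl⟩ := Submodule.Quotient.mk_surjective _ n
  rw [qsMap_mk, Submodule.Quotient.mk_eq_zero, mem_span_smul_top]
  constructor
  · rintro ⟨b, hb⟩
    obtain ⟨b, rfl⟩ := hg b
    obtain ⟨m, hm⟩ := (he (n - x • b)).1 (by rw [map_sub, map_smul, hb, sub_self])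
    refine ⟨Submodule.Quotient.mk m, ?_⟩
    rw [qsMap_mk, hm, Submodule.Quotient.eq, mem_span_smul_top]
    exact ⟨-b, by rw [smul_neg]; abel⟩
  · rintro ⟨m, hm⟩
    obtain ⟨m, rfl⟩ := Submodule.Quotient.mk_surjective _ m
    rw [qsMap_mk, Submodule.Quotient.eq, mem_span_smul_top] at hm
    obtain ⟨b, hb⟩ := hm
    refine ⟨- g b, ?_⟩
    rw [← map_neg, ← map_smul, smul_neg, hb, neg_sub, map_sub, he.apply_apply_eq_zero, sub_zero]

theorem qsMap_injective {x : A} {f : M →ₗ[A] N} {g : N →ₗ[A] L} (hf : Function.Injective f)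
    (he : Function.Exact f g)
    (hx : ∀ l : L, x • l = 0 → l = 0) : Function.Injective (qsMap x f) := by
  rw [injective_iff_map_eq_zero]
  intro m hm
  obtain ⟨m, rfl⟩ := Submodule.Quotient.mk_surjective _ m
  rw [qsMap_mk, Submodule.Quotient.mk_eq_zero, mem_span_smul_top] at hm
  obtain ⟨b, hb⟩ := hm
  obtain ⟨c, rfl⟩ := (he b).1 (hx _ (by rw [← map_smul, hb, he.apply_apply_eq_zero]))
  rw [← map_smul] at hb
  rw [Submodule.Quotient.mk_eq_zero, mem_span_smul_top]
  exact ⟨c, hf hb⟩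

theorem qs_projective (x : A) [Module.Projective A M] :
    Module.Projective (A ⧸ Ideal.span {x}) (QS x M) :=
  Module.Projective.of_equiv (LinearEquiv.extendScalarsOfSurjective (R := A) (S := A ⧸ Ideal.span {x}) Ideal.Quotient.mk_surjective
    (TensorProduct.quotTensorEquivQuotSMul M (Ideal.span {x})))

theorem projective_of_ev (h : ∀ (Y : Type) [AddCommGroup Y] [Module A Y], EV A M Y 1) :
    Module.Projective A M := by
  rw [IsProjective.iff_projective (R := A) M, projective_iff_hasProjectiveDimensionLT_one]
  refine HasProjectiveDimensionLT.mk fun i hi Y e => ?_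
  obtain ⟨l, rfl⟩ := Nat.exists_eq_add_of_le hi
  exact (EV.shift (d := 0) h l Y).elim _ _

theorem ev_qs {d : ℕ} :
    ∀ (M : Type) [AddCommGroup M] [Module A M] {x : A} (_ : ∀ a : A, x * a = 0 → a = 0)
    (_ : ∀ m : M, x • m = 0 → m = 0)
    (_ : ∀ (Y : Type) [AddCommGroup Y] [Module A Y], EV A M Y (d + 1)),
    ∀ (Y : Type) [AddCommGroup Y] [Module (A ⧸ Ideal.span {x}) Y], EV (A ⧸ Ideal.span {x})
    (QS x M) Y (d + 1) := by
  induction d with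
  | zero =>
    intro M _ _ x hA hx h Y _ _
    have := projective_of_ev h
    have := qs_projective (M := M) x
    exact EV.of_projective 0
  | succ d ih =>
    intro M _ _ x hA hx h Y _ _
    let g := Finsupp.linearCombination A (id : M → M)
    have hs : Function.Surjective g := Finsupp.linearCombination_id_surjective A M
    have he : Function.Exact (LinearMap.ker g).subtype g := LinearMap.exact_subtype_ker_map g
    have hi := Submodule.subtype_injective (LinearMap.ker g)
    have h1 := ih (LinearMap.ker g) (x := x) hA (fun m hm => by
      refine Subtype.ext (Finsupp.ext fun i => hA _ ?_)
      exact DFunLike.congr_fun (congrArg Subtype.val hm) i) (fun Y _ _ => EV.con₁ hi hs he (EV.of_projective d) (h Y)) Y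
    have := qs_projective (M := M →₀ A) x
    exact EV.con₃ (qsMap_injective hi he hx) (qsMap_surjective x hs) (qsMap_exact x hs he) h1 (EV.of_projective (d+1))

end
end ZhouLC

namespace ZhouLC
open Abelian Limits IsLocalRing

section
variable {A : Type} [CommRing A]

theorem EV.retract {S : Type} [CommRing S] {M N Y : Type} [AddCommGroup M] [Module S M]
    [AddCommGroup N] [Module S N]
    [AddCommGroup Y] [Module S Y] {l : ℕ} (i : N →ₗ[S] M) (r : M →ₗ[S] N) (h : ∀ n, r (i n) = n)
    (hM : EV S M Y l) : EV S N Y l := by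
  refine subsingleton_of_forall_eq 0 fun a => ?_
  have h1 : (Abelian.Ext.mk₀ (ModuleCat.ofHom r)).comp a (zero_add l) = 0 := hM.elim _ _
  have h2 := congrArg (fun b => (Abelian.Ext.mk₀ (ModuleCat.ofHom i)).comp b (zero_add l)) h1
  rw [Abelian.Ext.comp_zero, ← Abelian.Ext.comp_assoc_of_second_deg_zero, Abelian.Ext.mk₀_comp_mk₀,
    ← ModuleCat.ofHom_comp,
    (LinearMap.ext h : r ∘ₗ i = LinearMap.id)] at h2
  exact (Abelian.Ext.mk₀_id_comp a).symm.trans h2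

theorem wr_comap {B : Type} [CommRing B] (φ : A →+* B) (hφ : Function.Surjective φ) (rs : List A) :
    ∀ (J : Ideal B),
    WR J (rs.map φ) → WR (J.comap φ) rs := by
  induction rs with
  | nil => intros; trivial
  | cons r rs ih =>
    intro J h
    refine ⟨fun a ha => ?_, ?_⟩
    · rw [Ideal.mem_comap, map_mul] at ha
      exact h.1 _ ha
    · have h1 := ih _ h.2
      have e : (J ⊔ Ideal.span {φ r}).comap φ = J.comap φ ⊔ Ideal.span {r} := by
        have := Ideal.comap_map_of_surjective φ hφ (J.comap φ ⊔ Ideal.span {r})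
        rw [Ideal.map_sup, Ideal.map_comap_of_surjective φ hφ, Ideal.map_span,
          Set.image_singleton] at this
        rw [this]
        exact le_antisymm (sup_le le_rfl ((Ideal.comap_mono bot_le).trans le_sup_left)) le_sup_left
      rwa [e] at h1

theorem exists_functional [IsLocalRing A] {x : A} (hx : x ∈ maximalIdeal A)
    (hx2 : x ∉ maximalIdeal A ^ 2) :
    ∃ f : maximalIdeal A →ₗ[A] (A ⧸ maximalIdeal A), f ⟨x, hx⟩ = Submodule.Quotient.mk 1 := by
  have h0 : (maximalIdeal A).toCotangent ⟨x, hx⟩ ≠ 0 := by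
    rwa [Ne, Ideal.toCotangent_eq_zero]
  obtain ⟨f, hf⟩ := Module.Projective.exists_dual_eq_one (ResidueField A) h0
  let f' : (maximalIdeal A).Cotangent →ₗ[A] (A ⧸ maximalIdeal A) :=
    { toFun := f, map_add' := f.map_add, map_smul' := fun a b => by
        rw [RingHom.id_apply, ← algebraMap_smul (ResidueField A) a b, map_smul,
          algebraMap_smul]; rfl }
  exact ⟨f' ∘ₗ (maximalIdeal A).toCotangent, hf⟩

theorem exists_retract [IsLocalRing A] {x : A} (hx : x ∈ maximalIdeal A)
    (hx2 : x ∉ maximalIdeal A ^ 2)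
    [IsLocalRing (A ⧸ Ideal.span {x})] :
    ∃ (i : ((A ⧸ Ideal.span {x}) ⧸ maximalIdeal (A ⧸ Ideal.span {x})) →ₗ[A ⧸ Ideal.span {x}] QS x (maximalIdeal A))
      (r : QS x (maximalIdeal A) →ₗ[A ⧸ Ideal.span {x}] ((A ⧸ Ideal.span {x}) ⧸ maximalIdeal (A ⧸ Ideal.span {x}))),
      ∀ n, r (i n) = n := by
  let B := A ⧸ Ideal.span {x}
  let k := B ⧸ maximalIdeal B
  have hs : Function.Surjective (algebraMap A B) := Ideal.Quotient.mk_surjective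
  let q : A →ₗ[A] k := Algebra.linearMap A k
  have hq : Function.Surjective q := Ideal.Quotient.mk_surjective.comp hs
  have hk : maximalIdeal A = LinearMap.ker q := by
    ext a
    rw [LinearMap.mem_ker]
    have : q a = Ideal.Quotient.mk (maximalIdeal B) (algebraMap A B a) := rfl
    rw [this, Ideal.Quotient.eq_zero_iff_mem]
    have hl : IsLocalHom (algebraMap A B) := IsLocalHom.of_surjective _ hs
    rw [← maximalIdeal_comap (algebraMap A B), Ideal.mem_comap]
  let e : (A ⧸ maximalIdeal A) ≃ₗ[A] k := (Submodule.quotEquivOfEq _ _ hk).trans (q.quotKerEquivOfSurjective hq)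
  have he : ∀ a, e (Submodule.Quotient.mk a) = q a := fun a => rfl
  obtain ⟨f, hf⟩ := exists_functional hx hx2
  let i0 : (A ⧸ maximalIdeal A) →ₗ[A] QS x (maximalIdeal A) :=
    Submodule.liftQ _ (LinearMap.toSpanSingleton A _ (Submodule.Quotient.mk ⟨x, hx⟩)) (by
      intro a ha
      rw [LinearMap.mem_ker, LinearMap.toSpanSingleton_apply, ← Submodule.Quotient.mk_smul,
        Submodule.Quotient.mk_eq_zero,
        mem_span_smul_top]
      exact ⟨⟨a, ha⟩, Subtype.ext (mul_comm x a)⟩)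
  let r0 : QS x (maximalIdeal A) →ₗ[A] (A ⧸ maximalIdeal A) :=
    Submodule.liftQ _ f (by
      intro a ha
      obtain ⟨b, rfl⟩ := mem_span_smul_top.1 ha
      rw [LinearMap.mem_ker, map_smul]
      obtain ⟨c, hc⟩ := Submodule.Quotient.mk_surjective _ (f b)
      rw [← hc, ← Submodule.Quotient.mk_smul, Submodule.Quotient.mk_eq_zero]
      exact Ideal.mul_mem_right _ _ hx)
  have h0 : ∀ n, r0 (i0 n) = n := by
    intro n
    obtain ⟨n, rfl⟩ := Submodule.Quotient.mk_surjective _ n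
    have : i0 (Submodule.Quotient.mk n) = n • Submodule.Quotient.mk ⟨x, hx⟩ := rfl
    rw [this, map_smul]
    have : r0 (Submodule.Quotient.mk ⟨x, hx⟩) = f ⟨x, hx⟩ := rfl
    rw [this, hf, ← Submodule.Quotient.mk_smul, smul_eq_mul, mul_one]
  refine ⟨LinearMap.extendScalarsOfSurjective (R := A) hs (i0 ∘ₗ e.symm.toLinearMap),
    LinearMap.extendScalarsOfSurjective (R := A) hs (e.toLinearMap ∘ₗ r0), fun n => ?_⟩
  have : e (r0 (i0 (e.symm n))) = n := by rw [h0, LinearEquiv.apply_symm_apply]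
  exact this

theorem maximalIdeal_eq_bot [IsLocalRing A] (h : EV A (A ⧸ maximalIdeal A) (maximalIdeal A) 1) :
    maximalIdeal A = ⊥ := by
  obtain ⟨y, hy⟩ := extends_of_ev _ h LinearMap.id
  rw [eq_bot_iff]
  intro a ha
  have h1 : a = a * y := congrArg Subtype.val (hy ⟨a, ha⟩)
  have h2 : IsUnit (1 - (y : A)) := by
    by_contra hc
    have h3 := add_mem ((mem_maximalIdeal _).2 hc) y.2
    rw [sub_add_cancel] at h3
    exact (Ideal.ne_top_iff_one _).1 (Ideal.IsPrime.ne_top inferInstance) h3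
  have h3 : a * (1 - y) = 0 := by rw [mul_sub, mul_one, ← h1, sub_self]
  exact (h2.mul_left_eq_zero).1 h3

theorem exists_wr [IsLocalRing A] [IsNoetherianRing A] {d : ℕ}
    (h : ∀ (Y : Type) [AddCommGroup Y] [Module A Y], EV A (A ⧸ maximalIdeal A) Y (d + 1)) :
    ∃ rs : List A, WR ⊥ rs ∧ Ideal.ofList rs = maximalIdeal A := by
  obtain ⟨ts, hts⟩ : ∃ ts : List A, Ideal.ofList ts = maximalIdeal A := by
    obtain ⟨s, hs⟩ := IsNoetherian.noetherian (maximalIdeal A)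
    refine ⟨s.toList, ?_⟩
    rw [← hs]
    simp [Ideal.ofList]
  induction hn : ts.length generalizing A ts with
  | zero =>
    rw [List.length_eq_zero_iff] at hn
    subst hn
    exact ⟨[], trivial, hts⟩
  | succ n ih =>
    by_cases hx : ∃ x ∈ maximalIdeal A, x ∉ maximalIdeal A ^ 2 ∧ ∀ a, x * a = 0 → a = 0
    · obtain ⟨x, hx, hx2, hxr⟩ := hx
      obtain ⟨ts', hl, hts'⟩ := exchange ts ⊥ x (by rw [bot_sup_eq, hts]) hx (by rwa [sup_bot_eq])
      rw [bot_sup_eq] at hts'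
      have : Nontrivial (A ⧸ Ideal.span {x}) := Ideal.Quotient.nontrivial_iff.2
        (ne_top_of_le_ne_top (Ideal.IsPrime.ne_top inferInstance) ((Ideal.span_singleton_le_iff_mem _).2 hx))
      have : IsLocalRing (A ⧸ Ideal.span {x}) := IsLocalRing.of_surjective' _ Ideal.Quotient.mk_surjective
      have hmap := map_maximalIdeal_of_surjective _ (Ideal.Quotient.mk_surjective (I := Ideal.span {x}))
      obtain ⟨i, r, hir⟩ := exists_retract hx hx2
      have he : Function.Exact (Submodule.subtype (maximalIdeal A)) (Submodule.mkQ (maximalIdeal A)) :=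
        LinearMap.exact_iff.mpr (by rw [Submodule.ker_mkQ, Submodule.range_subtype])
      obtain ⟨us, hw, hus⟩ := ih (A := A ⧸ Ideal.span {x}) (fun Y _ _ => by
        refine EV.retract i r hir (ev_qs _ hxr ?_ ?_ Y)
        · exact fun m hm => Subtype.ext (hxr _ (congrArg Subtype.val hm))
        · exact fun Y _ _ => EV.con₁ (Submodule.subtype_injective _) (Submodule.mkQ_surjective _) he (EV.of_projective d)
            (EV.shift h 1 Y)) (ts'.map (Ideal.Quotient.mk _)) (by
          rw [← Ideal.map_ofList, ← hmap, ← hts', Ideal.map_sup, Ideal.map_quotient_self,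
            bot_sup_eq])
          (by rw [List.length_map]; omega)
      obtain ⟨us, rfl⟩ := List.map_surjective_iff.2 Ideal.Quotient.mk_surjective us
      refine ⟨x :: us, ⟨hxr, ?_⟩, ?_⟩
      · have := wr_comap _ Ideal.Quotient.mk_surjective us ⊥ hw
        rwa [← RingHom.ker_eq_comap_bot, Ideal.mk_ker, ← bot_sup_eq (Ideal.span {x})] at this
      · have h1 := congrArg (Ideal.comap (Ideal.Quotient.mk (Ideal.span {x}))) hus
        rw [← Ideal.map_ofList, ← hmap,
          Ideal.comap_map_of_surjective _ Ideal.Quotient.mk_surjective,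
          Ideal.comap_map_of_surjective _ Ideal.Quotient.mk_surjective, ← RingHom.ker_eq_comap_bot, Ideal.mk_ker] at h1
        rw [Ideal.ofList_cons, sup_comm, h1]
        exact sup_eq_left.2 ((Ideal.span_singleton_le_iff_mem _).2 hx)
    · refine ⟨[], trivial, ?_⟩
      rw [Ideal.ofList_nil]
      by_cases hm : maximalIdeal A ≤ maximalIdeal A ^ 2
      · exact (le_bot_iff.1 (le_of_le_sup_mul (by rw [bot_sup_eq, ← pow_two]; exact hm))).symm
      push Not at hx
      obtain ⟨y, hy⟩ : ∃ y : A, colonI ⊥ y = maximalIdeal A := by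
        have h1 : (maximalIdeal A : Set A) ⊆ ⋃ q ∈ insert (maximalIdeal A ^ 2) (associatedPrimes A A), ((fun q : Ideal A => q) q : Set A) := by
          intro x hxm
          simp only [Set.mem_iUnion]
          by_cases hx1 : x ∈ maximalIdeal A ^ 2
          · exact ⟨_, Set.mem_insert _ _, hx1⟩
          · obtain ⟨a, ha, ha0⟩ := hx x hxm hx1
            have : x ∈ ⋃ p ∈ associatedPrimes A A, (p : Set A) := by
              rw [biUnion_associatedPrimes_eq_compl_nonZeroDivisors]
              intro hc
              exact ha0 ((mul_right_mem_nonZeroDivisors_eq_zero_iff hc).1 ((mul_comm a x).trans ha))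
            simp only [Set.mem_iUnion] at this
            obtain ⟨q, hq, hxq⟩ := this
            exact ⟨q, Set.mem_insert_of_mem _ hq, hxq⟩
        obtain ⟨q, hq, hle⟩ := (Ideal.subset_union_prime_finite (f := fun q : Ideal A => q) ((associatedPrimes.finite A A).insert _)
          (maximalIdeal A ^ 2) (maximalIdeal A ^ 2) (fun q hq h1 _ => ((Set.mem_insert_iff.1 hq).resolve_left h1).1)).1 h1
        rcases Set.mem_insert_iff.1 hq with rfl | hq
        · exact absurd hle hm
        · have hqm : q = maximalIdeal A := le_antisymm (le_maximalIdeal hq.1.ne_top) hle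
          obtain ⟨y, hy⟩ := (isAssociatedPrime_iff.1 hq).2
          refine ⟨y, ?_⟩
          rw [← hqm, hy]
          ext a
          rw [mem_colonI, Submodule.mem_colon_singleton, smul_eq_mul, mul_comm]
      have hdown : ∀ d, (∀ (Y : Type) [AddCommGroup Y] [Module A Y], EV A (A ⧸ maximalIdeal A) Y (d + 1)) →
          ∀ (Y : Type) [AddCommGroup Y] [Module A Y], EV A (A ⧸ maximalIdeal A) Y 1 := by
        intro d
        induction d with
        | zero => exact fun h => h
        | succ d ihd =>
          intro h
          refine ihd (fun Y _ _ => ?_)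
          rw [← hy]
          exact EV.con₁ (colonF_inj ⊥ y) (colonG_surj ⊥ y) (colon_exact ⊥ y)
            (EV.congr (Submodule.quotEquivOfEqBot ⊥ rfl).symm (LinearEquiv.refl A Y) (EV.of_projective (X := A) (Y := Y) d))
            (ev_quot_of_residue h _ Y)
      exact (maximalIdeal_eq_bot (hdown d h _)).symm

end
end ZhouLC

namespace ZhouLC
open Abelian Limits IsLocalRing

section
variable {A : Type} [CommRing A]

theorem wr_map {B : Type} [CommRing B] (φ : A →+* B) (hφ : Function.Surjective φ) (rs : List A) :
    ∀ (J : Ideal B),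
    WR (J.comap φ) rs → WR J (rs.map φ) := by
  induction rs with
  | nil => intros; trivial
  | cons r rs ih =>
    intro J h
    refine ⟨fun b hb => ?_, ih _ ?_⟩
    · obtain ⟨a, rfl⟩ := hφ b
      exact h.1 a (by rwa [Ideal.mem_comap, map_mul])
    · have e : (J ⊔ Ideal.span {φ r}).comap φ = J.comap φ ⊔ Ideal.span {r} := by
        have := Ideal.comap_map_of_surjective φ hφ (J.comap φ ⊔ Ideal.span {r})
        rw [Ideal.map_sup, Ideal.map_comap_of_surjective φ hφ, Ideal.map_span,
          Set.image_singleton] at this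
        rw [this]
        exact le_antisymm (sup_le le_rfl ((Ideal.comap_mono bot_le).trans le_sup_left)) le_sup_left
      rw [e]
      exact h.2

theorem cons_wr {x : A} (hx : ∀ a, x * a = 0 → a = 0) [IsLocalRing A] (hxm : x ∈ maximalIdeal A)
    {B : Type} [CommRing B]
    [IsLocalRing B] (φ : A →+* B) (hφ : Function.Surjective φ)
    (hk : RingHom.ker φ = Ideal.span {x}) (us : List A)
    (hw : WR ⊥ (us.map φ)) (hus : Ideal.ofList (us.map φ) = maximalIdeal B) :
    WR ⊥ (x :: us) ∧ Ideal.ofList (x :: us) = maximalIdeal A := by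
  refine ⟨⟨hx, ?_⟩, ?_⟩
  · have := wr_comap _ hφ us ⊥ hw
    rwa [← RingHom.ker_eq_comap_bot, hk, ← bot_sup_eq (Ideal.span {x})] at this
  · have h1 := congrArg (Ideal.comap φ) hus
    rw [← Ideal.map_ofList, ← map_maximalIdeal_of_surjective φ hφ,
      Ideal.comap_map_of_surjective _ hφ,
      Ideal.comap_map_of_surjective _ hφ, ← RingHom.ker_eq_comap_bot, hk] at h1
    rw [Ideal.ofList_cons, sup_comm, h1]
    exact sup_eq_left.2 ((Ideal.span_singleton_le_iff_mem _).2 hxm)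

theorem residue_equiv [IsLocalRing A] {X : Type} [AddCommGroup X] [Module A X] (x : X) (hx : x ≠ 0)
    (hm : ∀ a ∈ maximalIdeal A, a • x = 0) (hs : ∀ y, ∃ a : A, a • x = y) :
    Nonempty ((A ⧸ maximalIdeal A) ≃ₗ[A] X) := by
  have hk : maximalIdeal A = LinearMap.ker (LinearMap.toSpanSingleton A X x) := by
    refine (maximalIdeal.isMaximal A).eq_of_le ?_ hm
    intro h
    have h1 : (1 : A) ∈ LinearMap.ker (LinearMap.toSpanSingleton A X x) := h ▸ trivial
    exact hx ((one_smul A x).symm.trans h1)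
  exact ⟨(Submodule.quotEquivOfEq _ _ hk).trans (LinearMap.quotKerEquivOfSurjective _ hs)⟩

theorem residue_localized (P : Ideal A) [P.IsPrime] :
    Nonempty ((Localization.AtPrime P ⧸ maximalIdeal (Localization.AtPrime P)) ≃ₗ[Localization.AtPrime P]
      LocalizedModule P.primeCompl (A ⧸ P)) := by
  refine residue_equiv (LocalizedModule.mk (Submodule.Quotient.mk 1) 1) ?_ ?_ ?_
  · intro h
    rw [← LocalizedModule.zero_mk 1, LocalizedModule.mk_eq] at h
    obtain ⟨u, hu⟩ := h
    simp only [one_smul, smul_zero] at hu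
    refine u.2 ?_
    have hu' : Submodule.Quotient.mk (p := P) ((u : A) • (1 : A)) = 0 := hu
    rwa [Submodule.Quotient.mk_eq_zero, smul_eq_mul, mul_one] at hu'
  · intro a ha
    induction a using Localization.induction_on with
    | _ y =>
    obtain ⟨a, s⟩ := y
    have ha' : a ∈ P := by
      rw [Localization.mk_eq_mk'] at ha
      exact (IsLocalization.AtPrime.mk'_mem_maximal_iff (Localization.AtPrime P) P a s).1 ha
    rw [LocalizedModule.mk_smul_mk, ← Submodule.Quotient.mk_smul, smul_eq_mul, mul_one,
      (Submodule.Quotient.mk_eq_zero P).2 ha', LocalizedModule.zero_mk]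
  · intro y
    induction y using LocalizedModule.induction_on with
    | _ m s =>
    obtain ⟨a, rfl⟩ := Submodule.Quotient.mk_surjective _ m
    refine ⟨Localization.mk a s, ?_⟩
    rw [LocalizedModule.mk_smul_mk, ← Submodule.Quotient.mk_smul, smul_eq_mul, mul_one, mul_one]

theorem exists_wr_localization [IsLocalRing A] [IsNoetherianRing A] {rs : List A} (hw : WR ⊥ rs)
    (h : Ideal.ofList rs = maximalIdeal A)
    (P : Ideal A) [P.IsPrime] : ∃ us : List (Localization.AtPrime P), WR ⊥ us ∧
      Ideal.ofList us = maximalIdeal (Localization.AtPrime P) := by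
  have : IsNoetherianRing (Localization.AtPrime P) := IsLocalization.isNoetherianRing P.primeCompl _ inferInstance
  have h1 := ev_quot_of_residue (d := rs.length) (fun Y _ _ => ev_residue_of_wr hw h Y 0) P
  have h2 : HasProjectiveDimensionLE (ModuleCat.of A (A ⧸ P)) rs.length := by
    refine HasProjectiveDimensionLT.mk fun i hi Y e => ?_
    obtain ⟨l, rfl⟩ := Nat.exists_eq_add_of_le hi
    exact (EV.shift h1 l Y).elim _ _
  have h3 := ModuleCat.localizedModule_hasProjectiveDimensionLE rs.length P.primeCompl (ModuleCat.of A (A ⧸ P))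
  obtain ⟨e⟩ := residue_localized P
  refine exists_wr (d := rs.length) fun Y _ _ => ?_
  let e' : (ModuleCat.localizedModule (ModuleCat.of A (A ⧸ P)) P.primeCompl) ≃ₗ[Localization.AtPrime P]
      LocalizedModule P.primeCompl (A ⧸ P) := Shrink.linearEquiv _ _
  refine EV.congr (e'.trans e.symm) (LinearEquiv.refl _ _) ?_
  exact HasProjectiveDimensionLT.subsingleton _ (rs.length + 1) _ le_rfl (ModuleCat.of _ Y)

/-- A regular local ring, given by a regular sequence of generators of the maximal ideal containing the residue
characteristic. -/
def Good (A : Type) [CommRing A] [IsLocalRing A] : Prop :=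
  ∃ (p : ℕ) (ys xs : List A), CharP (ResidueField A) p ∧ (p = 0 ∧ ys = [] ∨ p.Prime ∧ ys = [(p : A)]) ∧
    WR ⊥ (ys ++ xs) ∧ Ideal.ofList (ys ++ xs) = maximalIdeal A

theorem charP_of_cast {K : Type} [CommRing K] [Nontrivial K] {p : ℕ} (hp : p.Prime)
    (h : (p : K) = 0) : CharP K p := by
  obtain ⟨q, hq⟩ := CharP.exists K
  rcases (Nat.dvd_prime hp).1 ((CharP.cast_eq_zero_iff K q p).1 h) with rfl | rfl
  · exact absurd (CharP.cast_eq_zero K 1) (by rw [Nat.cast_one]; exact one_ne_zero)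
  · exact hq

theorem good_localization [IsLocalRing A] [IsNoetherianRing A] {p : ℕ} (hp : p.Prime)
    (hpm : (p : A) ∈ maximalIdeal A) {xs : List A}
    (hw : WR ⊥ ((p : A) :: xs)) (hg : Ideal.ofList ((p : A) :: xs) = maximalIdeal A) (P : Ideal A)
    [P.IsPrime] :
    Good (Localization.AtPrime P) := by
  have hPm := le_maximalIdeal (Ideal.IsPrime.ne_top ‹P.IsPrime›)
  have hcast : ∀ n : ℕ, (n : ResidueField (Localization.AtPrime P)) = 0 → (n : A) ∈ P := by
    intro n hn
    rw [← map_natCast (residue (Localization.AtPrime P)), residue_eq_zero_iff,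
      ← map_natCast (algebraMap A _)] at hn
    exact (IsLocalization.AtPrime.to_map_mem_maximal_iff (Localization.AtPrime P) P _).1 hn
  by_cases hpP : (p : A) ∈ P
  · let B := A ⧸ Ideal.span {(p : A)}
    let π : A →+* B := Ideal.Quotient.mk _
    have hπ : Function.Surjective π := Ideal.Quotient.mk_surjective
    have hkπ : RingHom.ker π = Ideal.span {(p : A)} := Ideal.mk_ker
    have hle : Ideal.span {(p : A)} ≤ P := (Ideal.span_singleton_le_iff_mem _).2 hpP
    have : Nontrivial B := Ideal.Quotient.nontrivial_iff.2 (ne_top_of_le_ne_top (Ideal.IsPrime.ne_top ‹_›) hle)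
    have : IsLocalRing B := IsLocalRing.of_surjective' _ hπ
    have hQ : (P.map π).IsPrime := Ideal.map_isPrime_of_surjective hπ (hkπ.trans_le hle)
    have hcomap : P = (P.map π).comap π := by
      rw [Ideal.comap_map_of_surjective π hπ, ← RingHom.ker_eq_comap_bot, hkπ, sup_eq_left.2 hle]
    obtain ⟨us, hus, hus'⟩ := exists_wr_localization (A := B) (rs := xs.map π) (wr_map π hπ xs ⊥ (by
        rw [← RingHom.ker_eq_comap_bot, hkπ, ← bot_sup_eq (Ideal.span {(p : A)})]
        exact hw.2)) (by
        rw [← Ideal.map_ofList, ← map_maximalIdeal_of_surjective π hπ, ← hg, Ideal.ofList_cons,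
          Ideal.map_sup]
        rw [show Ideal.map π (Ideal.span {(p : A)}) = ⊥ from Ideal.map_quotient_self _,
          bot_sup_eq]) (P.map π)
    let φ := Localization.localRingHom P (P.map π) π hcomap
    have hφ : Function.Surjective φ := by
      intro b
      obtain ⟨⟨b, t⟩, rfl⟩ := IsLocalization.mk'_surjective (P.map π).primeCompl b
      obtain ⟨t, ht⟩ := t
      obtain ⟨b, rfl⟩ := hπ b
      obtain ⟨t, rfl⟩ := hπ t
      refine ⟨IsLocalization.mk' _ b (⟨t, ?_⟩ : P.primeCompl), ?_⟩
      · intro h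
        exact ht (Ideal.mem_map_of_mem π h)
      · exact Localization.localRingHom_mk' _ _ _ hcomap _ _
    have hkφ : RingHom.ker φ = Ideal.span {(p : Localization.AtPrime P)} := by
      apply le_antisymm
      · intro a ha
        obtain ⟨⟨a, s⟩, rfl⟩ := IsLocalization.mk'_surjective P.primeCompl a
        rw [RingHom.mem_ker] at ha
        have h1 := (Localization.localRingHom_mk' P (P.map π) π hcomap a s).symm.trans ha
        rw [IsLocalization.mk'_eq_zero_iff] at h1
        obtain ⟨⟨u, hu⟩, hua⟩ := h1
        obtain ⟨u, rfl⟩ := hπ u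
        have hu' : u ∈ P.primeCompl := fun h => hu (Ideal.mem_map_of_mem π h)
        have h2 : u * a ∈ Ideal.span {(p : A)} := by
          rw [← hkπ, RingHom.mem_ker, map_mul]
          exact hua
        obtain ⟨b, hb⟩ := Ideal.mem_span_singleton'.1 h2
        rw [Ideal.mem_span_singleton']
        refine ⟨IsLocalization.mk' _ b ((⟨u, hu'⟩ : P.primeCompl) * s), ?_⟩
        rw [← map_natCast (algebraMap A (Localization.AtPrime P)), mul_comm,
          IsLocalization.mul_mk'_eq_mk'_of_mul, mul_comm, hb]
        exact IsLocalization.mk'_eq_of_eq (by push_cast; ring)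
      · have h0 : π (p : A) = 0 := by
          rw [← RingHom.mem_ker, hkπ]
          exact Ideal.mem_span_singleton_self _
        have h1 : (p : B) = 0 := (map_natCast π p).symm.trans h0
        have h2 : (p : Localization.AtPrime (P.map π)) = 0 :=
          (map_natCast (algebraMap B _) p).symm.trans ((congrArg _ h1).trans (map_zero _))
        rw [Ideal.span_singleton_le_iff_mem, RingHom.mem_ker]
        exact (map_natCast φ p).trans h2
    obtain ⟨vs, rfl⟩ := List.map_surjective_iff.2 hφ us
    have hpm' : (p : Localization.AtPrime P) ∈ maximalIdeal (Localization.AtPrime P) := by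
      rw [← map_natCast (algebraMap A _)]
      exact (IsLocalization.AtPrime.to_map_mem_maximal_iff (Localization.AtPrime P) P _).2 hpP
    have := cons_wr (x := (p : Localization.AtPrime P)) (by
      intro a ha
      obtain ⟨⟨a, s⟩, rfl⟩ := IsLocalization.mk'_surjective P.primeCompl a
      rw [← map_natCast (algebraMap A (Localization.AtPrime P)),
        IsLocalization.mul_mk'_eq_mk'_of_mul, IsLocalization.mk'_eq_zero_iff] at ha
      obtain ⟨u, hu⟩ := ha
      rw [IsLocalization.mk'_eq_zero_iff]
      exact ⟨u, hw.1 _ ((by rw [mul_left_comm]; exact hu : (p : A) * (u * a) = 0))⟩) hpm' φ hφ hkφ vs hus hus'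
    refine ⟨p, [(p : Localization.AtPrime P)], vs, charP_of_cast hp ?_, Or.inr ⟨hp, rfl⟩, this⟩
    rw [← map_natCast (residue (Localization.AtPrime P)), residue_eq_zero_iff]
    exact hpm'
  · obtain ⟨us, h⟩ := exists_wr_localization hw hg P
    obtain ⟨q, hq⟩ := CharP.exists (ResidueField (Localization.AtPrime P))
    rcases CharP.char_is_prime_or_zero (ResidueField (Localization.AtPrime P)) q with hq' | rfl
    · exfalso
      have h1 := hcast q (CharP.cast_eq_zero _ _)
      have h2 : p = q := by
        have := charP_of_cast (K := ResidueField A) hp (by rwa [← map_natCast (residue A),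
          residue_eq_zero_iff])
        have := charP_of_cast (K := ResidueField A) hq' (by
          rw [← map_natCast (residue A), residue_eq_zero_iff]; exact hPm h1)
        exact CharP.eq (ResidueField A) ‹_› ‹_›
      exact hpP (h2 ▸ h1)
    · exact ⟨0, [], us, hq, Or.inl ⟨rfl, rfl⟩, h⟩

theorem exists_regular_parameters [IsLocalRing A] [IsNoetherianRing A] {x : A}
    (h : ∃ s : Finset A, Ideal.span (s : Set A) = maximalIdeal A ∧ (s.card : WithBot ℕ∞) = ringKrullDim A) (hx : x ∈ maximalIdeal A)
    (hx2 : x ∉ maximalIdeal A ^ 2) :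
    ∃ xs : List A, WR ⊥ (x :: xs) ∧ Ideal.ofList (x :: xs) = maximalIdeal A := by
  obtain ⟨s, hs, hd⟩ := h
  obtain ⟨xs, hl, hxs⟩ := exchange s.toList ⊥ x (by
    rw [bot_sup_eq, ← hs]
    simp [Ideal.ofList]) hx (by rwa [sup_bot_eq])
  rw [Finset.length_toList] at hl
  rw [bot_sup_eq] at hxs
  have hxs' : Ideal.ofList (x :: xs) = maximalIdeal A := by rw [Ideal.ofList_cons, hxs]
  refine ⟨xs, wr_of_length_le _ ⊥ (by rw [bot_sup_eq, hxs']) ?_, hxs'⟩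
  rw [ringKrullDim_eq_of_ringEquiv (RingEquiv.quotientBot A), ← hd, List.length_cons, hl]

end
end ZhouLC

namespace ZhouLC
open Abelian Limits IsLocalRing

section
variable {Q k : Type} [CommRing Q] [Field k] (π : Q →+* k)

theorem exists_section_charP (hπ : Function.Surjective π)
    (hN : ∀ a b, π a = 0 → π b = 0 → a * b = 0) {p : ℕ} (hp : p.Prime)
    (h : (p : Q) = 0) : ∃ σ : k →+* Q, ∀ a, π (σ a) = a := by
  have : Nontrivial Q := π.domain_nontrivial
  have : CharP Q p := charP_of_cast hp h
  have : Fact p.Prime := ⟨hp⟩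
  have hNp : ∀ a, π a = 0 → a ^ p = 0 := by
    intro a ha
    obtain ⟨n, rfl⟩ := Nat.exists_eq_add_of_le hp.two_le
    rw [pow_add, pow_two, hN a a ha ha, zero_mul]
  let S : Set (Subring Q) := {L | (∀ q, q ^ p ∈ L) ∧ ∀ l ∈ L, π l = 0 → l = 0}
  have h0 : (frobenius Q p).range ∈ S := by
    refine ⟨fun q => ⟨q, rfl⟩, ?_⟩
    rintro _ ⟨q, rfl⟩ hq
    rw [frobenius_def, map_pow, pow_eq_zero_iff hp.ne_zero] at hq
    exact hNp q hq
  obtain ⟨L, -, hL⟩ := zorn_le_nonempty₀ S (by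
    intro c hc hch y hy
    refine ⟨sSup c, ⟨fun q => le_sSup hy ((hc hy).1 q), fun l hl => ?_⟩, fun z hz => le_sSup hz⟩
    obtain ⟨z, hz, hlz⟩ := (Subring.mem_sSup_of_directedOn ⟨y, hy⟩ hch.directedOn).1 hl
    exact (hc hz).2 l hlz) _ h0
  obtain ⟨⟨hLp, hL0⟩, hmax⟩ := hL
  let πL : L →+* k := π.comp L.subtype
  have hinj : Function.Injective πL := (injective_iff_map_eq_zero _).2 fun l hl => Subtype.ext (hL0 l l.2 hl)
  have hF : IsField L := by
    refine ⟨⟨0, 1, zero_ne_one⟩, mul_comm, ?_⟩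
    intro l hl
    have hl' : πL l ≠ 0 := fun h => hl (hinj (h.trans (map_zero _).symm))
    obtain ⟨q, hq⟩ := hπ (πL l)⁻¹
    obtain ⟨n, hn⟩ := Nat.exists_eq_succ_of_ne_zero hp.ne_zero
    refine ⟨l ^ n * ⟨q ^ p, hLp q⟩, Subtype.ext ?_⟩
    have h1 : ((l : Q) * q - 1) ^ p = 0 := hNp _ (by
      rw [map_sub, map_mul, hq, map_one, show π l = πL l from rfl, mul_inv_cancel₀ hl', sub_self])
    rw [sub_pow_char, one_pow, sub_eq_zero, mul_pow] at h1
    push_cast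
    rw [← mul_assoc, ← pow_succ', ← Nat.succ_eq_add_one, ← hn, h1]
  let _ : Field L := hF.toField
  let _ : Algebra L k := πL.toAlgebra
  have hsurj : Function.Surjective πL := by
    intro b
    obtain ⟨q, rfl⟩ := hπ b
    by_contra hq
    let ev := Polynomial.eval₂RingHom L.subtype q
    let a : L := ⟨q ^ p, hLp q⟩
    have hirr : Irreducible (Polynomial.X ^ p - Polynomial.C a) := by
      refine X_pow_sub_C_irreducible_of_prime hp fun b hb => hq ⟨b, ?_⟩
      have : CharP k p := charP_of_cast hp (by rw [← map_natCast π, h, map_zero])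
      apply frobenius_inj k p
      rw [frobenius_def, frobenius_def, ← map_pow, hb, ← map_pow]
      rfl
    have hmin : minpoly L (π q) = Polynomial.X ^ p - Polynomial.C a := by
      refine (minpoly.eq_of_irreducible_of_monic hirr ?_ (Polynomial.monic_X_pow_sub_C _ hp.ne_zero)).symm
      rw [map_sub, map_pow, Polynomial.aeval_X, Polynomial.aeval_C, sub_eq_zero, ← map_pow]
      rfl
    have hmem : ev.range ∈ S := by
      refine ⟨fun r => ⟨Polynomial.C ⟨r ^ p, hLp r⟩, Polynomial.eval₂_C _ _⟩, ?_⟩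
      rintro _ ⟨f, rfl⟩ hf
      have hf' : Polynomial.aeval (π q) f = 0 := by
        rw [← hf, Polynomial.aeval_def]
        exact (Polynomial.hom_eval₂ f L.subtype π q).symm
      obtain ⟨g, rfl⟩ := hmin ▸ minpoly.dvd L (π q) hf'
      have : ev (Polynomial.X ^ p - Polynomial.C a) = 0 := by
        rw [map_sub, map_pow, Polynomial.coe_eval₂RingHom, Polynomial.eval₂_X, Polynomial.eval₂_C,
          sub_eq_zero]
        rfl
      rw [map_mul, this, zero_mul]
    have hle : L ≤ ev.range := fun l hl => ⟨Polynomial.C ⟨l, hl⟩, Polynomial.eval₂_C _ _⟩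
    exact hq ⟨⟨q, hmax hmem hle ⟨Polynomial.X, Polynomial.eval₂_X _ _⟩⟩, rfl⟩
  let e := RingEquiv.ofBijective πL ⟨hinj, hsurj⟩
  exact ⟨L.subtype.comp e.symm.toRingHom, fun a => e.apply_symm_apply a⟩

theorem exists_section_charZero [CharZero k] (hπ : Function.Surjective π)
    (hN : ∀ a b, π a = 0 → π b = 0 → a * b = 0) :
    ∃ σ : k →+* Q, ∀ a, π (σ a) = a := by
  have hu : ∀ a, π a ≠ 0 → IsUnit a := by
    intro a ha
    obtain ⟨b, hb⟩ := hπ (π a)⁻¹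
    have h0 : π (a * b - 1) = 0 := by rw [map_sub, map_mul, hb, map_one, mul_inv_cancel₀ ha,
      sub_self]
    have h1 := hN _ _ h0 h0
    exact IsUnit.of_mul_eq_one (b * (2 - a * b)) (by linear_combination -h1)
  let f : ℚ →+* Q := IsLocalization.lift (M := nonZeroDivisors ℤ) (g := Int.castRingHom Q) (by
    intro y
    apply hu
    rw [eq_intCast, map_intCast]
    exact Int.cast_ne_zero.2 (nonZeroDivisors.ne_zero y.2))
  let _ : Algebra ℚ Q := f.toAlgebra
  let _ : Algebra ℚ k := DivisionRing.toRatAlgebra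
  obtain ⟨s, hs⟩ := exists_isTranscendenceBasis ℚ k
  have h1 := hs.isAlgebraic_field
  have : Algebra.IsSeparable (IntermediateField.adjoin ℚ (Set.range ((↑) : s → k))) k :=
    Algebra.IsAlgebraic.isSeparable_of_perfectField
  have := Algebra.FormallySmooth.of_algebraicIndependent_of_isSeparable hs.1
  let πa : Q →ₐ[ℚ] k := ⟨π, fun r => RingHom.congr_fun (RingHom.ext_rat (π.comp f) (algebraMap ℚ k)) r⟩
  have hnil : IsNilpotent (RingHom.ker (πa : Q →+* k)) := by
    refine ⟨2, ?_⟩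
    rw [pow_two, Ideal.zero_eq_bot, eq_bot_iff, Ideal.mul_le]
    exact fun a ha b hb => hN a b ha hb
  exact ⟨Algebra.FormallySmooth.liftOfSurjective (AlgHom.id ℚ k) πa hπ hnil,
    fun a => Algebra.FormallySmooth.liftOfSurjective_apply (AlgHom.id ℚ k) πa hπ hnil a⟩

end
end ZhouLC

namespace ZhouLC
open Abelian Limits IsLocalRing

section
variable {A : Type} [CommRing A]

theorem wr_inf (qs : List A) :
    ∀ J : Ideal A, WR J qs → J ⊓ Ideal.ofList qs ≤ J * Ideal.ofList qs := by
  induction qs with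
  | nil => intro J _; rw [Ideal.ofList_nil, inf_bot_eq]; exact bot_le
  | cons q qs ih =>
    rintro J ⟨hq, hw⟩ f ⟨hf, hf'⟩
    rw [Ideal.ofList_cons] at hf' ⊢
    obtain ⟨a, ha, g, hg, rfl⟩ := Submodule.mem_sup.1 hf'
    obtain ⟨a, rfl⟩ := Ideal.mem_span_singleton'.1 ha
    have h1 : g ∈ (J ⊔ Ideal.span {q}) * Ideal.ofList qs := by
      refine ih _ hw ⟨?_, hg⟩
      have : g = (a * q + g) + -(a * q) := by ring
      rw [this]
      exact Submodule.add_mem_sup hf (neg_mem ha)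
    rw [Ideal.sup_mul] at h1
    obtain ⟨u, hu, v, hv, rfl⟩ := Submodule.mem_sup.1 h1
    obtain ⟨v, hv, rfl⟩ := Ideal.mem_span_singleton_mul.1 hv
    have h2 : a + v ∈ J := by
      refine hq _ ?_
      have : q * (a + v) = (a * q + (u + q * v)) - u := by ring
      rw [this]
      exact sub_mem hf ((Ideal.mul_le_left : J * Ideal.ofList qs ≤ J) hu)
    have h3 : a * q + (u + q * v) = (a + v) * q + u := by ring
    have h4 : J * Ideal.ofList qs ≤ J * (Ideal.span {q} ⊔ Ideal.ofList qs) := Ideal.mul_mono_right le_sup_right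
    rw [h3]
    exact add_mem (Ideal.mul_mem_mul h2 (Ideal.mem_sup_left (Ideal.mem_span_singleton_self q))) (h4 hu)

theorem wr_nodup (rs : List A) :
    ∀ J : Ideal A, WR J rs → J ⊔ Ideal.ofList rs ≠ ⊤ → (∀ x ∈ rs, x ∉ J) ∧ rs.Nodup := by
  induction rs with
  | nil => intros; exact ⟨fun x hx => absurd hx List.not_mem_nil, List.nodup_nil⟩
  | cons x rs ih =>
    rintro J ⟨hx, hw⟩ h
    rw [Ideal.ofList_cons, ← sup_assoc] at h
    obtain ⟨h1, h2⟩ := ih _ hw h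
    refine ⟨?_, List.nodup_cons.2 ⟨fun hxr => h1 x hxr (Ideal.mem_sup_right (Ideal.mem_span_singleton_self x)), h2⟩⟩
    intro y hy hyJ
    rcases List.mem_cons.1 hy with rfl | hy
    · refine h ((Ideal.eq_top_iff_one _).2 (Ideal.mem_sup_left (Ideal.mem_sup_left (hx 1 ?_))))
      rwa [mul_one]
    · exact h1 y hy (Ideal.mem_sup_left hyJ)

variable (A) in
/-- The canonical presentation of a ring by integral polynomials. -/
noncomputable abbrev pres : MvPolynomial A ℤ →+* A := MvPolynomial.eval₂Hom (Int.castRingHom A) id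

theorem pres_X (a : A) : pres A (MvPolynomial.X a) = a := MvPolynomial.eval₂Hom_X' _ _ _

theorem pres_surjective : Function.Surjective (pres A) := fun a => ⟨_, pres_X a⟩

variable [IsLocalRing A]

theorem exists_section_residue {Q : Type} [CommRing Q] {p : ℕ} [CharP (ResidueField A) p]
    (π : Q →+* ResidueField A) (hπ : Function.Surjective π)
    (hN : ∀ a b, π a = 0 → π b = 0 → a * b = 0)
    (h : p = 0 ∨ p.Prime ∧ (p : Q) = 0) : ∃ σ : ResidueField A →+* Q, ∀ a, π (σ a) = a := by
  rcases h with rfl | ⟨hp, hpQ⟩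
  · have : CharZero (ResidueField A) := CharP.charP_to_charZero _
    exact exists_section_charZero π hπ hN
  · exact exists_section_charP π hπ hN hp hpQ

theorem exists_endo {p : ℕ} {ys xs : List A} [CharP (ResidueField A) p]
    (hp : p = 0 ∧ ys = [] ∨ p.Prime ∧ ys = [(p : A)])
    (hw : WR ⊥ (ys ++ xs)) (hm : Ideal.ofList (ys ++ xs) = maximalIdeal A) :
    ∃ s : MvPolynomial A ℤ →+* MvPolynomial A ℤ, (∀ f, pres A (s f) = pres A f) ∧
      (∀ x ∈ xs, s (MvPolynomial.X x) = MvPolynomial.X x) ∧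
      ∀ k f, pres A f = 0 → s^[k] f ∈ (maximalIdeal A).comap (pres A) ^ k := by
  classical
  let θ := pres A
  have hθ : Function.Surjective θ := pres_surjective
  obtain ⟨zs, hzs, hz⟩ : ∃ zs : List (MvPolynomial A ℤ), zs.map θ = ys ∧ (p = 0 ∧ zs = [] ∨ p.Prime ∧ zs = [(p : MvPolynomial A ℤ)]) := by
    rcases hp with ⟨h, rfl⟩ | ⟨h, rfl⟩
    · exact ⟨[], rfl, Or.inl ⟨h, rfl⟩⟩
    · exact ⟨[(p : MvPolynomial A ℤ)], by rw [List.map_singleton, map_natCast], Or.inr ⟨h, rfl⟩⟩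
  let qs := zs ++ xs.map MvPolynomial.X
  have hqs : qs.map θ = ys ++ xs := by
    rw [List.map_append, hzs, List.map_map]
    congr 1
    exact (List.map_congr_left fun x _ => pres_X x).trans (List.map_id _)
  let J := RingHom.ker θ
  let q := Ideal.ofList qs
  have hN : (maximalIdeal A).comap θ = J ⊔ q := by
    rw [← hm, ← hqs, ← Ideal.map_ofList, Ideal.comap_map_of_surjective θ hθ,
      ← RingHom.ker_eq_comap_bot, sup_comm]
  have hJq : J ⊓ q ≤ J * q := wr_inf qs J (wr_comap θ hθ qs ⊥ (hqs ▸ hw))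
  let K := J * J ⊔ q
  have hKN : K ≤ (maximalIdeal A).comap θ := hN ▸ sup_le_sup_right (Ideal.mul_le_left : J * J ≤ J) q
  let Q := MvPolynomial A ℤ ⧸ K
  let mk : MvPolynomial A ℤ →+* Q := Ideal.Quotient.mk K
  let π : Q →+* ResidueField A := Ideal.Quotient.lift K ((residue A).comp θ) (fun f hf => (residue_eq_zero_iff _).2 (hKN hf))
  have hπmk : ∀ f, π (mk f) = residue A (θ f) := fun f => rfl
  obtain ⟨σ, hσ⟩ := exists_section_residue (p := p) π (fun b => by
      obtain ⟨a, rfl⟩ := residue_surjective b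
      obtain ⟨f, rfl⟩ := hθ a
      exact ⟨mk f, rfl⟩) (fun a b ha hb => by
      obtain ⟨f, rfl⟩ := Ideal.Quotient.mk_surjective a
      obtain ⟨g, rfl⟩ := Ideal.Quotient.mk_surjective b
      have hf : f ∈ J ⊔ q := hN ▸ (residue_eq_zero_iff _).1 ha
      have hg : g ∈ J ⊔ q := hN ▸ (residue_eq_zero_iff _).1 hb
      rw [← map_mul]
      refine Ideal.Quotient.eq_zero_iff_mem.2 ((?_ : (J ⊔ q) * (J ⊔ q) ≤ K) (Ideal.mul_mem_mul hf hg))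
      rw [Ideal.sup_mul, Ideal.mul_sup]
      exact sup_le (sup_le le_sup_left ((Ideal.mul_le_right : J * q ≤ q).trans le_sup_right)) ((Ideal.mul_le_left : q * (J ⊔ q) ≤ q).trans le_sup_right)) (by
      rcases hz with ⟨h, -⟩ | ⟨h, rfl⟩
      · exact Or.inl h
      · refine Or.inr ⟨h, ?_⟩
        rw [← map_natCast mk]
        exact Ideal.Quotient.eq_zero_iff_mem.2 (Ideal.mem_sup_right (Ideal.subset_span (by simp [qs]))))
  have he : ∀ a : A, ∃ e, mk e = σ (residue A a) ∧ θ e = a ∧ (a ∈ xs → e = MvPolynomial.X a) := by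
    intro a
    by_cases ha : a ∈ xs
    · have h1 : MvPolynomial.X a ∈ q := Ideal.subset_span (by simp [qs, ha])
      refine ⟨MvPolynomial.X a, ?_, pres_X a, fun _ => rfl⟩
      have h2 : residue A a = 0 := by
        rw [residue_eq_zero_iff, ← hm]
        exact Ideal.subset_span (by simp [ha])
      rw [h2, map_zero]
      exact Ideal.Quotient.eq_zero_iff_mem.2 (Ideal.mem_sup_right h1)
    · obtain ⟨f, hf⟩ := Ideal.Quotient.mk_surjective (σ (residue A a))
      have h1 : f - MvPolynomial.X a ∈ J ⊔ q := by
        rw [← hN, Ideal.mem_comap, map_sub, pres_X, ← residue_eq_zero_iff, map_sub, sub_eq_zero]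
        exact (congrArg π hf).trans (hσ _)
      obtain ⟨j, hj, r, hr, hjr⟩ := Submodule.mem_sup.1 h1
      refine ⟨f - r, ?_, ?_, fun h => absurd h ha⟩
      · rw [map_sub]
        refine Eq.trans ?_ hf
        rw [sub_eq_self]
        exact Ideal.Quotient.eq_zero_iff_mem.2 (Ideal.mem_sup_right hr)
      · have : f - r = MvPolynomial.X a + j := by linear_combination -hjr
        rw [this, map_add, show θ j = 0 from hj, add_zero]
        exact pres_X a
  choose e hemk heθ hex using he
  let s : MvPolynomial A ℤ →+* MvPolynomial A ℤ := MvPolynomial.eval₂Hom (Int.castRingHom _) e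
  have hsX : ∀ a, s (MvPolynomial.X a) = e a := fun a => MvPolynomial.eval₂Hom_X' _ _ _
  have hs : ∀ f, θ (s f) = θ f := by
    intro f
    refine RingHom.congr_fun (?_ : θ.comp s = θ) f
    refine MvPolynomial.ringHom_ext' (RingHom.ext_int _ _) fun a => ?_
    rw [RingHom.comp_apply, hsX, heθ]
    exact (pres_X a).symm
  have hsσ : ∀ f, mk (s f) = σ (residue A (θ f)) := by
    intro f
    refine RingHom.congr_fun (?_ : mk.comp s = (σ.comp (residue A)).comp θ) f
    refine MvPolynomial.ringHom_ext' (RingHom.ext_int _ _) fun a => ?_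
    rw [RingHom.comp_apply, hsX, hemk, RingHom.comp_apply, RingHom.comp_apply,
      show θ (MvPolynomial.X a) = a from pres_X a]
  have hJ : J.map s ≤ (maximalIdeal A).comap θ * J := by
    rw [Ideal.map_le_iff_le_comap]
    intro f hf
    have h1 : s f ∈ J := (hs f).trans hf
    have h2 : s f ∈ J * J ⊔ q := by
      apply Ideal.Quotient.eq_zero_iff_mem.1
      refine (hsσ f).trans ?_
      rw [show θ f = 0 from hf, map_zero, map_zero]
    obtain ⟨u, hu, v, hv, huv⟩ := Submodule.mem_sup.1 h2
    have h3 : v ∈ J := by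
      have : v = s f - u := by rw [← huv]; ring
      rw [this]
      exact sub_mem h1 ((Ideal.mul_le_left : J * J ≤ J) hu)
    rw [Ideal.mem_comap, hN, Ideal.sup_mul, ← huv]
    exact Submodule.add_mem_sup hu ((mul_comm J q) ▸ hJq ⟨h3, hv⟩)
  have hNs : ((maximalIdeal A).comap θ).map s ≤ (maximalIdeal A).comap θ := by
    rw [Ideal.map_le_iff_le_comap]
    intro f hf
    rw [Ideal.mem_comap, Ideal.mem_comap, hs]
    exact hf
  refine ⟨s, hs, fun x hx => (hsX x).trans (hex x hx), fun k f hf => ?_⟩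
  have key : s^[k] f ∈ (maximalIdeal A).comap θ ^ k * J := by
    induction k with
    | zero => rw [pow_zero, one_mul]; exact hf
    | succ k ih =>
      rw [Function.iterate_succ_apply', pow_succ, mul_assoc]
      have := Ideal.mem_map_of_mem s ih
      rw [Ideal.map_mul, Ideal.map_pow] at this
      exact Ideal.mul_mono (Ideal.pow_right_mono hNs k) hJ this
  exact (Ideal.mul_le_left : (maximalIdeal A).comap θ ^ k * J ≤ _) key

end
end ZhouLC

namespace ZhouLC
open Abelian Limits IsLocalRing

section
variable {A : Type} [CommRing A] [IsLocalRing A] {T : Type} [CommRing T]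

theorem exists_limit_hom (g₀ : MvPolynomial A ℤ →+* T) (s : MvPolynomial A ℤ →+* MvPolynomial A ℤ)
    (hs : ∀ f, pres A (s f) = pres A f)
    (hs' : ∀ k f, pres A f = 0 → s^[k] f ∈ (maximalIdeal A).comap (pres A) ^ k)
    (K : ℕ → Ideal T) (hK0 : ∀ t, (∀ k, t ∈ K k) → t = 0)
    (hKc : ∀ u : ℕ → T, (∀ k, u (k + 1) - u k ∈ K k) → ∃ t, ∀ k, t - u k ∈ K k) (d : ℕ)
    (hd : ∀ k, (((maximalIdeal A).comap (pres A)).map g₀) ^ (k + d) ≤ K k) :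
    ∃ φ : A →+* T, (∀ a, s (MvPolynomial.X a) = MvPolynomial.X a → φ a = g₀ (MvPolynomial.X a)) ∧
      ∀ a k, ∃ f, pres A f = a ∧ φ a - g₀ f ∈ K k := by
  have hsk : ∀ k f, pres A (s^[k] f) = pres A f := by
    intro k f
    induction k with
    | zero => rfl
    | succ k ih => rw [Function.iterate_succ_apply', hs, ih]
  have hJ : ∀ k f, pres A f = 0 → g₀ (s^[k + d] f) ∈ K k := by
    intro k f hf
    apply hd
    rw [← Ideal.map_pow]
    exact Ideal.mem_map_of_mem g₀ (hs' _ _ hf)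
  have hdiff : ∀ f k, g₀ (s^[k + 1 + d] f) - g₀ (s^[k + d] f) ∈ K k := by
    intro f k
    have : k + 1 + d = (k + d) + 1 := by ring
    rw [this, Function.iterate_succ_apply, ← map_sub, ← iterate_map_sub]
    exact hJ _ _ (by rw [map_sub, hs, sub_self])
  choose g hg using fun f => hKc (fun k => g₀ (s^[k + d] f)) (hdiff f)
  have huniq : ∀ t t', (∀ k, t - t' ∈ K k) → t = t' := fun t t' h => sub_eq_zero.1 (hK0 _ h)
  let G : MvPolynomial A ℤ →+* T := RingHom.mk'
    { toFun := g
      map_one' := huniq _ _ fun k => by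
        have := hg 1 k
        rwa [iterate_map_one, map_one] at this
      map_mul' := fun x y => huniq _ _ fun k => by
        have h1 := hg (x * y) k
        have hx := hg x k
        have hy := hg y k
        rw [iterate_map_mul, map_mul] at h1
        have := sub_mem (sub_mem h1 (Ideal.mul_mem_right (g y) _ hx)) (Ideal.mul_mem_left _ (g₀ (s^[k + d] x)) hy)
        convert this using 1
        ring } (fun x y => huniq _ _ fun k => by
        have h1 := hg (x + y) k
        rw [iterate_map_add, map_add] at h1
        have := sub_mem (sub_mem h1 (hg x k)) (hg y k)
        convert this using 1
        change g (x + y) - (g x + g y) = _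
        ring)
  have hGg : ∀ f, G f = g f := fun f => rfl
  have hker : RingHom.ker (pres A) ≤ RingHom.ker G := by
    intro f hf
    refine hK0 _ fun k => ?_
    have := add_mem (hg f k) (hJ k f hf)
    rwa [sub_add_cancel] at this
  let φ := RingHom.liftOfRightInverse (pres A) MvPolynomial.X pres_X ⟨G, hker⟩
  have hφ : ∀ f, φ (pres A f) = g f := fun f => RingHom.liftOfRightInverse_comp_apply (pres A) MvPolynomial.X pres_X ⟨G, hker⟩ f
  refine ⟨φ, fun a ha => ?_, fun a k => ?_⟩
  · have := hφ (MvPolynomial.X a)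
    rw [pres_X] at this
    rw [this]
    refine huniq _ _ fun k => ?_
    have := hg (MvPolynomial.X a) k
    rwa [Function.iterate_fixed ha] at this
  · refine ⟨s^[k + d] (MvPolynomial.X a), by rw [hsk, pres_X], ?_⟩
    have := hφ (MvPolynomial.X a)
    rw [pres_X] at this
    rw [this]
    exact hg _ k

end
end ZhouLC

namespace ZhouLC
open Abelian Limits IsLocalRing

section
variable (B : Type) [CommRing B] (n : ℕ)

/-- The truncated polynomial ring `B[X]/(X^(n+1))`. -/
abbrev Tr : Type := Polynomial B ⧸ Ideal.span {(Polynomial.X : Polynomial B) ^ (n + 1)}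

/-- The class of the variable. -/
noncomputable abbrev trX : Tr B n := Ideal.Quotient.mk _ Polynomial.X

theorem coeff_of_mem_span (i : ℕ) (hi : i ≤ n) (f : Polynomial B)
    (hf : f ∈ Ideal.span {(Polynomial.X : Polynomial B) ^ (n + 1)}) :
    Polynomial.lcoeff B i f = 0 :=
  Polynomial.X_pow_dvd_iff.1 (Ideal.mem_span_singleton.1 hf) i (Nat.lt_succ_of_le hi)

/-- The `i`-th coefficient, as an additive map. -/
noncomputable def trCoeffAdd (i : ℕ) (hi : i ≤ n) : Tr B n →+ B :=
  QuotientAddGroup.lift (Submodule.toAddSubgroup (Ideal.span {(Polynomial.X : Polynomial B) ^ (n + 1)}))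
    (Polynomial.lcoeff B i).toAddMonoidHom (fun f hf => coeff_of_mem_span B n i hi f hf)

/-- The `i`-th coefficient, meaningful for `i ≤ n`. -/
noncomputable def trCoeff (i : ℕ) (hi : i ≤ n) : Tr B n →ₗ[B] B where
  toFun := trCoeffAdd B n i hi
  map_add' := map_add _
  map_smul' b t := by
    obtain ⟨f, rfl⟩ := Ideal.Quotient.mk_surjective t
    exact Polynomial.coeff_smul b f i

/-- The constant coefficient. -/
noncomputable def trRho : Tr B n →+* B := Ideal.Quotient.lift _ Polynomial.constantCoeff (by
  intro f hf
  obtain ⟨g, rfl⟩ := Ideal.mem_span_singleton'.1 hf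
  rw [map_mul, map_pow, Polynomial.constantCoeff_apply Polynomial.X, Polynomial.coeff_X_zero,
    zero_pow (Nat.succ_ne_zero n), mul_zero])

variable {B n}

theorem trCoeff_mk (i : ℕ) (hi : i ≤ n) (f : Polynomial B) :
    trCoeff B n i hi (Ideal.Quotient.mk _ f) = f.coeff i := rfl

theorem trRho_mk (f : Polynomial B) : trRho B n (Ideal.Quotient.mk _ f) = f.coeff 0 := rfl

theorem trRho_algebraMap (b : B) : trRho B n (algebraMap B _ b) = b := Polynomial.coeff_C_zero

theorem trRho_X : trRho B n (trX B n) = 0 := Polynomial.coeff_X_zero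

theorem trX_pow : trX B n ^ (n + 1) = 0 := by
  rw [← map_pow]
  exact Ideal.Quotient.eq_zero_iff_mem.2 (Ideal.mem_span_singleton_self _)

theorem mk_eq_sum (f : Polynomial B) : (Ideal.Quotient.mk _ f : Tr B n) =
    ∑ i : Fin (n + 1), algebraMap B _ (f.coeff i) * trX B n ^ (i : ℕ) := by
  have h : (Ideal.Quotient.mk _ (∑ i : Fin (n + 1), Polynomial.C (f.coeff i) * Polynomial.X ^ (i : ℕ)) : Tr B n) =
      ∑ i : Fin (n + 1), algebraMap B _ (f.coeff i) * trX B n ^ (i : ℕ) := by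
    rw [map_sum]
    refine Finset.sum_congr rfl fun i _ => ?_
    rw [map_mul, map_pow]
    rfl
  rw [← h, Ideal.Quotient.eq, Ideal.mem_span_singleton, Polynomial.X_pow_dvd_iff]
  intro d hd
  rw [Polynomial.coeff_sub, sub_eq_zero, Polynomial.finsetSum_coeff,
    Finset.sum_eq_single (⟨d, hd⟩ : Fin (n + 1))]
  · simp
  · intro i _ hi
    rw [Polynomial.coeff_C_mul_X_pow, if_neg]
    exact fun h => hi (Fin.ext h.symm)
  · intro h
    exact absurd (Finset.mem_univ _) h

theorem eq_sum_trCoeff (t : Tr B n) :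
    t = ∑ i : Fin (n + 1), algebraMap B _ (trCoeff B n i (Nat.le_of_lt_succ i.2) t) * trX B n ^ (i : ℕ) := by
  obtain ⟨f, rfl⟩ := Ideal.Quotient.mk_surjective t
  exact mk_eq_sum f

theorem exists_trCoeff (b : Fin (n + 1) → B) :
    ∃ t : Tr B n, ∀ i : Fin (n + 1), trCoeff B n i (Nat.le_of_lt_succ i.2) t = b i := by
  refine ⟨Ideal.Quotient.mk _ (∑ i : Fin (n + 1), Polynomial.C (b i) * Polynomial.X ^ (i : ℕ)), fun i => ?_⟩
  rw [trCoeff_mk, Polynomial.finsetSum_coeff, Finset.sum_eq_single i]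
  · simp
  · intro j _ hj
    rw [Polynomial.coeff_C_mul_X_pow, if_neg]
    exact fun h => hj (Fin.ext h.symm)
  · intro h
    exact absurd (Finset.mem_univ _) h

theorem mem_map_iff_trCoeff (I : Ideal B) (t : Tr B n) : t ∈ I.map (algebraMap B (Tr B n)) ↔
    ∀ i : Fin (n + 1), trCoeff B n i (Nat.le_of_lt_succ i.2) t ∈ I := by
  constructor
  · intro h i
    induction h using Submodule.span_induction with
    | zero => rw [map_zero]; exact zero_mem _
    | add x y _ _ hx hy => rw [map_add]; exact add_mem hx hy
    | mem x hx =>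
      obtain ⟨b, hb, rfl⟩ := hx
      rw [Algebra.algebraMap_eq_smul_one, map_smul]
      exact Ideal.mul_mem_right _ _ hb
    | smul s x hx _ =>
      have h1 : s • x ∈ I.map (algebraMap B (Tr B n)) := Ideal.mul_mem_left _ s hx
      rw [IsScalarTower.algebraMap_eq B (Polynomial B) (Tr B n), ← Ideal.map_map] at h1
      obtain ⟨f, hf, hf'⟩ := (Ideal.mem_map_iff_of_surjective _ Ideal.Quotient.mk_surjective).1 h1
      rw [← hf']
      exact Ideal.mem_map_C_iff.1 hf i
  · intro h
    rw [eq_sum_trCoeff t]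
    exact Ideal.sum_mem _ fun i _ => Ideal.mul_mem_right _ _ (Ideal.mem_map_of_mem _ (h i))

theorem trRho_mem_iff (I : Ideal B) (t : Tr B n) (h : trRho B n t ∈ I) :
    t ∈ I.map (algebraMap B (Tr B n)) ⊔ Ideal.span {trX B n} := by
  rw [eq_sum_trCoeff t, Fin.sum_univ_succ]
  refine Submodule.add_mem_sup (Ideal.mul_mem_right _ _ (Ideal.mem_map_of_mem _ ?_)) (Ideal.sum_mem _ fun i _ => ?_)
  · obtain ⟨f, rfl⟩ := Ideal.Quotient.mk_surjective t
    exact h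
  · exact Ideal.mul_mem_left _ _ (Ideal.pow_mem_of_mem _ (Ideal.mem_span_singleton_self _) _ (Nat.succ_pos i))

theorem trRho_eq_zero {t : Tr B n} (h : trRho B n t = 0) : ∃ t', t = trX B n * t' := by
  have := trRho_mem_iff ⊥ t ((Submodule.mem_bot _).2 h)
  rw [Ideal.map_bot, bot_sup_eq] at this
  obtain ⟨a, rfl⟩ := Ideal.mem_span_singleton'.1 this
  exact ⟨a, mul_comm _ _⟩

theorem exists_limit {I : Ideal B} (h : IsAdicComplete I B) (u : ℕ → B)
    (hu : ∀ k, u (k + 1) - u k ∈ I ^ k) :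
    ∃ b, ∀ k, b - u k ∈ I ^ k := by
  obtain ⟨b, hb⟩ := h.toIsPrecomplete.prec' u (by
    intro i j hij
    rw [SModEq.sub_mem, smul_eq_mul, Ideal.mul_top]
    induction j, hij using Nat.le_induction with
    | base => rw [sub_self]; exact zero_mem _
    | succ j hij ih =>
      have := sub_mem ih (Ideal.pow_le_pow_right hij (hu j))
      rwa [sub_sub_sub_cancel_right, ← neg_mem_iff, neg_sub, ← neg_mem_iff, neg_sub] at this)
  refine ⟨b, fun k => ?_⟩
  have := hb k
  rwa [SModEq.sub_mem, smul_eq_mul, Ideal.mul_top, ← neg_mem_iff, neg_sub] at this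

theorem eq_zero_of_mem_pow {I : Ideal B} (h : IsAdicComplete I B) (b : B) (hb : ∀ k, b ∈ I ^ k) :
    b = 0 := by
  refine h.toIsHausdorff.haus' b fun k => ?_
  rw [SModEq.zero, smul_eq_mul, Ideal.mul_top]
  exact hb k

theorem exists_deformation {A : Type} [CommRing A] [IsLocalRing A] [Algebra A B]
    (hB : IsAdicComplete ((maximalIdeal A).map (algebraMap A B)) B) {p : ℕ} {ys xs : List A}
    [CharP (ResidueField A) p] (hp : p = 0 ∧ ys = [] ∨ p.Prime ∧ ys = [(p : A)])
    (hw : WR ⊥ (ys ++ xs)) (hm : Ideal.ofList (ys ++ xs) = maximalIdeal A) (n : ℕ) (c : A → B) :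
    ∃ φ : A →+* Tr B n, (∀ a, trRho B n (φ a) = algebraMap A B a) ∧
      ∀ x ∈ xs, φ x = algebraMap B _ (algebraMap A B x) + algebraMap B _ (c x) * trX B n := by
  obtain ⟨s, hs, hsx, hs'⟩ := exists_endo hp hw hm
  let I := (maximalIdeal A).map (algebraMap A B)
  let g₀ : MvPolynomial A ℤ →+* Tr B n := MvPolynomial.eval₂Hom (Int.castRingHom _)
    (fun a => algebraMap B _ (algebraMap A B a) + algebraMap B _ (c a) * trX B n)
  have hg : ∀ f, trRho B n (g₀ f) = algebraMap A B (pres A f) := by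
    intro f
    refine RingHom.congr_fun (?_ : (trRho B n).comp g₀ = (algebraMap A B).comp (pres A)) f
    refine MvPolynomial.ringHom_ext' (RingHom.ext_int _ _) fun a => ?_
    rw [RingHom.comp_apply, RingHom.comp_apply, pres_X, MvPolynomial.eval₂Hom_X', map_add, map_mul,
      trRho_X, mul_zero, add_zero,
      trRho_algebraMap]
  obtain ⟨φ, hφ, hφ'⟩ := exists_limit_hom g₀ s hs hs' (fun k => (I ^ k).map (algebraMap B (Tr B n))) (by
      intro t ht
      rw [eq_sum_trCoeff t]
      refine Finset.sum_eq_zero fun i _ => ?_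
      rw [eq_zero_of_mem_pow hB (trCoeff B n i _ t) (fun k => (mem_map_iff_trCoeff _ _).1 (ht k) i),
        map_zero, zero_mul]) (by
      intro u hu
      choose b hb using fun i : Fin (n + 1) => exists_limit hB (fun k => trCoeff B n i (Nat.le_of_lt_succ i.2) (u k)) (fun k => by
        rw [← map_sub]
        exact (mem_map_iff_trCoeff _ _).1 (hu k) i)
      obtain ⟨t, ht⟩ := exists_trCoeff b
      refine ⟨t, fun k => (mem_map_iff_trCoeff _ _).2 fun i => ?_⟩
      rw [map_sub, ht]
      exact hb i k) (n + 1) (by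
      intro k
      have h1 : ((maximalIdeal A).comap (pres A)).map g₀ ≤ I.map (algebraMap B (Tr B n)) ⊔ Ideal.span {trX B n} := by
        rw [Ideal.map_le_iff_le_comap]
        intro f hf
        refine trRho_mem_iff _ _ ?_
        rw [hg]
        exact Ideal.mem_map_of_mem _ hf
      refine (Ideal.pow_right_mono h1 _).trans (Ideal.sup_pow_add_le_pow_sup_pow.trans ?_)
      rw [Ideal.span_singleton_pow, trX_pow, Ideal.span_singleton_zero, sup_bot_eq, Ideal.map_pow])
  refine ⟨φ, fun a => sub_eq_zero.1 (eq_zero_of_mem_pow hB _ fun k => ?_), fun x hx => ?_⟩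
  · obtain ⟨f, rfl, hf⟩ := hφ' a k
    rw [← hg, ← map_sub]
    exact (mem_map_iff_trCoeff _ _).1 hf 0
  · rw [hφ x (hsx x hx), MvPolynomial.eval₂Hom_X']

end
end ZhouLC

namespace ZhouLC
open Abelian Limits IsLocalRing TensorProduct

theorem flat_of_exact {A M M' M'' : Type} [CommRing A] [AddCommGroup M] [Module A M]
    [AddCommGroup M'] [Module A M']
    [AddCommGroup M''] [Module A M''] {f : M' →ₗ[A] M} {g : M →ₗ[A] M''}
    (hf : Function.Injective f) (hg : Function.Surjective g)
    (h : Function.Exact f g) [Module.Flat A M'] [Module.Flat A M''] : Module.Flat A M := by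
  rw [Module.Flat.iff_lTensor_preserves_injective_linearMap]
  intro N P _ _ _ _ u hu
  rw [injective_iff_map_eq_zero]
  intro x hx
  have h1 : g.rTensor N x = 0 := by
    refine Module.Flat.lTensor_preserves_injective_linearMap (M := M'') u hu ?_
    rw [map_zero, ← LinearMap.comp_apply, LinearMap.lTensor_comp_rTensor,
      ← LinearMap.rTensor_comp_lTensor, LinearMap.comp_apply,
      hx, map_zero]
  obtain ⟨y, rfl⟩ := (rTensor_exact N h hg x).1 h1
  rw [← LinearMap.comp_apply, LinearMap.lTensor_comp_rTensor, ← LinearMap.rTensor_comp_lTensor,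
    LinearMap.comp_apply] at hx
  have h2 : Function.Injective (f.rTensor P) :=
    (LinearMap.lTensor_inj_iff_rTensor_inj P f).1 (LinearMap.lTensor_injective_of_exact_of_flat g hg f hf h P)
  have h3 := Module.Flat.lTensor_preserves_injective_linearMap (M := M') u hu
    ((h2 (hx.trans (map_zero _).symm)).trans (map_zero _).symm)
  rw [h3, map_zero]

theorem flat_of_ringHom_bijective {A B S : Type} [CommRing A] [CommRing B] [CommRing S]
    [Algebra A B] [Module.Flat A B] (φ : A →+* S)
    (ρ : S →+* B) (hρ : Function.Bijective ρ) (h : ∀ a, ρ (φ a) = algebraMap A B a) : φ.Flat := by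
  let _ := φ.toAlgebra
  let e : S →ₗ[A] B := { ρ with
    map_smul' := fun a t => (map_mul ρ (φ a) t).trans (by rw [h]; exact (Algebra.smul_def _ _).symm) }
  exact Module.Flat.of_linearEquiv (LinearEquiv.ofBijective e hρ)

theorem flat_of_ringHom_exact {A B S T : Type} [CommRing A] [CommRing B] [CommRing S] [CommRing T]
    [Algebra A B] [Module.Flat A B]
    (φ : A →+* S) (π : S →+* T) (hπ : Function.Surjective π) (h : (π.comp φ).Flat) (u : B →+ S)
    (hu : Function.Injective u)
    (hu' : ∀ a b, u (algebraMap A B a * b) = φ a * u b) (he : Function.Exact u π) : φ.Flat := by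
  let _ := φ.toAlgebra
  let _ := (π.comp φ).toAlgebra
  have : Module.Flat A T := h
  let f : B →ₗ[A] S := { u with map_smul' := fun a b => (congrArg u (Algebra.smul_def a b)).trans (hu' a b) }
  let g : S →ₗ[A] T := { π with map_smul' := fun a t => map_mul π (φ a) t }
  exact flat_of_exact (f := f) (g := g) hu hπ he

section
variable {B : Type} [CommRing B] {n : ℕ}

theorem mul_trX_pow (t : Tr B n) :
    t * trX B n ^ n = algebraMap B _ (trRho B n t) * trX B n ^ n := by
  have h : trRho B n (t - algebraMap B _ (trRho B n t)) = 0 := by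
    rw [map_sub, trRho_algebraMap, sub_self]
  obtain ⟨u, hu⟩ := trRho_eq_zero h
  rw [← sub_eq_zero, ← sub_mul, hu, mul_right_comm, ← pow_succ', trX_pow, zero_mul]

theorem trCoeff_mul_trX_pow (b : B) :
    trCoeff B n n le_rfl (algebraMap B _ b * trX B n ^ n) = b := by
  have h : (algebraMap B _ b * trX B n ^ n : Tr B n) = Ideal.Quotient.mk _ (Polynomial.C b * Polynomial.X ^ n) := by
    rw [map_mul, map_pow]
    rfl
  rw [h, trCoeff_mk, Polynomial.coeff_C_mul_X_pow, if_pos rfl]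

theorem trRho_injective : Function.Injective (trRho B 0) := by
  rw [injective_iff_map_eq_zero]
  intro t ht
  obtain ⟨u, rfl⟩ := trRho_eq_zero ht
  rw [← pow_one (trX B 0), trX_pow, zero_mul]

variable (B n) in
/-- Truncation by one more degree. -/
noncomputable def trRed : Tr B (n + 1) →+* Tr B n :=
  Ideal.Quotient.factor (Ideal.span_singleton_le_span_singleton.2 (pow_dvd_pow _ (Nat.le_succ _)))

theorem trRed_surjective : Function.Surjective (trRed B n) := Ideal.Quotient.factor_surjective _

theorem trRho_trRed (t : Tr B (n + 1)) : trRho B n (trRed B n t) = trRho B (n + 1) t := by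
  obtain ⟨f, rfl⟩ := Ideal.Quotient.mk_surjective t
  exact (congrArg (trRho B n) (Ideal.Quotient.factor_mk _ f)).trans ((trRho_mk f).trans (trRho_mk f).symm)

theorem trRed_eq_zero {t : Tr B (n + 1)} (h : trRed B n t = 0) :
    ∃ b, algebraMap B _ b * trX B (n + 1) ^ (n + 1) = t := by
  obtain ⟨f, rfl⟩ := Ideal.Quotient.mk_surjective t
  obtain ⟨g, rfl⟩ := Ideal.mem_span_singleton'.1 (Ideal.Quotient.eq_zero_iff_mem.1 h)
  refine ⟨g.coeff 0, ?_⟩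
  exact (mul_trX_pow (Ideal.Quotient.mk _ g)).symm.trans (by rw [map_mul, map_pow])

theorem trRed_trX_pow : trRed B n (trX B (n + 1) ^ (n + 1)) = 0 := by
  rw [map_pow]
  exact trX_pow

variable {A : Type} [CommRing A]

theorem tr_map_pow_le (φ α : A →+* Tr B n) (h : ∀ a, trRho B n (φ a) = trRho B n (α a))
    (I : Ideal A) :
    I.map φ ^ (n + 2) ≤ I.map α := by
  have h1 : I.map φ ≤ I.map α ⊔ Ideal.span {trX B n} := by
    rw [Ideal.map_le_iff_le_comap]
    intro a ha
    have h2 : trRho B n (φ a - α a) = 0 := by rw [map_sub, h, sub_self]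
    obtain ⟨u, hu⟩ := trRho_eq_zero h2
    have h3 : φ a = α a + trX B n * u := by rw [← hu, add_sub_cancel]
    rw [Ideal.mem_comap, h3]
    exact Submodule.add_mem_sup (Ideal.mem_map_of_mem _ ha) (Ideal.mul_mem_right _ _ (Ideal.mem_span_singleton_self _))
  refine (Ideal.pow_right_mono h1 _).trans ?_
  have h3 : n + 2 = 1 + (n + 1) := by omega
  rw [h3]
  refine Ideal.sup_pow_add_le_pow_sup_pow.trans ?_
  rw [Ideal.span_singleton_pow, trX_pow, Ideal.span_singleton_zero, sup_bot_eq, pow_one]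

variable [Algebra A B] [Module.Flat A B]

theorem tr_flat : ∀ {n : ℕ} (φ : A →+* Tr B n) (_ : ∀ a, trRho B n (φ a) = algebraMap A B a), φ.Flat
  | 0, φ, h => flat_of_ringHom_bijective φ (trRho B 0) ⟨trRho_injective, fun b => ⟨algebraMap B _ b, trRho_algebraMap b⟩⟩ h
  | n + 1, φ, h => by
    have h' : ∀ a, trRho B n ((trRed B n).comp φ a) = algebraMap A B a := fun a => (trRho_trRed _).trans (h a)
    refine flat_of_ringHom_exact φ (trRed B n) trRed_surjective (tr_flat _ h')
      ((AddMonoidHom.mulRight (trX B (n + 1) ^ (n + 1))).comp (algebraMap B (Tr B (n + 1))).toAddMonoidHom) ?_ ?_ ?_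
    · intro b b' hb
      rw [← trCoeff_mul_trX_pow (n := n + 1) b, ← trCoeff_mul_trX_pow (n := n + 1) b']
      exact congrArg _ hb
    · intro a b
      change algebraMap B _ (algebraMap A B a * b) * trX B (n + 1) ^ (n + 1) = φ a * (algebraMap B _ b * trX B (n + 1) ^ (n + 1))
      rw [mul_left_comm, mul_trX_pow (φ a), h, map_mul, ← mul_assoc,
        mul_comm (algebraMap B (Tr B (n + 1)) b)]
    · intro t
      refine ⟨fun ht => trRed_eq_zero ht, ?_⟩
      rintro ⟨b, rfl⟩
      exact (map_mul (trRed B n) (algebraMap B _ b) _).trans (by rw [trRed_trX_pow, mul_zero])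

theorem tr_twist [IsNoetherianRing A] (φ α : A →+* Tr B n)
    (hφ : ∀ a, trRho B n (φ a) = algebraMap A B a)
    (hα : ∀ a, trRho B n (α a) = algebraMap A B a) (I J : Ideal A) (i j : ℕ) :
    Nonempty (BC φ (LC J i (LC I j A)) ≃ₗ[Tr B n] BC α (LC J i (LC I j A))) :=
  bc_lc_lc_twist φ α (tr_flat φ hφ) (tr_flat α hα) (n + 2)
    (tr_map_pow_le φ α fun a => (hφ a).trans (hα a).symm) (tr_map_pow_le α φ fun a => (hα a).trans (hφ a).symm) I J i j

end
end ZhouLC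

namespace ZhouLC
open Abelian Limits IsLocalRing TensorProduct

section
variable {A S T : Type} [CommRing A] [CommRing S] [CommRing T] (φ : A →+* S) (ψ : A →+* T)

/-- A semilinear map of coefficient rings induces a map of extensions of scalars. -/
theorem exists_bc_coeff (χ : S →+ T) (hχ : ∀ a s, χ (φ a * s) = ψ a * χ s) (N : Type)
    [AddCommGroup N] [Module A N] :
    ∃ F : BC φ N →+ BC ψ N, ∀ s z, F (bct φ s z) = bct ψ (χ s) z := by
  let _ := φ.toAlgebra
  let _ := ψ.toAlgebra
  let χ' : S →ₗ[A] T := { χ with map_smul' := hχ }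
  exact ⟨(χ'.rTensor N).toAddMonoidHom, fun s z => rfl⟩

theorem exists_bc_reduce (ρ : S →+* T) (hρ : Function.Surjective ρ) (h : ∀ a, ρ (φ a) = ψ a) (x : S)
    (hx : ∀ s, ρ s = 0 → ∃ s', s = x * s') (N : Type) [AddCommGroup N] [Module A N] :
    ∃ F :
    BC φ N →+ BC ψ N, (∀ s z, F (bct φ s z) = bct ψ (ρ s) z) ∧ ∀ w, F w = 0 → ∃ v, w = x • v := by
  let _ := φ.toAlgebra
  let _ := ψ.toAlgebra
  let χ : S →ₗ[A] T := { ρ with map_smul' := fun a s => (map_mul ρ (φ a) s).trans (by rw [h]; rfl) }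
  refine ⟨(χ.rTensor N).toAddMonoidHom, fun s z => rfl, fun w hw => ?_⟩
  obtain ⟨u, rfl⟩ := (rTensor_exact N (LinearMap.exact_subtype_ker_map χ) hρ w).1 hw
  clear hw
  induction u using TensorProduct.induction_on with
  | zero => exact ⟨0, by rw [smul_zero, map_zero]; rfl⟩
  | tmul s z =>
    obtain ⟨s, hs⟩ := s
    obtain ⟨s', rfl⟩ := hx s hs
    exact ⟨bct φ s' z, rfl⟩
  | add u v hu hv =>
    obtain ⟨u', hu'⟩ := hu
    obtain ⟨v', hv'⟩ := hv
    exact ⟨u' + v', by rw [map_add, smul_add, hu', hv']; rfl⟩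

theorem bc_smul_map {N : Type} [AddCommGroup N] [Module A N] (a : A) (w : BC φ N) :
    bcMap φ (a • LinearMap.id) w = φ a • w := by
  induction w using bc_induction with
  | h0 => rw [map_zero, smul_zero]
  | ht s z => rw [bcMap_bct, LinearMap.smul_apply, LinearMap.id_apply, bct_smul]
  | ha x y hx hy => rw [map_add, smul_add, hx, hy]

/-- The kernel of multiplication. -/
abbrev sker (N : Type) [AddCommGroup N] [Module A N] (a : A) :
    Submodule A N := LinearMap.ker (a • (LinearMap.id : N →ₗ[A] N))

theorem bc_sker (hφ : φ.Flat) {N : Type} [AddCommGroup N] [Module A N] (a : A) (w : BC φ N)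
    (hw : φ a • w = 0) :
    ∃ u, bcMap φ (sker N a).subtype u = w :=
  (bcMap_exact φ hφ (LinearMap.exact_subtype_ker_map (a • (LinearMap.id : N →ₗ[A] N))) w).1 ((bc_smul_map φ a w).trans hw)

theorem smul_bcMap_sker {N : Type} [AddCommGroup N] [Module A N] (a : A) (u : BC φ (sker N a)) :
    φ a • bcMap φ (sker N a).subtype u = 0 := by
  induction u using bc_induction with
  | h0 => rw [map_zero, smul_zero]
  | ht s z =>
    rw [bcMap_bct, ← bct_smul]
    exact (congrArg _ z.2).trans (bct_zero φ s)
  | ha x y hx hy => rw [map_add, smul_add, hx, hy, add_zero]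

theorem bc_sker_twist (α : A →+* S) (hφ : φ.Flat) (hα : α.Flat) {N : Type} [AddCommGroup N]
    [Module A N] (a : A) (h : φ a = α a)
    (e : BC φ N ≃ₗ[S] BC α N) : Nonempty (BC φ (sker N a) ≃ₗ[S] BC α (sker N a)) := by
  let f := e.toLinearMap.comp (bcMap φ (sker N a).subtype)
  let g := bcMap α (sker N a).subtype
  have hf : Function.Injective f := e.injective.comp (bcMap_injective φ hφ (Submodule.subtype_injective _))
  have hg : Function.Injective g := bcMap_injective α hα (Submodule.subtype_injective _)
  have hr : LinearMap.range f = LinearMap.range g := by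
    ext w
    constructor
    · rintro ⟨u, rfl⟩
      exact bc_sker α hα a _ ((map_smul e (α a) _).symm.trans (by rw [← h, smul_bcMap_sker,
        map_zero]))
    · rintro ⟨u, rfl⟩
      obtain ⟨v, hv⟩ := bc_sker φ hφ a (e.symm (g u)) (by rw [← map_smul, h, smul_bcMap_sker,
        map_zero])
      exact ⟨v, (congrArg e hv).trans (e.apply_symm_apply _)⟩
  exact ⟨(LinearEquiv.ofInjective f hf).trans ((LinearEquiv.ofEq _ _ hr).trans (LinearEquiv.ofInjective g hg).symm)⟩

theorem bct_one_eq_zero (hφ : φ.FaithfullyFlat) {N : Type} [AddCommGroup N] [Module A N] {z : N}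
    (h : bct φ 1 z = 0) : z = 0 := by
  let _ := φ.toAlgebra
  have : Module.FaithfullyFlat A S := hφ
  exact (Module.FaithfullyFlat.one_tmul_eq_zero_iff A N (A := S) z).1 h

end

section
variable {A B : Type} [CommRing A] [CommRing B] [Algebra A B]

variable (A B) in
/-- The constant embedding into the truncated polynomial ring. -/
noncomputable def trC (n : ℕ) : A →+* Tr B n := (algebraMap B (Tr B n)).comp (algebraMap A B)

theorem trRho_trC (n : ℕ) (a : A) : trRho B n (trC A B n a) = algebraMap A B a := trRho_algebraMap _

/-- A twisted form of `N` along a deformation that moves `x` forces divisibility by `x`. -/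
theorem exists_smul_eq_of_twist (hB : (algebraMap A B).FaithfullyFlat) {N : Type} [AddCommGroup N]
    [Module A N] (x : A) (n : ℕ)
    (φ : A →+* Tr B n) (hφ : ∀ a, trRho B n (φ a) = algebraMap A B a)
    (hx : φ x = trC A B n x + trX B n)
    (σ : BC φ N ≃ₗ[Tr B n] BC (trC A B n) N) (z : N) (hz : x ^ n • z = 0) : ∃ z', x • z' = z := by
  let α := trC A B n
  let ψ := algebraMap A B
  have hψ : ψ.Flat := hB.flat
  obtain ⟨r, hr, hr0⟩ := exists_bc_reduce φ ψ (trRho B n) (fun b => ⟨_, trRho_algebraMap b⟩) hφ (trX B n) (fun s => trRho_eq_zero) N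
  have hsemi : ∀ s w, r (s • w) = trRho B n s • r w := by
    intro s w
    induction w using bc_induction with
    | h0 => rw [smul_zero, map_zero, smul_zero]
    | ht t m => rw [smul_bct, hr, hr, smul_bct, map_mul]
    | ha v w hv hw => rw [smul_add, map_add, map_add, smul_add, hv, hw]
  let w := σ.symm (bct α 1 z)
  have hw : α (x ^ n) • w = 0 := by rw [← map_smul, ← bct_smul, hz, bct_zero, map_zero]
  obtain ⟨u, hu⟩ := bc_sker ψ hψ (x ^ n) (r w) (by
    have h1 := hsemi (α (x ^ n)) w
    rw [hw, map_zero, trRho_trC] at h1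
    exact h1.symm)
  obtain ⟨u', hu'⟩ : ∃ u' : BC φ (sker N (x ^ n)), r (bcMap φ (sker N (x ^ n)).subtype u') = r w := by
    rw [← hu]
    clear hu
    induction u using bc_induction with
    | h0 => exact ⟨0, by rw [map_zero, map_zero, map_zero]⟩
    | ht s m => exact ⟨bct φ (algebraMap B _ s) m, by rw [bcMap_bct, bcMap_bct, hr,
      trRho_algebraMap]⟩
    | ha u v hu hv =>
      obtain ⟨u', hu'⟩ := hu
      obtain ⟨v', hv'⟩ := hv
      exact ⟨u' + v', by rw [map_add, map_add, map_add, hu', hv']⟩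
  obtain ⟨v, hv⟩ := hr0 (w - bcMap φ (sker N (x ^ n)).subtype u') (by rw [map_sub, hu', sub_self])
  obtain ⟨y, hy⟩ : ∃ y, trX B n ^ n • bct α 1 z = α x • y := by
    have h1 : σ w = bct α 1 z := σ.apply_symm_apply _
    have h2 : trX B n ^ n • w = trX B n ^ n • bcMap φ (sker N (x ^ n)).subtype u' := by
      rw [← sub_eq_zero, ← smul_sub, hv, smul_smul, ← pow_succ, trX_pow]
      exact zero_smul (Tr B n) v
    have h3 : φ x ^ n • bcMap φ (sker N (x ^ n)).subtype u' = 0 := by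
      rw [← map_pow]
      exact smul_bcMap_sker φ _ _
    obtain ⟨c, hc⟩ : trX B n - φ x ∣ trX B n ^ n - φ x ^ n := sub_dvd_pow_sub_pow _ _ _
    have h4 : trX B n ^ n • bcMap φ (sker N (x ^ n)).subtype u' = α x • (-c) • bcMap φ (sker N (x ^ n)).subtype u' := by
      have h5 : trX B n ^ n = φ x ^ n + α x * -c := by
        rw [← sub_eq_iff_eq_add', hc, hx]
        ring
      rw [h5, add_smul, h3, zero_add, mul_smul]
    refine ⟨σ ((-c) • bcMap φ (sker N (x ^ n)).subtype u'), ?_⟩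
    rw [← map_smul, ← h4, ← h2, map_smul, h1]
  let q := (LinearMap.range (x • (LinearMap.id : N →ₗ[A] N))).mkQ
  have hq : ∀ m, x • q m = 0 := fun m =>
    (map_smul q x m).symm.trans ((Submodule.Quotient.mk_eq_zero _).2 ⟨m, rfl⟩)
  have hkill : ∀ y, α x • bcMap α q y = 0 := by
    intro y
    induction y using bc_induction with
    | h0 => rw [map_zero, smul_zero]
    | ht s m => rw [bcMap_bct, ← bct_smul, hq, bct_zero]
    | ha u v hu hv => rw [map_add, smul_add, hu, hv, add_zero]
  obtain ⟨F, hF⟩ := exists_bc_coeff α ψ (trCoeff B n n le_rfl).toAddMonoidHom (fun a s => by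
    have h1 : (algebraMap A B a) • s = α a * s := Algebra.smul_def (algebraMap A B a) s
    rw [← h1]
    exact map_smul (trCoeff B n n le_rfl) _ _) (N ⧸ LinearMap.range (x • (LinearMap.id : N →ₗ[A] N)))
  have h5 : bct ψ 1 (q z) = 0 := by
    have h6 := congrArg (fun t => F (bcMap α q t)) hy
    change F (bcMap α q (trX B n ^ n • bct α 1 z)) = F (bcMap α q (α x • y)) at h6
    rw [map_smul (bcMap α q), map_smul (bcMap α q), hkill, map_zero, bcMap_bct, smul_bct, hF,
      mul_one] at h6
    have h7 := trCoeff_mul_trX_pow (n := n) (1 : B)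
    rw [map_one, one_mul] at h7
    rw [← h6]
    exact congrArg (fun t => bct ψ t (q z)) h7.symm
  have h6 := bct_one_eq_zero ψ hB h5
  exact (Submodule.Quotient.mk_eq_zero _).1 h6

end
end ZhouLC

namespace ZhouLC
open Abelian Limits IsLocalRing TensorProduct

section
variable {A : Type} [CommRing A]

theorem ev_of_sker {J : Ideal A} {x : A} (hx : x ∈ J) {N : Type} [AddCommGroup N] [Module A N]
    (hs : ∀ z : N, ∃ z', x • z' = z) {l : ℕ} (h : EV A (A ⧸ J) (sker N x) (l + 1)) :
    EV A (A ⧸ J) N l := by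
  refine subsingleton_of_forall_eq 0 fun a => ?_
  obtain ⟨b, rfl⟩ := Abelian.Ext.covariant_sequence_exact₃ (ModuleCat.of A (A ⧸ J))
    (sc_exact (f := (sker N x).subtype) (g := x • (LinearMap.id : N →ₗ[A] N)) (Submodule.subtype_injective _) hs (LinearMap.exact_subtype_ker_map (x • (LinearMap.id : N →ₗ[A] N)))) a
    (n₁ := l + 1) rfl (h.elim _ _)
  refine (ext_smul x b).trans ?_
  have h0 : x • (LinearMap.id : (A ⧸ J) →ₗ[A] (A ⧸ J)) = 0 := by
    refine LinearMap.ext fun y => ?_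
    obtain ⟨y, rfl⟩ := Ideal.Quotient.mk_surjective y
    exact Ideal.Quotient.eq_zero_iff_mem.2 (Ideal.mul_mem_right _ _ hx)
  rw [← smul_ext x b, h0, ModuleCat.ofHom_zero, Abelian.Ext.mk₀_zero, Abelian.Ext.zero_comp]

variable {B : Type} [CommRing B] [Algebra A B]

variable (B) in
/-- All deformations of `A` to `B[X]/(X^(n+1))` that fix the elements of `F` give isomorphic extensions of `N`. -/
def TwistInvariant (F : List A) (N : Type) [AddCommGroup N] [Module A N] : Prop :=
  ∀ (n : ℕ) (φ : A →+* Tr B n), (∀ a, trRho B n (φ a) = algebraMap A B a) → (∀ y ∈ F, φ y = trC A B n y) →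
    Nonempty (BC φ N ≃ₗ[Tr B n] BC (trC A B n) N)

theorem TwistInvariant.sker [Module.Flat A B] {F : List A} {N : Type} [AddCommGroup N] [Module A N]
    (h : TwistInvariant B F N) (x : A) :
    TwistInvariant B (x :: F) (sker N x) := by
  intro n φ hφ hF
  obtain ⟨e⟩ := h n φ hφ fun y hy => hF y (List.mem_cons_of_mem _ hy)
  exact bc_sker_twist φ (trC A B n) (tr_flat φ hφ) (tr_flat _ (trRho_trC n)) x (hF x List.mem_cons_self) e

theorem ev_of_twistInvariant [Module.FaithfullyFlat A B] {J : Ideal A} {xs : List A}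
    (hxs : ∀ (n : ℕ) (c : A → B), ∃ φ : A →+* Tr B n, (∀ a, trRho B n (φ a) = algebraMap A B a) ∧
      ∀ x ∈ xs, φ x = algebraMap B _ (algebraMap A B x) + algebraMap B _ (c x) * trX B n) (hJ : ∀ x ∈ xs, x ∈ J)
    (rs : List A) : ∀ (F : List A) (_ : (rs ++ F).Nodup) (_ : rs ⊆ xs) (_ : F ⊆ xs)
    (N : Type) [AddCommGroup N] [Module A N] (_ : TwistInvariant B F N)
    (_ : ∀ x ∈ J, ∀ z : N, ∃ n : ℕ, x ^ n • z = 0)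
    (l : ℕ) (_ : ∀ (Y : Type) [AddCommGroup Y] [Module A Y], EV A (A ⧸ J) Y (l + rs.length)), EV A
    (A ⧸ J) N l := by
  induction rs with
  | nil =>
    intro F _ _ _ N _ _ _ _ l h
    exact h N
  | cons x rs ih =>
    intro F hnd hrs hF N _ _ hN htors l h
    have hx := hrs List.mem_cons_self
    have hnd' : (rs ++ (x :: F)).Nodup := (List.perm_middle.nodup_iff).2 hnd
    refine ev_of_sker (hJ x hx) (fun z => ?_) (ih (x :: F) hnd' (fun y hy => hrs (List.mem_cons_of_mem _ hy))
      (List.cons_subset.2 ⟨hx, hF⟩) _ (hN.sker x) (fun y hy z => ?_) (l + 1) fun Y _ _ => ?_)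
    · obtain ⟨n, hn⟩ := htors x (hJ x hx) z
      classical
      obtain ⟨φ, hφ, hφx⟩ := hxs n fun y => if y = x then 1 else 0
      obtain ⟨σ⟩ := hN n φ hφ fun y hy => by
        have hyx : y ≠ x := by
          rintro rfl
          exact (List.nodup_cons.1 hnd).1 (List.mem_append_right _ hy)
        rw [hφx y (hF hy), if_neg hyx, map_zero, zero_mul, add_zero]
        rfl
      refine exists_smul_eq_of_twist (RingHom.faithfullyFlat_algebraMap_iff.2 inferInstance) x n φ hφ ?_ σ z hn
      rw [hφx x hx, if_pos rfl, map_one, one_mul]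
      rfl
    · obtain ⟨n, hn⟩ := htors y hy z.1
      exact ⟨n, Subtype.ext hn⟩
    · have e : l + 1 + rs.length = l + (x :: rs).length := by rw [List.length_cons]; omega
      rw [e]
      exact h Y

variable [IsNoetherianRing A] [IsLocalRing A]

theorem ev_lc_lc (hA : Good A) (I : Ideal A) (i j : ℕ) (X : Type) [AddCommGroup X] [Module A X] :
    EV A X (LC (maximalIdeal A) i (LC I j A)) 2 := by
  obtain ⟨p, ys, xs, _, hp, hw, hm⟩ := hA
  let B := AdicCompletion (maximalIdeal A) A
  have hB : IsAdicComplete ((maximalIdeal A).map (algebraMap A B)) B :=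
    AdicCompletion.isAdicComplete_self _ (maximalIdeal A).fg_of_isNoetherianRing
  have : Module.FaithfullyFlat A B := Module.FaithfullyFlat.of_flat_of_isLocalHom
  have htors : ∀ x ∈ maximalIdeal A, ∀ z : LC (maximalIdeal A) i (LC I j A), ∃ n : ℕ, x ^ n • z = 0 :=
    fun x hx z => lc_pow_torsion _ hx z
  have hnd := (wr_nodup _ ⊥ hw (by rw [bot_sup_eq, hm]; exact Ideal.IsPrime.ne_top')).2
  have hmem : ∀ x ∈ xs, x ∈ maximalIdeal A := fun x hx => by
    rw [← hm]
    exact Ideal.subset_span (List.mem_append_right _ hx)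
  refine ev_of_residue htors 1 ?_ X
  refine ev_of_twistInvariant (B := B) (exists_deformation hB hp hw hm) hmem xs []
    (by rw [List.append_nil]; exact hnd.of_append_right) (List.Subset.refl _) (List.nil_subset _) _
    (fun n φ hφ _ => tr_twist φ _ hφ (trRho_trC n) I (maximalIdeal A) i j) htors 2 fun Y _ _ => ?_
  have hys : ys.length ≤ 1 := by
    rcases hp with ⟨_, rfl⟩ | ⟨_, rfl⟩
    · exact Nat.zero_le _
    · exact le_rfl
  have hl := ev_residue_of_wr hw hm Y (1 - ys.length)
  have e : (ys ++ xs).length + 1 + (1 - ys.length) = 2 + xs.length := by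
    rw [List.length_append]; omega
  rwa [e] at hl

end
end ZhouLC

namespace ZhouLC
open Abelian Limits IsLocalRing TensorProduct

section
variable {A : Type} [CommRing A]

theorem krullDim_support_cases {M : Type} [AddCommGroup M] [Module A M] {l : ℕ}
    (h : Order.krullDim (Module.support A M) + 1 < (l : WithBot ℕ∞)) :
    Subsingleton M ∨ ∃ d : ℕ, Order.krullDim (Module.support A M) = d ∧ d + 1 < l := by
  by_cases hM : Subsingleton M
  · exact Or.inl hM
  · rw [not_subsingleton_iff_nontrivial] at hM
    have : Nonempty (Module.support A M) := (Module.nonempty_support_of_nontrivial (R := A) (M := M)).to_subtype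
    have h0 : Order.krullDim (Module.support A M) ≠ ⊥ := ne_of_gt (Order.bot_lt_krullDim)
    obtain ⟨e, he⟩ := WithBot.ne_bot_iff_exists.1 h0
    rw [← he] at h ⊢
    have h1 : e + 1 < (l : ℕ∞) := by exact_mod_cast h
    have h2 : e ≠ ⊤ := by
      rintro rfl
      rw [top_add] at h1
      exact not_top_lt h1
    obtain ⟨d, rfl⟩ := ENat.ne_top_iff_exists.1 h2
    exact Or.inr ⟨d, rfl, by exact_mod_cast h1⟩

variable [IsNoetherianRing A]

theorem ev_residue_lc [IsLocalRing A] (hA : Good A) (I : Ideal A) (j l : ℕ)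
    (h : Order.krullDim (Module.support A (LC I j A)) + 1 < (l : WithBot ℕ∞)) :
    EV A (A ⧸ maximalIdeal A) (LC I j A) l := by
  rcases krullDim_support_cases h with h | ⟨d, hd, hl⟩
  · exact EV.of_subsingleton_right l
  · have h1 := ev_of_lc_injdim (maximalIdeal A) d (LC I j A) (fun i X _ _ => ev_lc_lc hA I i j X) (fun i hi => lc_vanish _ i fun m => by
      refine (krullDim_torsionOf_le m).trans_lt ?_
      rw [hd]
      exact_mod_cast hi) (l - (d + 2))
    have e : d + 2 + (l - (d + 2)) = l := by omega
    rwa [e] at h1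

theorem ev_lc (hA : ∀ (P : Ideal A) [P.IsPrime], Good (Localization.AtPrime P)) (I : Ideal A)
    (j l : ℕ)
    (h : Order.krullDim (Module.support A (LC I j A)) + 1 < (l : WithBot ℕ∞)) (X : Type)
    [AddCommGroup X] [Module A X] :
    EV A X (LC I j A) l := by
  rcases krullDim_support_cases h with h | ⟨d, hd, hl⟩
  · exact EV.of_subsingleton_right l
  · obtain ⟨l, rfl⟩ := Nat.exists_eq_add_one_of_ne_zero (Nat.ne_zero_of_lt hl)
    refine ev_of_localized l _ (fun P _ => ?_) X
    obtain ⟨e⟩ := lc_localized I j P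
    refine EV.congr (LinearEquiv.refl _ _) e.symm (ev_residue_lc (hA P) _ j _ ?_)
    rw [← e.support_eq]
    exact (add_le_add_left (krullDim_support_localized_le P) 1).trans_lt h

end
end ZhouLC

/-- **Zhou.** Let `(R, 𝔪)` be an unramified regular local ring of mixed characteristic `(0, p)`
(regularity: `𝔪` is generated by `dim R` elements; unramified: `p ∉ 𝔪²`) and `I` an ideal.
Then for all `i, j`: `injdim_R H^j_I(R) ≤ dim Supp H^j_I(R) + 1` and
`injdim_R H^i_𝔪(H^j_I(R)) ≤ 1`, where injective dimension is expressed via the standard Ext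
characterization. -/
theorem zhou_injective_dimension_mixed_char
    (R : Type) [CommRing R] [IsNoetherianRing R] [IsLocalRing R]
    (hreg : ∃ s : Finset R, Ideal.span (s : Set R) = IsLocalRing.maximalIdeal R ∧
      (s.card : WithBot ℕ∞) = ringKrullDim R)
    [CharZero R] (p : ℕ) (hp : p.Prime) [CharP (IsLocalRing.ResidueField R) p]
    (hunram : (p : R) ∉ IsLocalRing.maximalIdeal R ^ 2)
    (I : Ideal R) (i j : ℕ) :
    (∀ (N : ModuleCat R) (l : ℕ),
        Order.krullDim (Module.support R ((localCohomology I j).obj (ModuleCat.of R R))) + 1 <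
          (l : WithBot ℕ∞) →
        Subsingleton (((Ext R (ModuleCat R) l).obj (Opposite.op N)).obj
          ((localCohomology I j).obj (ModuleCat.of R R)))) ∧
      (∀ (N : ModuleCat R) (l : ℕ), 1 < l →
        Subsingleton (((Ext R (ModuleCat R) l).obj (Opposite.op N)).obj
          ((localCohomology (IsLocalRing.maximalIdeal R) i).obj
            ((localCohomology I j).obj (ModuleCat.of R R))))) := by
  have hpm : (p : R) ∈ IsLocalRing.maximalIdeal R := by
    rw [← IsLocalRing.residue_eq_zero_iff, map_natCast, CharP.cast_eq_zero]
  obtain ⟨xs, hw, hm⟩ := ZhouLC.exists_regular_parameters hreg hpm hunram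
  refine ⟨fun N l h => ?_, fun N l h => ?_⟩
  · have h1 := ZhouLC.ev_lc (fun P _ => ZhouLC.good_localization hp hpm hw hm P) I j l h N
    exact (ZhouLC.extEquiv N _ l).toEquiv.subsingleton_congr.2 h1
  · have h1 := ZhouLC.EV.all_le (ZhouLC.ev_lc_lc ⟨p, [(p : R)], xs, inferInstance, Or.inr ⟨hp, rfl⟩, hw, hm⟩ I i j) h N
    exact (ZhouLC.extEquiv N _ l).toEquiv.subsingleton_congr.2 h1
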